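/- Fix an integer d ≥ 2 and a real c > c_d^*, and let t_c be the smallest root in (0,1) of t = e^{−c(1−t)^d}. Then asymptotically almost surely, dim ker ∂_d(Y_d(n, c/n)) = C(n,d)·(1+o(1))·( c·t_c·(1−t_c)^d + (c/(d+1))·(1−t_c)^{d+1} − (1−t_c) ); that is, for every ε > 0, the probability that | dim ker ∂_d(Y_d(n,c/n)) / C(n,d) − ( c·t_c·(1−t_c)^d + (c/(d+1))·(1−t_c)^{d+1} − (1−t_c) ) | ≤ ε tends to 1 as n → ∞. -/

import Mathlib

open Finset Filter
open scoped Classical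

noncomputable section

/-- The set of all possible `d`-faces: `(d+1)`-element subsets of `[n]`. -/
def allFaces (n d : ℕ) : Finset (Finset (Fin n)) :=
  Finset.univ.filter (fun σ => σ.card = d + 1)

/-- Probability of the event `E` under `Y_d(n,p)`. -/
def probY (n d : ℕ) (p : ℝ) (E : Finset (Finset (Fin n)) → Prop) : ℝ :=
  ∑ F ∈ (allFaces n d).powerset,
    if E F then p ^ F.card * (1 - p) ^ ((allFaces n d).card - F.card) else 0

/-- Expectation of `X` under `Y_d(n,p)`. -/
def expectY (n d : ℕ) (p : ℝ) (X : Finset (Finset (Fin n)) → ℝ) : ℝ :=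
  ∑ F ∈ (allFaces n d).powerset,
    p ^ F.card * (1 - p) ^ ((allFaces n d).card - F.card) * X F

/-- Coefficient of the `d`-face `τ` in the boundary of `σ`. -/
def bdCoeff {n : ℕ} (τ σ : Finset (Fin n)) : ℝ :=
  if τ ⊆ σ ∧ τ.card + 1 = σ.card then
    ∑ v ∈ σ \ τ, (-1 : ℝ) ^ (σ.filter (fun w => w < v)).card
  else 0

/-- The boundary operator `∂_d(F) : ℝ^F → ℝ^{(d-1)-faces}`. -/
def boundaryMap (n : ℕ) (F : Finset (Finset (Fin n))) :
    (↥F → ℝ) →ₗ[ℝ] (Finset (Fin n) → ℝ) where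
  toFun x := fun τ => ∑ σ ∈ F.attach, x σ * bdCoeff τ σ.1
  map_add' x y := by
    funext τ
    simp [add_mul, Finset.sum_add_distrib]
  map_smul' c x := by
    funext τ
    simp [Finset.mul_sum, mul_assoc]

/-- Dimension of the kernel of `∂_d(F)`, i.e. `dim H_d`. -/
def dimKer (n : ℕ) (F : Finset (Finset (Fin n))) : ℕ :=
  Module.finrank ℝ (LinearMap.ker (boundaryMap n F))

/-- The real shadow of `F`. -/
def shadowR (n d : ℕ) (F : Finset (Finset (Fin n))) : Finset (Finset (Fin n)) :=
  (allFaces n d).filter (fun σ => σ ∉ F ∧ dimKer n F < dimKer n (insert σ F))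

/-- The `(d+2)`-subsets all of whose `(d+1)`-subsets are faces of `F`. -/
def simplexBoundaries (n d : ℕ) (F : Finset (Finset (Fin n))) : Finset (Finset (Fin n)) :=
  Finset.univ.filter (fun τ => τ.card = d + 2 ∧ ∀ s ∈ τ.powerset, s.card = d + 1 → s ∈ F)

/-- The boundary cycle of the `(d+2)`-subset `τ`, as a vector in `ℝ^F`. -/
def simplexCycle (n : ℕ) (F : Finset (Finset (Fin n))) (τ : Finset (Fin n)) : ↥F → ℝ :=
  fun σ => bdCoeff σ.1 τ

namespace LP

section Bern
set_option linter.unusedSectionVars false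
variable {α : Type*} [DecidableEq α]

/-- Expectation with respect to a `p`-random subset of `S`. -/
def bE (S : Finset α) (p : ℝ) (X : Finset α → ℝ) : ℝ :=
  ∑ F ∈ S.powerset, p ^ F.card * (1 - p) ^ (S.card - F.card) * X F

lemma bE_empty (p : ℝ) (X : Finset α → ℝ) : bE ∅ p X = X ∅ := by
  simp [bE]

lemma bE_insert {S : Finset α} {σ : α} (h : σ ∉ S) (p : ℝ) (X : Finset α → ℝ) :
    bE (insert σ S) p X = (1 - p) * bE S p X + p * bE S p (fun F => X (insert σ F)) := by
  unfold bE
  rw [Finset.sum_powerset_insert h, mul_sum, mul_sum]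
  congr 1
  · refine sum_congr rfl fun F hF => ?_
    have h1 : F.card ≤ S.card := card_le_card (mem_powerset.1 hF)
    rw [card_insert_of_notMem h, show S.card + 1 - F.card = (S.card - F.card) + 1 by omega, pow_succ]
    ring
  · refine sum_congr rfl fun F hF => ?_
    have h1 : σ ∉ F := fun h' => h (mem_powerset.1 hF h')
    rw [card_insert_of_notMem h, card_insert_of_notMem h1, Nat.add_sub_add_right, pow_succ]
    ring

lemma bE_congr {S : Finset α} {p : ℝ} {X Y : Finset α → ℝ} (h : ∀ F ⊆ S, X F = Y F) :
    bE S p X = bE S p Y :=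
  sum_congr rfl fun F hF => by rw [h F (mem_powerset.1 hF)]

lemma bE_add (S : Finset α) (p : ℝ) (X Y : Finset α → ℝ) :
    bE S p (fun F => X F + Y F) = bE S p X + bE S p Y := by
  simp [bE, mul_add, sum_add_distrib]

lemma bE_sub (S : Finset α) (p : ℝ) (X Y : Finset α → ℝ) :
    bE S p (fun F => X F - Y F) = bE S p X - bE S p Y := by
  simp [bE, mul_sub, sum_sub_distrib]

lemma bE_mul (S : Finset α) (p c : ℝ) (X : Finset α → ℝ) :
    bE S p (fun F => c * X F) = c * bE S p X := by
  simp only [bE, mul_sum]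
  exact sum_congr rfl fun F _ => by ring

lemma bE_sum {ι : Type*} (S : Finset α) (p : ℝ) (T : Finset ι) (X : ι → Finset α → ℝ) :
    bE S p (fun F => ∑ i ∈ T, X i F) = ∑ i ∈ T, bE S p (X i) := by
  simp only [bE, mul_sum]
  exact sum_comm

lemma bE_const (S : Finset α) (p c : ℝ) : bE S p (fun _ => c) = c := by
  induction S using Finset.induction_on with
  | empty => simp [bE_empty]
  | insert σ S h ih => rw [bE_insert h, ih]; ring

lemma bE_nonneg {S : Finset α} {p : ℝ} (hp0 : 0 ≤ p) (hp1 : p ≤ 1) {X : Finset α → ℝ}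
    (h : ∀ F ⊆ S, 0 ≤ X F) : 0 ≤ bE S p X := by
  refine sum_nonneg fun F hF => ?_
  have := h F (mem_powerset.1 hF)
  have : 0 ≤ 1 - p := by linarith
  positivity

lemma bE_mono {S : Finset α} {p : ℝ} (hp0 : 0 ≤ p) (hp1 : p ≤ 1) {X Y : Finset α → ℝ}
    (h : ∀ F ⊆ S, X F ≤ Y F) : bE S p X ≤ bE S p Y := by
  have := bE_nonneg (S := S) hp0 hp1 (X := fun F => Y F - X F)
    (fun F hF => sub_nonneg.2 (h F hF))
  rw [bE_sub] at this
  linarith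

lemma bE_abs {S : Finset α} {p : ℝ} (hp0 : 0 ≤ p) (hp1 : p ≤ 1) (X : Finset α → ℝ) :
    |bE S p X| ≤ bE S p (fun F => |X F|) := by
  rw [abs_le]
  constructor
  · have := bE_mono (S := S) hp0 hp1 (X := fun F => (-1) * |X F|) (Y := X)
      (fun F _ => by have := neg_abs_le (X F); linarith)
    rw [bE_mul] at this
    linarith
  · exact bE_mono hp0 hp1 fun F _ => le_abs_self _

lemma bE_sq_le {S : Finset α} {p : ℝ} (hp0 : 0 ≤ p) (hp1 : p ≤ 1) (X : Finset α → ℝ) :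
    (bE S p X) ^ 2 ≤ bE S p (fun F => X F ^ 2) := by
  have h := bE_nonneg (S := S) hp0 hp1 (X := fun F => (X F - bE S p X) ^ 2)
    (fun F _ => sq_nonneg _)
  have e : bE S p (fun F => (X F - bE S p X) ^ 2)
      = bE S p (fun F => X F ^ 2) - (bE S p X) ^ 2 := by
    have : (fun F => (X F - bE S p X) ^ 2) =
        fun F => (X F ^ 2 - (2 * bE S p X) * X F) + (bE S p X) ^ 2 := by
      funext F; ring
    rw [this, bE_add, bE_const, bE_sub, bE_mul]; ring
  linarith

lemma bE_var_eq (S : Finset α) (p : ℝ) (X : Finset α → ℝ) :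
    bE S p (fun F => (X F - bE S p X) ^ 2) = bE S p (fun F => X F ^ 2) - (bE S p X) ^ 2 := by
  have : (fun F => (X F - bE S p X) ^ 2) =
      fun F => (X F ^ 2 - (2 * bE S p X) * X F) + (bE S p X) ^ 2 := by
    funext F; ring
  rw [this, bE_add, bE_const, bE_sub, bE_mul]; ring

/-- `E|X| ≤ sqrt (E X²)`. -/
lemma bE_abs_le_sqrt {S : Finset α} {p : ℝ} (hp0 : 0 ≤ p) (hp1 : p ≤ 1) (X : Finset α → ℝ) :
    bE S p (fun F => |X F|) ≤ Real.sqrt (bE S p (fun F => X F ^ 2)) := by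
  apply Real.le_sqrt_of_sq_le
  have := bE_sq_le (S := S) hp0 hp1 (fun F => |X F|)
  simpa using this

lemma bE_union {S T : Finset α} (h : Disjoint S T) (p : ℝ) (X : Finset α → ℝ) :
    bE (S ∪ T) p X = bE S p (fun F => bE T p (fun G => X (F ∪ G))) := by
  induction S using Finset.induction_on generalizing X with
  | empty => simp [bE_empty]
  | insert σ S hσ ih =>
    rw [disjoint_insert_left] at h
    rw [insert_union, bE_insert (by simp [hσ, h.1]), bE_insert hσ, ih h.2, ih h.2]
    simp only [insert_union]

/-- Efron–Stein inequality. -/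
lemma efron_stein {S : Finset α} {p : ℝ} (hp0 : 0 ≤ p) (hp1 : p ≤ 1) (X : Finset α → ℝ) :
    bE S p (fun F => (X F - bE S p X) ^ 2) ≤
      p * ∑ σ ∈ S, bE S p (fun F => (X (insert σ F) - X (F.erase σ)) ^ 2) := by
  rw [bE_var_eq]
  induction S using Finset.induction_on generalizing X with
  | empty => simp [bE_empty]
  | insert σ S hσ ih =>
    have h0 := ih X
    have h1 := ih (fun F => X (insert σ F))
    rw [sum_insert hσ]
    have hA : bE (insert σ S) p (fun F => (X (insert σ F) - X (F.erase σ)) ^ 2)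
        = bE S p (fun F => (X (insert σ F) - X F) ^ 2) := by
      rw [bE_insert hσ]
      have e1 : bE S p (fun F => (X (insert σ F) - X (F.erase σ)) ^ 2)
          = bE S p (fun F => (X (insert σ F) - X F) ^ 2) :=
        bE_congr fun F hF => by rw [erase_eq_of_notMem fun h => hσ (hF h)]
      have e2 : bE S p (fun F => (X (insert σ (insert σ F)) - X ((insert σ F).erase σ)) ^ 2)
          = bE S p (fun F => (X (insert σ F) - X F) ^ 2) :=
        bE_congr fun F hF => by
          rw [insert_idem, erase_insert fun h => hσ (hF h)]
      rw [e1, e2]; ring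
    have hB : ∑ ρ ∈ S, bE (insert σ S) p (fun F => (X (insert ρ F) - X (F.erase ρ)) ^ 2)
        = (1 - p) * ∑ ρ ∈ S, bE S p (fun F => (X (insert ρ F) - X (F.erase ρ)) ^ 2)
        + p * ∑ ρ ∈ S, bE S p (fun F => (X (insert σ (insert ρ F)) - X (insert σ (F.erase ρ))) ^ 2) := by
      rw [mul_sum, mul_sum, ← sum_add_distrib]
      refine sum_congr rfl fun ρ hρ => ?_
      rw [bE_insert hσ]
      congr 2
      refine bE_congr fun F hF => ?_
      have hne : ρ ≠ σ := fun h => hσ (h ▸ hρ)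
      rw [Finset.insert_comm, erase_insert_of_ne hne.symm]
    rw [hA, hB, bE_insert hσ, bE_insert hσ]
    have h2 := bE_sq_le (S := S) hp0 hp1 (fun F => X (insert σ F) - X F)
    rw [bE_sub] at h2
    set a := bE S p X
    set b := bE S p (fun F => X (insert σ F))
    set q := bE S p (fun F => (X (insert σ F) - X F) ^ 2)
    have hp' : 0 ≤ 1 - p := by linarith
    have h3 : p * (1 - p) * (b - a) ^ 2 ≤ p * q := by
      have h4 : (1 - p) * (b - a) ^ 2 ≤ q := by nlinarith [sq_nonneg (b - a)]
      nlinarith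
    nlinarith [mul_le_mul_of_nonneg_left h0 hp', mul_le_mul_of_nonneg_left h1 hp0]

/-- Harris' inequality for two decreasing functions. -/
lemma harris {S : Finset α} {p : ℝ} (hp0 : 0 ≤ p) (hp1 : p ≤ 1) {X Y : Finset α → ℝ}
    (hX : Antitone X) (hY : Antitone Y) :
    bE S p X * bE S p Y ≤ bE S p (fun F => X F * Y F) := by
  induction S using Finset.induction_on generalizing X Y with
  | empty => simp [bE_empty]
  | insert σ S hσ ih =>
    have hi : Monotone (fun F : Finset α => insert σ F) := fun A B h => insert_subset_insert _ h
    have h0 := ih hX hY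
    have h1 := ih (hX.comp_monotone hi) (hY.comp_monotone hi)
    have hXX : bE S p (fun F => X (insert σ F)) ≤ bE S p X :=
      bE_mono hp0 hp1 fun F _ => hX (subset_insert _ _)
    have hYY : bE S p (fun F => Y (insert σ F)) ≤ bE S p Y :=
      bE_mono hp0 hp1 fun F _ => hY (subset_insert _ _)
    simp only [bE_insert hσ]
    simp only [Function.comp_def] at h1
    have hp' : 0 ≤ 1 - p := by linarith
    nlinarith [mul_le_mul_of_nonneg_left h0 hp', mul_le_mul_of_nonneg_left h1 hp0,
      mul_nonneg (mul_nonneg hp0 hp') (mul_nonneg (sub_nonneg.2 hXX) (sub_nonneg.2 hYY))]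

lemma bE_map (e : Equiv.Perm α) {S : Finset α} (hS : S.map e.toEmbedding = S) (p : ℝ)
    (X : Finset α → ℝ) : bE S p (fun F => X (F.map e.toEmbedding)) = bE S p X := by
  unfold bE
  refine sum_bij (fun F _ => F.map e.toEmbedding) ?_ ?_ ?_ ?_
  · intro F hF
    rw [mem_powerset] at hF ⊢
    rw [← hS]; exact map_subset_map.2 hF
  · intro F _ G _ h
    exact map_injective _ h
  · intro G hG
    refine ⟨G.map e.symm.toEmbedding, ?_, ?_⟩
    · rw [mem_powerset] at hG ⊢
      intro x hx
      rw [Finset.mem_map] at hx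
      obtain ⟨y, hy, rfl⟩ := hx
      have := hG hy
      rw [← hS, Finset.mem_map] at this
      obtain ⟨z, hz, rfl⟩ := this
      simpa using hz
    · ext x; simp
  · intro F _; simp

lemma bE_continuous (S : Finset α) (X : Finset α → ℝ) : Continuous (fun p => bE S p X) := by
  unfold bE; fun_prop

lemma bE_card (S : Finset α) (p : ℝ) : bE S p (fun F => (F.card : ℝ)) = p * S.card := by
  induction S using Finset.induction_on with
  | empty => simp [bE_empty]
  | insert σ S h ih =>
    rw [bE_insert h, ih]
    have : bE S p (fun F => ((insert σ F).card : ℝ)) = bE S p (fun F => (F.card : ℝ) + 1) :=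
      bE_congr fun F hF => by
        rw [card_insert_of_notMem fun h' => h (hF h')]; push_cast; ring
    rw [this, bE_add, bE_const, ih, card_insert_of_notMem h]; push_cast; ring

/-- expectation of a product of independent factors -/
lemma bE_prod (S : Finset α) (p : ℝ) (g : α → ℝ) :
    bE S p (fun F => ∏ σ ∈ F, g σ) = ∏ σ ∈ S, (1 - p * (1 - g σ)) := by
  induction S using Finset.induction_on with
  | empty => simp [bE_empty]
  | insert σ S h ih =>
    rw [bE_insert h, ih, prod_insert h]
    have : bE S p (fun F => ∏ ρ ∈ insert σ F, g ρ) = bE S p (fun F => g σ * ∏ ρ ∈ F, g ρ) :=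
      bE_congr fun F hF => by rw [prod_insert fun h' => h (hF h')]
    rw [this, bE_mul, ih]; ring

/-- expectation of a double sum over the random set -/
lemma bE_sum_mem (S : Finset α) (p : ℝ) (g : α → ℝ) :
    bE S p (fun F => ∑ σ ∈ F, g σ) = p * ∑ σ ∈ S, g σ := by
  induction S using Finset.induction_on with
  | empty => simp [bE_empty]
  | insert σ S h ih =>
    rw [bE_insert h, ih, sum_insert h]
    have : bE S p (fun F => ∑ ρ ∈ insert σ F, g ρ) = bE S p (fun F => g σ + ∑ ρ ∈ F, g ρ) :=
      bE_congr fun F hF => by rw [sum_insert fun h' => h (hF h')]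
    rw [this, bE_add, bE_const, ih]; ring

lemma bE_sum_sum_mem (S : Finset α) (p : ℝ) (g : α → α → ℝ) :
    bE S p (fun F => ∑ σ ∈ F, ∑ ρ ∈ F, g σ ρ) =
      p * ∑ σ ∈ S, g σ σ + p ^ 2 * ∑ σ ∈ S, ∑ ρ ∈ S.erase σ, g σ ρ := by
  induction S using Finset.induction_on with
  | empty => simp [bE_empty]
  | insert σ S h ih =>
    rw [bE_insert h, ih, sum_insert h, sum_insert h, erase_insert h]
    have : bE S p (fun F => ∑ ρ ∈ insert σ F, ∑ ρ' ∈ insert σ F, g ρ ρ') =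
        bE S p (fun F => ((g σ σ + ∑ ρ ∈ F, g σ ρ) + ∑ ρ ∈ F, g ρ σ) + ∑ ρ ∈ F, ∑ ρ' ∈ F, g ρ ρ') :=
      bE_congr fun F hF => by
        have hF' : σ ∉ F := fun h' => h (hF h')
        rw [sum_insert hF', sum_insert hF']
        simp only [sum_insert hF', sum_add_distrib]; ring
    have h2 : ∑ x ∈ S, ∑ ρ ∈ (insert σ S).erase x, g x ρ =
        ∑ x ∈ S, g x σ + ∑ x ∈ S, ∑ ρ ∈ S.erase x, g x ρ := by
      rw [← sum_add_distrib]
      refine sum_congr rfl fun x hx => ?_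
      have hne : σ ≠ x := fun h' => h (h' ▸ hx)
      rw [erase_insert_of_ne hne, sum_insert (by simp [h])]
    rw [this, bE_add, bE_add, bE_add, bE_const, bE_sum_mem, bE_sum_mem, ih, h2]; ring

/-- Covariance. -/
def bCov (S : Finset α) (p : ℝ) (X Y : Finset α → ℝ) : ℝ :=
  bE S p (fun F => X F * Y F) - bE S p X * bE S p Y

/-- Cauchy–Schwarz for the covariance, with one variable bounded in `[0,1]`. -/
lemma bCov_le {S : Finset α} {p : ℝ} (hp0 : 0 ≤ p) (hp1 : p ≤ 1) {X Y : Finset α → ℝ}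
    (h0 : ∀ F, 0 ≤ X F) (h1 : ∀ F, X F ≤ 1) :
    bCov S p X Y ≤ Real.sqrt (bE S p (fun F => (Y F - bE S p Y) ^ 2)) := by
  have e : bCov S p X Y = bE S p (fun F => X F * (Y F - bE S p Y)) := by
    have : (fun F => X F * (Y F - bE S p Y)) = fun F => X F * Y F - bE S p Y * X F := by
      funext F; ring
    rw [this, bE_sub, bE_mul, bCov]; ring
  rw [e]
  refine le_trans (bE_mono hp0 hp1 fun F _ => ?_) (bE_abs_le_sqrt hp0 hp1 _)
  calc X F * (Y F - bE S p Y) ≤ X F * |Y F - bE S p Y| :=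
        mul_le_mul_of_nonneg_left (le_abs_self _) (h0 F)
    _ ≤ 1 * |Y F - bE S p Y| := mul_le_mul_of_nonneg_right (h1 F) (abs_nonneg _)
    _ = _ := one_mul _

lemma bCov_sum_right {ι : Type*} (S : Finset α) (p : ℝ) (X : Finset α → ℝ) (T : Finset ι)
    (Y : ι → Finset α → ℝ) :
    bCov S p X (fun F => ∑ i ∈ T, Y i F) = ∑ i ∈ T, bCov S p X (Y i) := by
  simp only [bCov, mul_sum, bE_sum, sum_sub_distrib]

end Bern

section Resolvent
set_option linter.unusedSectionVars false
open Matrix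
variable {α V : Type*} [DecidableEq α] [Fintype V] [DecidableEq V]

/-- The (upper) Laplacian of the column set `F`. -/
def LM (b : α → V → ℝ) (F : Finset α) : Matrix V V ℝ := ∑ σ ∈ F, vecMulVec (b σ) (b σ)

/-- The regularized projection `(1 + s L)⁻¹`. -/
def RM (s : ℝ) (b : α → V → ℝ) (F : Finset α) : Matrix V V ℝ := (1 + s • LM b F)⁻¹

lemma LM_posSemidef (b : α → V → ℝ) (F : Finset α) : (LM b F).PosSemidef := by
  unfold LM
  refine Matrix.posSemidef_sum _ fun σ _ => ?_
  have := Matrix.posSemidef_vecMulVec_self_star (b σ)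
  simpa using this

lemma one_add_posDef {s : ℝ} (hs : 0 ≤ s) (b : α → V → ℝ) (F : Finset α) :
    (1 + s • LM b F).PosDef :=
  Matrix.PosDef.one.add_posSemidef ((LM_posSemidef b F).smul hs)

lemma isUnit_det {s : ℝ} (hs : 0 ≤ s) (b : α → V → ℝ) (F : Finset α) :
    IsUnit (1 + s • LM b F).det := (one_add_posDef hs b F).det_pos.ne'.isUnit

lemma mul_RM {s : ℝ} (hs : 0 ≤ s) (b : α → V → ℝ) (F : Finset α) :
    (1 + s • LM b F) * RM s b F = 1 := mul_nonsing_inv _ (isUnit_det hs b F)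

lemma RM_mul {s : ℝ} (hs : 0 ≤ s) (b : α → V → ℝ) (F : Finset α) :
    RM s b F * (1 + s • LM b F) = 1 := nonsing_inv_mul _ (isUnit_det hs b F)

lemma LM_transpose (b : α → V → ℝ) (F : Finset α) : (LM b F)ᵀ = LM b F := by
  simp [LM, transpose_sum, transpose_vecMulVec]

lemma RM_transpose (s : ℝ) (b : α → V → ℝ) (F : Finset α) : (RM s b F)ᵀ = RM s b F := by
  rw [RM, transpose_nonsing_inv]
  simp [LM_transpose]

lemma RM_symm (s : ℝ) (b : α → V → ℝ) (F : Finset α) (τ τ' : V) :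
    RM s b F τ τ' = RM s b F τ' τ := by
  conv_lhs => rw [← RM_transpose]
  rfl

lemma LM_mulVec (b : α → V → ℝ) (F : Finset α) (z : V → ℝ) :
    LM b F *ᵥ z = ∑ σ ∈ F, (b σ ⬝ᵥ z) • b σ := by
  rw [LM, Matrix.sum_mulVec]
  refine sum_congr rfl fun σ _ => ?_
  rw [vecMulVec_mulVec]
  ext; simp [mul_comm]

lemma dot_RM_comm (s : ℝ) (b : α → V → ℝ) (F : Finset α) (u v : V → ℝ) :
    u ⬝ᵥ (RM s b F *ᵥ v) = (RM s b F *ᵥ u) ⬝ᵥ v := by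
  rw [dotProduct_mulVec, ← mulVec_transpose, RM_transpose]

lemma quad_id {s : ℝ} (hs : 0 ≤ s) (b : α → V → ℝ) (F : Finset α) (v : V → ℝ) :
    v ⬝ᵥ (RM s b F *ᵥ v) = (RM s b F *ᵥ v) ⬝ᵥ (RM s b F *ᵥ v)
      + s * ∑ σ ∈ F, (b σ ⬝ᵥ (RM s b F *ᵥ v)) ^ 2 := by
  set z := RM s b F *ᵥ v with hz
  have hv : v = z + s • (LM b F *ᵥ z) := by
    have : (1 + s • LM b F) *ᵥ z = v := by
      rw [hz, mulVec_mulVec, mul_RM hs, one_mulVec]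
    rw [← this, add_mulVec, one_mulVec, smul_mulVec]
  conv_lhs => rw [hv]
  rw [add_dotProduct, smul_dotProduct, LM_mulVec, sum_dotProduct]
  congr 2
  simp only [smul_dotProduct, smul_eq_mul]
  exact sum_congr rfl fun σ _ => by ring

lemma RM_single (s : ℝ) (b : α → V → ℝ) (F : Finset α) (τ : V) :
    RM s b F *ᵥ (Pi.single τ 1) = fun τ' => RM s b F τ τ' := by
  ext τ'
  simp [RM_symm s b F τ τ']

lemma diag_id {s : ℝ} (hs : 0 ≤ s) (b : α → V → ℝ) (F : Finset α) (τ : V) :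
    RM s b F τ τ = ∑ τ', RM s b F τ τ' ^ 2 + s * ∑ σ ∈ F, ((RM s b F *ᵥ b σ) τ) ^ 2 := by
  have h := quad_id hs b F (Pi.single τ 1)
  have h2 : ∀ σ, b σ ⬝ᵥ (RM s b F *ᵥ Pi.single τ 1) = (RM s b F *ᵥ b σ) τ := by
    intro σ
    rw [dot_RM_comm]; simp
  simp only [h2] at h
  rw [RM_single, single_one_dotProduct] at h
  rw [h]
  simp [pow_two, dotProduct]

lemma row_sq_le {s : ℝ} (hs : 0 ≤ s) (b : α → V → ℝ) (F : Finset α) (τ : V) :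
    ∑ τ', RM s b F τ τ' ^ 2 ≤ RM s b F τ τ := by
  have h := diag_id hs b F τ
  have : 0 ≤ s * ∑ σ ∈ F, ((RM s b F *ᵥ b σ) τ) ^ 2 :=
    mul_nonneg hs (sum_nonneg fun _ _ => sq_nonneg _)
  linarith

lemma diag_nonneg {s : ℝ} (hs : 0 ≤ s) (b : α → V → ℝ) (F : Finset α) (τ : V) :
    0 ≤ RM s b F τ τ := le_trans (sum_nonneg fun _ _ => sq_nonneg _) (row_sq_le hs b F τ)

lemma diag_le_one {s : ℝ} (hs : 0 ≤ s) (b : α → V → ℝ) (F : Finset α) (τ : V) :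
    RM s b F τ τ ≤ 1 := by
  have h1 := row_sq_le hs b F τ
  have h2 : RM s b F τ τ ^ 2 ≤ ∑ τ', RM s b F τ τ' ^ 2 :=
    single_le_sum (f := fun τ' => RM s b F τ τ' ^ 2) (fun _ _ => sq_nonneg _) (mem_univ τ)
  nlinarith

lemma diag_pos {s : ℝ} (hs : 0 ≤ s) (b : α → V → ℝ) (F : Finset α) (τ : V) :
    0 < RM s b F τ τ :=
  (one_add_posDef hs b F).inv.diag_pos

lemma col_bound {s : ℝ} (hs : 1 ≤ s) (b : α → V → ℝ) (F : Finset α) (τ : V) {σ : α} (hσ : σ ∈ F) :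
    |(RM s b F *ᵥ b σ) τ| ≤ 1 := by
  have hs0 : 0 ≤ s := by linarith
  have h := diag_id hs0 b F τ
  have h1 := diag_le_one hs0 b F τ
  have h2 : ((RM s b F *ᵥ b σ) τ) ^ 2 ≤ ∑ σ ∈ F, ((RM s b F *ᵥ b σ) τ) ^ 2 :=
    single_le_sum (f := fun σ => ((RM s b F *ᵥ b σ) τ) ^ 2) (fun _ _ => sq_nonneg _) hσ
  have h3 : 0 ≤ ∑ τ', RM s b F τ τ' ^ 2 := sum_nonneg fun _ _ => sq_nonneg _
  have h4 : 0 ≤ ∑ σ ∈ F, ((RM s b F *ᵥ b σ) τ) ^ 2 := sum_nonneg fun _ _ => sq_nonneg _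
  rw [← sq_le_one_iff_abs_le_one]
  nlinarith

lemma LM_insert (b : α → V → ℝ) {F : Finset α} {σ : α} (h : σ ∉ F) :
    LM b (insert σ F) = LM b F + vecMulVec (b σ) (b σ) := by
  rw [LM, sum_insert h, add_comm]; rfl

lemma RM_insert {s : ℝ} (hs : 0 ≤ s) (b : α → V → ℝ) {F : Finset α} {σ : α} (h : σ ∉ F) :
    RM s b (insert σ F) = RM s b F - (s / (1 + s * (b σ ⬝ᵥ (RM s b F *ᵥ b σ)))) •
      vecMulVec (RM s b F *ᵥ b σ) (RM s b F *ᵥ b σ) := by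
  set R := RM s b F with hR
  set q := b σ ⬝ᵥ (R *ᵥ b σ) with hq
  have hq0 : 0 ≤ q := by
    rw [hq, hR, quad_id hs]
    refine add_nonneg ?_ (mul_nonneg hs (sum_nonneg fun _ _ => sq_nonneg _))
    exact sum_nonneg fun _ _ => mul_self_nonneg _
  have hne : 1 + s * q ≠ 0 := by positivity
  rw [RM]
  apply inv_eq_right_inv
  rw [LM_insert b h, smul_add, ← add_assoc, add_mul, mul_sub, mul_sub, hR, mul_RM hs, ← hR]
  rw [Matrix.mul_smul, Matrix.mul_smul, mul_vecMulVec, mulVec_mulVec, hR, mul_RM hs, ← hR, one_mulVec]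
  rw [Matrix.smul_mul, Matrix.smul_mul, vecMulVec_mul, vecMulVec_mul_vecMulVec]
  have e1 : b σ ᵥ* R = R *ᵥ b σ := by
    rw [← mulVec_transpose, hR, RM_transpose]
  rw [e1, ← hq]
  ext i j
  simp [vecMulVec_apply]
  field_simp
  ring

/-- One step of the update: the difference is a rank one matrix `z zᵀ` with `|z|² ≤ 1`. -/
lemma RM_step {s : ℝ} (hs : 0 ≤ s) (b : α → V → ℝ) (F : Finset α) (σ : α) :
    ∃ z : V → ℝ, (∀ τ τ', RM s b F τ τ' - RM s b (insert σ F) τ τ' = z τ * z τ') ∧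
      ∑ τ, z τ ^ 2 ≤ 1 := by
  by_cases h : σ ∈ F
  · exact ⟨0, by simp [insert_eq_of_mem h]⟩
  set R := RM s b F with hR
  set q := b σ ⬝ᵥ (R *ᵥ b σ) with hq
  have hqq : (R *ᵥ b σ) ⬝ᵥ (R *ᵥ b σ) ≤ q := by
    rw [hq, hR, quad_id hs]
    have : 0 ≤ s * ∑ ρ ∈ F, (b ρ ⬝ᵥ (RM s b F *ᵥ b σ)) ^ 2 :=
      mul_nonneg hs (sum_nonneg fun _ _ => sq_nonneg _)
    linarith
  have hq0 : 0 ≤ q := le_trans (sum_nonneg fun _ _ => mul_self_nonneg _) hqq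
  have hk : 0 ≤ s / (1 + s * q) := by positivity
  refine ⟨fun τ => Real.sqrt (s / (1 + s * q)) * (R *ᵥ b σ) τ, ?_, ?_⟩
  · intro τ τ'
    rw [RM_insert hs b h, ← hR, ← hq]
    have := Real.mul_self_sqrt hk
    simp only [Matrix.sub_apply, Matrix.smul_apply, vecMulVec_apply, smul_eq_mul]
    linear_combination (-(R *ᵥ b σ) τ * (R *ᵥ b σ) τ') * this
  · simp only [mul_pow, Real.sq_sqrt hk, ← mul_sum]
    have e : ∑ i, (R *ᵥ b σ) i ^ 2 = (R *ᵥ b σ) ⬝ᵥ (R *ᵥ b σ) := by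
      simp [dotProduct, pow_two]
    rw [e]
    calc _ ≤ s / (1 + s * q) * q := mul_le_mul_of_nonneg_left hqq hk
      _ ≤ 1 := by
        rw [div_mul_eq_mul_div, div_le_one (by positivity)]; linarith

lemma RM_diag_insert_le {s : ℝ} (hs : 0 ≤ s) (b : α → V → ℝ) (F : Finset α) (σ : α) (τ : V) :
    RM s b (insert σ F) τ τ ≤ RM s b F τ τ := by
  obtain ⟨z, hz, _⟩ := RM_step hs b F σ
  have := hz τ τ
  nlinarith [mul_self_nonneg (z τ)]

lemma RM_diag_union {s : ℝ} (hs : 0 ≤ s) (b : α → V → ℝ) (F G : Finset α) :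
    (∀ τ, RM s b (F ∪ G) τ τ ≤ RM s b F τ τ) ∧
    (∀ τ τ', |RM s b F τ τ' - RM s b (F ∪ G) τ τ'| ≤
      ((RM s b F τ τ - RM s b (F ∪ G) τ τ) + (RM s b F τ' τ' - RM s b (F ∪ G) τ' τ')) / 2) ∧
    ∑ τ, (RM s b F τ τ - RM s b (F ∪ G) τ τ) ≤ G.card := by
  induction G using Finset.induction_on with
  | empty => simp
  | insert σ G hσ ih =>
    obtain ⟨h1, h2, h3⟩ := ih
    obtain ⟨z, hz, hz1⟩ := RM_step hs b (F ∪ G) σ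
    rw [union_insert]
    refine ⟨fun τ => ?_, fun τ τ' => ?_, ?_⟩
    · have := hz τ τ
      have := h1 τ
      nlinarith [mul_self_nonneg (z τ)]
    · have e1 := hz τ τ
      have e2 := hz τ' τ'
      have e3 := hz τ τ'
      have h := h2 τ τ'
      have : |z τ * z τ'| ≤ (z τ * z τ + z τ' * z τ') / 2 := by
        rw [abs_le]
        constructor <;> nlinarith [sq_nonneg (z τ - z τ'), sq_nonneg (z τ + z τ')]
      rw [← e1, ← e2, ← e3] at this
      calc _ = |(RM s b F τ τ' - RM s b (F ∪ G) τ τ') +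
            (RM s b (F ∪ G) τ τ' - RM s b (insert σ (F ∪ G)) τ τ')| := by ring_nf
        _ ≤ _ := abs_add_le _ _
        _ ≤ _ := by linarith
    · rw [card_insert_of_notMem hσ]
      have : ∑ τ, (RM s b F τ τ - RM s b (insert σ (F ∪ G)) τ τ) =
          ∑ τ, (RM s b F τ τ - RM s b (F ∪ G) τ τ) + ∑ τ, z τ ^ 2 := by
        rw [← sum_add_distrib]
        refine sum_congr rfl fun τ _ => ?_
        rw [pow_two, ← hz]; ring
      rw [this]; push_cast; linarith

lemma RM_diag_antitone {s : ℝ} (hs : 0 ≤ s) (b : α → V → ℝ) (τ : V) :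
    Antitone (fun F => RM s b F τ τ) := by
  intro F G h
  have := (RM_diag_union hs b F G).1 τ
  rwa [union_eq_right.2 h] at this

/-- Cavity estimate. -/
lemma cavity {s : ℝ} (hs : 1 ≤ s) (b : α → V → ℝ) (F G : Finset α) (hFG : Disjoint F G) (τ : V)
    (hF : ∀ σ ∈ F, b σ τ = 0) (hG : ∀ σ ∈ G, b σ τ ^ 2 = 1) (w : α → V → ℝ)
    (hw : ∀ σ ∈ G, w σ = b σ - (b σ τ) • Pi.single τ 1) (D : α → ℝ) (hD : ∀ σ, 0 ≤ D σ) :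
    |RM s b (F ∪ G) τ τ - 1 / (1 + ∑ σ ∈ G, 1 / (1 / s + D σ))| ≤
      s * ∑ σ ∈ G, ∑ ρ ∈ G, |w σ ⬝ᵥ (RM s b F *ᵥ w ρ) - if σ = ρ then D σ else 0| := by
  have hs0 : 0 ≤ s := by linarith
  have hspos : 0 < s := by linarith
  set R := RM s b F with hR
  set e : V → ℝ := Pi.single τ 1 with he
  set x : ℝ := 1 / (1 + ∑ σ ∈ G, 1 / (1 / s + D σ)) with hx
  set E : α → α → ℝ := fun σ ρ => w σ ⬝ᵥ (R *ᵥ w ρ) - if σ = ρ then D σ else 0 with hE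
  have hA : ∀ σ, 0 < 1 / s + D σ := fun σ => by have := hD σ; positivity
  have hden : 0 < 1 + ∑ σ ∈ G, 1 / (1 / s + D σ) := by
    have : 0 ≤ ∑ σ ∈ G, 1 / (1 / s + D σ) := sum_nonneg fun σ _ => (one_div_pos.2 (hA σ)).le
    linarith
  have hx0 : 0 < x := by positivity
  -- e is fixed by the cavity resolvent
  have hLe : LM b F *ᵥ e = 0 := by
    rw [LM_mulVec]
    refine sum_eq_zero fun σ hσ => ?_
    simp [he, hF σ hσ]
  have hMe : (1 + s • LM b F) *ᵥ e = e := by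
    rw [add_mulVec, one_mulVec, smul_mulVec, hLe]; simp
  have hRe : R *ᵥ e = e := by
    conv_lhs => rw [← hMe]
    rw [mulVec_mulVec, hR, RM_mul hs0, one_mulVec]
  have hwτ : ∀ σ ∈ G, w σ τ = 0 := fun σ hσ => by rw [hw σ hσ]; simp [he]
  have hRw : ∀ ρ ∈ G, (R *ᵥ w ρ) τ = 0 := by
    intro ρ hρ
    have : e ⬝ᵥ (R *ᵥ w ρ) = (R *ᵥ e) ⬝ᵥ w ρ := dot_RM_comm s b F e (w ρ)
    rw [hRe] at this
    simp only [he, single_one_dotProduct] at this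
    rw [this, hwτ ρ hρ]
  have hbw : ∀ σ ∈ G, ∀ ρ ∈ G, b σ ⬝ᵥ (R *ᵥ w ρ) = w σ ⬝ᵥ (R *ᵥ w ρ) := by
    intro σ hσ ρ hρ
    rw [hw σ hσ, sub_dotProduct, smul_dotProduct, single_one_dotProduct, hRw ρ hρ]; simp
  set r : α → ℝ := fun σ => s * x * ∑ ρ ∈ G, b ρ τ * E σ ρ / (1 / s + D ρ) with hr
  set z : V → ℝ := x • (e - ∑ ρ ∈ G, (b ρ τ / (1 / s + D ρ)) • (R *ᵥ w ρ)) with hz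
  have hzτ : z τ = x := by
    rw [hz]
    simp only [Pi.smul_apply, Pi.sub_apply, Finset.sum_apply, smul_eq_mul]
    rw [sum_eq_zero fun ρ hρ => by rw [hRw ρ hρ, mul_zero]]
    simp [he]
  have hbz : ∀ σ ∈ G, s * (b σ ⬝ᵥ z) = x * b σ τ / (1 / s + D σ) - r σ := by
    intro σ hσ
    rw [hz, dotProduct_smul, dotProduct_sub, dotProduct_sum]
    have h1 : b σ ⬝ᵥ e = b σ τ := by simp [he]
    have h2 : ∑ ρ ∈ G, b σ ⬝ᵥ ((b ρ τ / (1 / s + D ρ)) • (R *ᵥ w ρ)) =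
        b σ τ / (1 / s + D σ) * D σ + ∑ ρ ∈ G, b ρ τ * E σ ρ / (1 / s + D ρ) := by
      have h3 : b σ τ / (1 / s + D σ) * D σ =
          ∑ ρ ∈ G, b ρ τ / (1 / s + D ρ) * (if σ = ρ then D σ else 0) := by
        simp [hσ]
      rw [h3, ← sum_add_distrib]
      refine sum_congr rfl fun ρ hρ => ?_
      rw [dotProduct_smul, hbw σ hσ ρ hρ, smul_eq_mul]
      simp only [hE]; ring
    rw [h1, h2, hr, smul_eq_mul]
    have := (hA σ).ne'
    have h4 : b σ τ - b σ τ / (1 / s + D σ) * D σ = b σ τ / (1 / s + D σ) * (1 / s) := by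
      have h6 : b σ τ = b σ τ / (1 / s + D σ) * (1 / s + D σ) := by
        rw [div_mul_cancel₀ _ this]
      linear_combination h6
    have h5 : s * (1 / s) = 1 := by field_simp
    calc _ = x * s * ((b σ τ - b σ τ / (1 / s + D σ) * D σ)) -
          s * x * ∑ ρ ∈ G, b ρ τ * E σ ρ / (1 / s + D ρ) := by ring
      _ = x * (b σ τ / (1 / s + D σ)) * (s * (1 / s)) -
          s * x * ∑ ρ ∈ G, b ρ τ * E σ ρ / (1 / s + D ρ) := by rw [h4]; ring
      _ = _ := by rw [h5]; ring
  have hMz : (1 + s • LM b (F ∪ G)) *ᵥ z = e - ∑ σ ∈ G, r σ • b σ := by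
    have h1 : (1 + s • LM b (F ∪ G)) *ᵥ z =
        (1 + s • LM b F) *ᵥ z + ∑ σ ∈ G, (s * (b σ ⬝ᵥ z)) • b σ := by
      rw [LM, sum_union hFG, smul_add, ← add_assoc, add_mulVec]
      congr 1
      have : (∑ σ ∈ G, vecMulVec (b σ) (b σ)) = LM b G := rfl
      rw [this, smul_mulVec, LM_mulVec, smul_sum]
      simp only [smul_smul]
    have h2 : (1 + s • LM b F) *ᵥ z = x • (e - ∑ ρ ∈ G, (b ρ τ / (1 / s + D ρ)) • w ρ) := by
      rw [hz, mulVec_smul, mulVec_sub, hMe]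
      congr 2
      have := map_sum (Matrix.mulVecLin (1 + s • LM b F))
        (fun ρ => (b ρ τ / (1 / s + D ρ)) • (R *ᵥ w ρ)) G
      simp only [mulVecLin_apply] at this
      rw [this]
      refine sum_congr rfl fun ρ _ => ?_
      rw [mulVec_smul, mulVec_mulVec, hR, mul_RM hs0, one_mulVec]
    rw [h1, h2]
    have h3 : ∑ σ ∈ G, (s * (b σ ⬝ᵥ z)) • b σ =
        ∑ σ ∈ G, ((x * b σ τ / (1 / s + D σ)) • b σ - r σ • b σ) :=
      sum_congr rfl fun σ hσ => by rw [hbz σ hσ, sub_smul]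
    rw [h3, sum_sub_distrib]
    have h4 : ∑ σ ∈ G, (x * b σ τ / (1 / s + D σ)) • b σ =
        x • ∑ σ ∈ G, (b σ τ / (1 / s + D σ)) • w σ + (x * ∑ σ ∈ G, 1 / (1 / s + D σ)) • e := by
      rw [mul_sum, sum_smul, smul_sum, ← sum_add_distrib]
      refine sum_congr rfl fun σ hσ => ?_
      rw [hw σ hσ, smul_sub, smul_sub, smul_smul, smul_smul, smul_smul]
      have : x * (b σ τ / (1 / s + D σ)) * b σ τ = x * (1 / (1 / s + D σ)) := by
        rw [← hG σ hσ]; ring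
      rw [this, ← mul_div_assoc]; abel
    rw [h4, smul_sub]
    have h5 : x • e + (x * ∑ σ ∈ G, 1 / (1 / s + D σ)) • e = e := by
      rw [← add_smul]
      have : x + x * ∑ σ ∈ G, 1 / (1 / s + D σ) = 1 := by
        rw [← mul_one_add, hx, one_div_mul_cancel hden.ne']
      rw [this, one_smul]
    calc _ = (x • e + (x * ∑ σ ∈ G, 1 / (1 / s + D σ)) • e) - ∑ σ ∈ G, r σ • b σ := by abel
      _ = _ := by rw [h5]
  have hz2 : z = RM s b (F ∪ G) *ᵥ e - ∑ σ ∈ G, r σ • (RM s b (F ∪ G) *ᵥ b σ) := by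
    have : RM s b (F ∪ G) *ᵥ ((1 + s • LM b (F ∪ G)) *ᵥ z) = z := by
      rw [mulVec_mulVec, RM_mul hs0, one_mulVec]
    rw [← this, hMz, mulVec_sub]
    congr 1
    have := map_sum (Matrix.mulVecLin (RM s b (F ∪ G))) (fun σ => r σ • b σ) G
    simp only [mulVecLin_apply, mulVec_smul] at this
    exact this
  have hfin : RM s b (F ∪ G) τ τ - x = ∑ σ ∈ G, r σ * (RM s b (F ∪ G) *ᵥ b σ) τ := by
    have := congrFun hz2 τ
    rw [hzτ] at this
    rw [this, he, RM_single]
    simp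
  rw [hfin, mul_sum]
  refine (abs_sum_le_sum_abs _ _).trans (sum_le_sum fun σ hσ => ?_)
  rw [abs_mul]
  have hc := col_bound hs b (F ∪ G) τ (mem_union_right F hσ)
  have hr1 : |r σ| ≤ s * ∑ ρ ∈ G, |E σ ρ| := by
    rw [hr]
    simp only []
    rw [mul_assoc, abs_mul, abs_of_pos hspos, mul_sum]
    refine mul_le_mul_of_nonneg_left ?_ hs0
    refine (abs_sum_le_sum_abs _ _).trans (sum_le_sum fun ρ hρ => ?_)
    have hb1 : |b ρ τ| = 1 := by
      have := hG ρ hρ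
      rw [← sq_abs] at this
      nlinarith [abs_nonneg (b ρ τ)]
    rw [abs_mul, abs_of_pos hx0, abs_div, abs_mul, hb1, one_mul, abs_of_pos (hA ρ)]
    have hxle : x ≤ 1 / s + D ρ := by
      rw [hx, div_le_iff₀ hden]
      have h1 : 1 / (1 / s + D ρ) ≤ ∑ σ ∈ G, 1 / (1 / s + D σ) :=
        single_le_sum (f := fun σ => 1 / (1 / s + D σ))
          (fun σ _ => (one_div_pos.2 (hA σ)).le) hρ
      have h2 : (1 / s + D ρ) * (1 / (1 / s + D ρ)) = 1 := by
        exact mul_one_div_cancel (hA ρ).ne'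
      have := mul_le_mul_of_nonneg_left h1 (hA ρ).le
      nlinarith [hA ρ]
    rw [← mul_div_assoc, div_le_iff₀ (hA ρ), mul_comm]
    exact mul_le_mul_of_nonneg_left hxle (abs_nonneg _)
  calc _ ≤ |r σ| * 1 := mul_le_mul_of_nonneg_left hc (abs_nonneg _)
    _ ≤ _ := by rw [mul_one]; exact hr1

end Resolvent

section RankPart
open Matrix

lemma log_ineq {s l : ℝ} (hs : 1 < s) (hl : 0 < l) :
    Real.log s + Real.log l ≤ l + s * l / (1 + s * l) * Real.log s := by
  have hL : 0 < Real.log s := Real.log_pos hs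
  set L := Real.log s with hLdef
  set u := 1 + s * l with hu
  have hsl : 0 < s * l := by positivity
  have hu0 : 0 < u := by linarith
  have e : s * l / u * L = L - L / u := by
    have : s * l = u - 1 := by rw [hu]; ring
    rw [this]; field_simp
  rw [e]
  suffices h : Real.log l + L / u ≤ l by linarith
  have h1 : Real.log l ≤ l - 1 := Real.log_le_sub_one_of_pos hl
  by_cases hc : L ≤ u
  · have : L / u ≤ 1 := (div_le_one hu0).2 hc
    linarith
  · push Not at hc
    have h2 : Real.log (s * l) ≤ s * l - 1 := Real.log_le_sub_one_of_pos hsl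
    rw [Real.log_mul (by linarith) hl.ne'] at h2
    have h3 : L / u = L - s * l * (L / u) := by
      have : s * l = u - 1 := by rw [hu]; ring
      rw [this]; field_simp; ring
    have h4 : 1 ≤ L / u := (one_le_div hu0).2 hc.le
    nlinarith

variable {V : Type*} [Fintype V] [DecidableEq V]

lemma prod_nonzero_eig {L : Matrix V V ℝ} (hL : L.PosSemidef) (Z : Matrix V V ℤ)
    (hZ : Z.map (Int.castRingHom ℝ) = L) :
    1 ≤ ∏ i ∈ univ.filter (fun i => hL.1.eigenvalues i ≠ 0), hL.1.eigenvalues i := by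
  set lam := hL.1.eigenvalues with hlam
  set A := univ.filter (fun i => lam i ≠ 0) with hA
  set B := univ.filter (fun i => ¬ (lam i ≠ 0)) with hB
  have hch : L.charpoly = ∏ i, (Polynomial.X - Polynomial.C (lam i)) := hL.1.charpoly_eq
  have hIntg : L.charpoly = Z.charpoly.map (Int.castRingHom ℝ) := by
    rw [← hZ, charpoly_map]
  have hsplit : L.charpoly = (∏ i ∈ A, (Polynomial.X - Polynomial.C (lam i))) * Polynomial.X ^ B.card := by
    rw [hch, ← prod_filter_mul_prod_filter_not univ (fun i => lam i ≠ 0)]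
    congr 1
    rw [← prod_const]
    refine prod_congr rfl fun i hi => ?_
    simp only [hB, mem_filter, mem_univ, true_and, not_not] at hi
    rw [hi]; simp
  have hcoef : L.charpoly.coeff B.card = ∏ i ∈ A, (- lam i) := by
    rw [hsplit]
    have := Polynomial.coeff_mul_X_pow (∏ i ∈ A, (Polynomial.X - Polynomial.C (lam i))) B.card 0
    rw [zero_add] at this
    rw [this, Polynomial.coeff_zero_eq_eval_zero, Polynomial.eval_prod]
    simp
  rw [hIntg, Polynomial.coeff_map] at hcoef
  set m := Z.charpoly.coeff B.card with hm
  have hpos : 0 < ∏ i ∈ A, lam i := by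
    refine prod_pos fun i hi => ?_
    have h0 : 0 ≤ lam i := hL.eigenvalues_nonneg i
    have h1 : lam i ≠ 0 := by simpa [hA] using hi
    exact lt_of_le_of_ne h0 h1.symm
  have habs : |(m : ℝ)| = ∏ i ∈ A, lam i := by
    have : ((Int.castRingHom ℝ) m) = (m : ℝ) := rfl
    rw [← this, hcoef, abs_prod]
    refine prod_congr rfl fun i hi => ?_
    rw [abs_neg, abs_of_nonneg (hL.eigenvalues_nonneg i)]
  have hm0 : m ≠ 0 := by
    intro h
    rw [h] at habs
    simp at habs
    linarith
  rw [← habs]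
  have : (1 : ℤ) ≤ |m| := Int.one_le_abs hm0
  exact_mod_cast this

lemma trace_inv {L : Matrix V V ℝ} (hL : L.PosSemidef) {s : ℝ} (hs : 0 ≤ s) :
    ((1 + s • L)⁻¹).trace = ∑ i, 1 / (1 + s * hL.1.eigenvalues i) := by
  set lam := hL.1.eigenvalues with hlam
  set φ := Unitary.conjStarAlgAut ℝ (Matrix V V ℝ) hL.1.eigenvectorUnitary with hφ
  have hsp : L = φ (diagonal lam) := by
    have := hL.1.spectral_theorem
    exact this
  have hpos : ∀ i, 1 + s * lam i ≠ 0 := fun i => by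
    have : 0 ≤ lam i := hL.eigenvalues_nonneg i
    positivity
  have h1 : (1 + s • L) = φ (diagonal fun i => 1 + s * lam i) := by
    conv_lhs => rw [hsp]
    rw [← map_one φ, ← map_smul, ← map_add]
    congr 1
    ext i j
    by_cases h : i = j
    · subst h; simp
    · simp [h]
  have h2 : (1 + s • L)⁻¹ = φ (diagonal fun i => 1 / (1 + s * lam i)) := by
    apply inv_eq_right_inv
    rw [h1, ← map_mul, diagonal_mul_diagonal, ← map_one φ]
    congr 1
    ext i j
    by_cases h : i = j
    · subst h; simp [hpos i]
    · simp [h]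
  rw [h2, hφ, Unitary.conjStarAlgAut_apply, trace_mul_comm, ← mul_assoc]
  simp [trace_diagonal]

lemma rank_bounds {L : Matrix V V ℝ} (hL : L.PosSemidef) (Z : Matrix V V ℤ)
    (hZ : Z.map (Int.castRingHom ℝ) = L) {s : ℝ} (hs : 1 < s) :
    (Fintype.card V : ℝ) - ((1 + s • L)⁻¹).trace ≤ L.rank ∧
    L.rank * Real.log s ≤ L.trace + Real.log s * ((Fintype.card V : ℝ) - ((1 + s • L)⁻¹).trace) := by
  have hs0 : 0 ≤ s := by linarith
  have hprod := prod_nonzero_eig hL Z hZ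
  rw [trace_inv hL hs0]
  have htr : L.trace = ∑ i, hL.1.eigenvalues i := hL.1.trace_eq_sum_eigenvalues
  rw [htr, hL.1.rank_eq_card_non_zero_eigs]
  have hnn : ∀ i, 0 ≤ hL.1.eigenvalues i := hL.eigenvalues_nonneg
  generalize hL.1.eigenvalues = lam at *
  have hcard : (Fintype.card {i // lam i ≠ 0}) = (univ.filter fun i => lam i ≠ 0).card := by
    rw [Fintype.card_subtype]
  rw [hcard]
  set A := univ.filter (fun i => lam i ≠ 0) with hA
  have hdiff : (Fintype.card V : ℝ) - ∑ i, 1 / (1 + s * lam i) =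
      ∑ i ∈ A, s * lam i / (1 + s * lam i) := by
    have h1 : (Fintype.card V : ℝ) - ∑ i, 1 / (1 + s * lam i) = ∑ i, s * lam i / (1 + s * lam i) := by
      have : (Fintype.card V : ℝ) = ∑ _i : V, (1 : ℝ) := by simp
      rw [this, ← sum_sub_distrib]
      refine sum_congr rfl fun i _ => ?_
      have : 1 + s * lam i ≠ 0 := by have := hnn i; positivity
      field_simp; ring
    rw [h1, hA, sum_filter]
    refine sum_congr rfl fun i _ => ?_
    split_ifs with h
    · rfl
    · push Not at h; simp [h]
  have hsum : ∑ i, lam i = ∑ i ∈ A, lam i := by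
    rw [hA, sum_filter]
    refine sum_congr rfl fun i _ => ?_
    split_ifs with h
    · rfl
    · push Not at h; simp [h]
  rw [hdiff, hsum]
  constructor
  · calc ∑ i ∈ A, s * lam i / (1 + s * lam i) ≤ ∑ i ∈ A, (1 : ℝ) := by
          refine sum_le_sum fun i _ => ?_
          have := hnn i
          rw [div_le_one (by positivity)]; linarith
      _ = _ := by simp
  · have hlog : 0 ≤ ∑ i ∈ A, Real.log (lam i) := by
      rw [← Real.log_prod (fun i hi => by simpa [hA] using hi)]
      exact Real.log_nonneg hprod
    calc (A.card : ℝ) * Real.log s = ∑ i ∈ A, Real.log s := by simp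
      _ ≤ ∑ i ∈ A, Real.log s + ∑ i ∈ A, Real.log (lam i) := by linarith
      _ = ∑ i ∈ A, (Real.log s + Real.log (lam i)) := by rw [sum_add_distrib]
      _ ≤ ∑ i ∈ A, (lam i + s * lam i / (1 + s * lam i) * Real.log s) := by
          refine sum_le_sum fun i hi => ?_
          have h1 : lam i ≠ 0 := by simpa [hA] using hi
          exact log_ineq hs (lt_of_le_of_ne (hnn i) h1.symm)
      _ = _ := by rw [sum_add_distrib, ← sum_mul]; ring

end RankPart

section BD

/-- boundary vector of `σ`. -/
def bd (n : ℕ) : Finset (Fin n) → Finset (Fin n) → ℝ := fun σ τ => bdCoeff τ σ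

variable {n : ℕ}

lemma bd_erase {σ : Finset (Fin n)} {v : Fin n} (hv : v ∈ σ) :
    bd n σ (σ.erase v) = (-1 : ℝ) ^ (σ.filter (fun w => w < v)).card := by
  have h1 : σ \ σ.erase v = {v} := by
    exact Finset.sdiff_erase_self hv
  have h2 : (σ.erase v).card + 1 = σ.card := card_erase_add_one hv
  simp [bd, bdCoeff, erase_subset, h2, h1]

lemma bd_erase_sq {σ : Finset (Fin n)} {v : Fin n} (hv : v ∈ σ) :
    bd n σ (σ.erase v) ^ 2 = 1 := by
  rw [bd_erase hv, ← pow_mul, mul_comm, pow_mul]; simp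

lemma exists_erase {σ τ : Finset (Fin n)} (h : τ ⊆ σ ∧ τ.card + 1 = σ.card) :
    ∃ v ∈ σ, τ = σ.erase v := by
  have hc : (σ \ τ).card = 1 := by rw [card_sdiff_of_subset h.1]; omega
  obtain ⟨v, hv⟩ := card_eq_one.1 hc
  have hv' : v ∈ σ \ τ := by rw [hv]; simp
  refine ⟨v, (mem_sdiff.1 hv').1, ?_⟩
  rw [← sdiff_singleton_eq_erase, ← hv, Finset.sdiff_sdiff_eq_self h.1]

lemma bd_eq_zero {σ τ : Finset (Fin n)} (h : ¬ (τ ⊆ σ ∧ τ.card + 1 = σ.card)) : bd n σ τ = 0 := by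
  simp [bd, bdCoeff, h]

lemma bd_sum (σ : Finset (Fin n)) (f : Finset (Fin n) → ℝ) (hf : ∀ τ, bd n σ τ = 0 → f τ = 0) :
    ∑ τ, f τ = ∑ v ∈ σ, f (σ.erase v) := by
  have hinj : Set.InjOn (fun v => σ.erase v) σ := fun v hv w hw h => by
    exact (erase_inj σ hv).1 h
  rw [← sum_image (f := f) hinj]
  symm
  refine sum_subset (subset_univ _) fun τ _ hτ => hf τ (bd_eq_zero fun h => hτ ?_)
  obtain ⟨v, hv, rfl⟩ := exists_erase h
  exact mem_image_of_mem _ hv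

lemma bd_int (σ τ : Finset (Fin n)) : ∃ z : ℤ, bd n σ τ = z := by
  by_cases h : τ ⊆ σ ∧ τ.card + 1 = σ.card
  · obtain ⟨v, hv, rfl⟩ := exists_erase h
    rw [bd_erase hv]
    exact ⟨(-1) ^ (σ.filter (fun w => w < v)).card, by simp⟩
  · exact ⟨0, by simp [bd_eq_zero h]⟩

lemma bd_sq_sum (σ : Finset (Fin n)) : ∑ τ, bd n σ τ ^ 2 = σ.card := by
  rw [bd_sum σ _ (fun τ h => by simp [h])]
  rw [sum_congr rfl fun v hv => bd_erase_sq hv]; simp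

open Matrix in
lemma dimKer_add_rank (F : Finset (Finset (Fin n))) :
    (dimKer n F : ℝ) + (LM (bd n) F).rank = F.card := by
  set M : Matrix (Finset (Fin n)) F ℝ := Matrix.of fun τ σ => bd n σ.1 τ with hM
  have h1 : boundaryMap n F = M.mulVecLin := by
    ext x τ
    simp [boundaryMap, hM, mulVec, dotProduct, bd, mul_comm]
  have h2 : LM (bd n) F = M * Mᵀ := by
    ext τ τ'
    simp only [LM, Matrix.sum_apply, vecMulVec_apply, Matrix.mul_apply, hM, transpose_apply, of_apply]
    rw [← sum_attach]; rfl
  have h3 := LinearMap.finrank_range_add_finrank_ker (boundaryMap n F)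
  rw [h2, rank_self_mul_transpose, Matrix.rank, ← h1, dimKer]
  rw [Module.finrank_fintype_fun_eq_card, Fintype.card_coe] at h3
  exact_mod_cast (by omega : _ = F.card)

open Matrix in
lemma dimKer_bounds (F : Finset (Finset (Fin n))) {d : ℕ} (hF : ∀ σ ∈ F, σ.card = d + 1)
    {s : ℝ} (hs : 1 < s) :
    (dimKer n F : ℝ) ≤ F.card - ∑ τ, (1 - RM s (bd n) F τ τ) ∧
    (F.card : ℝ) - ∑ τ, (1 - RM s (bd n) F τ τ) - (d + 1) * F.card / Real.log s ≤ dimKer n F := by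
  have hlog : 0 < Real.log s := Real.log_pos hs
  choose z hz using fun σ τ => bd_int (n := n) σ τ
  have hZ : (∑ σ ∈ F, vecMulVec (z σ) (z σ)).map (Int.castRingHom ℝ) = LM (bd n) F := by
    ext τ τ'
    simp [LM, Matrix.sum_apply, vecMulVec_apply, hz]
  have h := rank_bounds (LM_posSemidef (bd n) F) _ hZ hs
  have hr := dimKer_add_rank F
  have htr : (LM (bd n) F).trace = (d + 1) * F.card := by
    rw [LM, trace_sum]
    have : ∀ σ ∈ F, (vecMulVec (bd n σ) (bd n σ)).trace = (d : ℝ) + 1 := by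
      intro σ hσ
      have := bd_sq_sum σ
      rw [hF σ hσ] at this
      push_cast at this
      rw [← this]
      simp [Matrix.trace, vecMulVec_apply, pow_two]
    rw [sum_congr rfl this]; simp only [sum_const, nsmul_eq_mul]; ring
  have hT : ∑ τ, (1 - RM s (bd n) F τ τ) =
      (Fintype.card (Finset (Fin n)) : ℝ) - ((1 + s • LM (bd n) F)⁻¹).trace := by
    rw [sum_sub_distrib]; simp [Matrix.trace, RM]
  rw [← hT, htr] at h
  obtain ⟨ha, hb⟩ := h
  refine ⟨by linarith, ?_⟩
  have hb' : ((LM (bd n) F).rank : ℝ) ≤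
      (d + 1) * F.card / Real.log s + ∑ τ, (1 - RM s (bd n) F τ τ) := by
    rw [← le_div_iff₀ hlog] at hb
    refine hb.trans (le_of_eq ?_)
    field_simp
  linarith

lemma dimKer_add_span (F : Finset (Finset (Fin n))) :
    (dimKer n F : ℝ) + Module.finrank ℝ (Submodule.span ℝ (Set.image (bd n) (F : Set (Finset (Fin n))))) = F.card := by
  have h3 := LinearMap.finrank_range_add_finrank_ker (boundaryMap n F)
  rw [Module.finrank_fintype_fun_eq_card, Fintype.card_coe] at h3
  have h4 : LinearMap.range (boundaryMap n F) = Submodule.span ℝ (Set.image (bd n) (F : Set (Finset (Fin n)))) := by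
    have hb : ∀ x, boundaryMap n F x = ∑ σ : F, x σ • bd n σ.1 := by
      intro x; ext τ; simp [boundaryMap, bd]
    have : Submodule.span ℝ (Set.image (bd n) (F : Set (Finset (Fin n)))) =
        Submodule.span ℝ (Set.range fun σ : F => bd n σ.1) := by
      congr 1; ext v; simp
    rw [this]
    ext v
    rw [Submodule.mem_span_range_iff_exists_fun, LinearMap.mem_range]
    simp only [hb]
  rw [← h4, dimKer]
  exact_mod_cast (by omega : _ = F.card)

/-- `dimKer` changes by at most one when a face is added. -/
lemma dimKer_insert (F : Finset (Finset (Fin n))) (σ : Finset (Fin n)) :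
    ((dimKer n (insert σ F) : ℝ) - dimKer n F) ^ 2 ≤ 1 := by
  by_cases h : σ ∈ F
  · simp [insert_eq_of_mem h]
  have h1 := dimKer_add_span F
  have h2 := dimKer_add_span (insert σ F)
  rw [card_insert_of_notMem h, coe_insert, Set.image_insert_eq, Submodule.span_insert] at h2
  push_cast at h2
  set W := Submodule.span ℝ (Set.image (bd n) (F : Set (Finset (Fin n)))) with hW
  set U := Submodule.span ℝ {bd n σ} with hU
  have h3 : Module.finrank ℝ ↥(U ⊔ W) ≤ Module.finrank ℝ W + 1 := by
    refine (Submodule.finrank_add_le_finrank_add_finrank U W).trans ?_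
    have : Module.finrank ℝ U ≤ 1 := by
      have := finrank_span_le_card (R := ℝ) ({bd n σ} : Set (Finset (Fin n) → ℝ))
      simpa using this
    omega
  have h4 : Module.finrank ℝ W ≤ Module.finrank ℝ ↥(U ⊔ W) := Submodule.finrank_mono le_sup_right
  have h3' : (Module.finrank ℝ ↥(U ⊔ W) : ℝ) ≤ Module.finrank ℝ W + 1 := by exact_mod_cast h3
  have h4' : (Module.finrank ℝ W : ℝ) ≤ Module.finrank ℝ ↥(U ⊔ W) := by exact_mod_cast h4
  rw [sq_le_one_iff_abs_le_one, abs_le]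
  constructor <;> linarith

lemma dimKer_ge (F : Finset (Finset (Fin n))) {d : ℕ} (hF : ∀ σ ∈ F, σ.card = d + 1) :
    (F.card : ℝ) - n.choose d ≤ dimKer n F := by
  have h1 := dimKer_add_span F
  have h2 : Module.finrank ℝ (Submodule.span ℝ (Set.image (bd n) (F : Set (Finset (Fin n))))) ≤ n.choose d := by
    set T : Finset (Finset (Fin n) → ℝ) := (powersetCard d (univ : Finset (Fin n))).image
      (fun τ => Pi.single τ 1) with hT
    have h3 : Submodule.span ℝ (Set.image (bd n) (F : Set (Finset (Fin n)))) ≤ Submodule.span ℝ (T : Set _) := by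
      rw [Submodule.span_le]
      rintro _ ⟨σ, hσ, rfl⟩
      have : bd n σ = ∑ v ∈ σ, bd n σ (σ.erase v) • Pi.single (σ.erase v) 1 := by
        have h5 := bd_sum σ
        ext τ
        have := bd_sum σ (fun τ' => bd n σ τ' * (Pi.single τ' 1 : Finset (Fin n) → ℝ) τ)
          (fun τ' h => by simp [h])
        rw [Finset.sum_apply]
        simp only [Pi.smul_apply, smul_eq_mul]
        rw [← this]
        simp [Pi.single_apply]
      rw [this]
      refine Submodule.sum_mem _ fun v hv => Submodule.smul_mem _ _ (Submodule.subset_span ?_)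
      simp only [hT, coe_image, Set.mem_image, mem_coe, mem_powersetCard]
      refine ⟨_, ⟨subset_univ _, ?_⟩, rfl⟩
      rw [card_erase_of_mem hv, hF σ hσ]; rfl
    refine (Submodule.finrank_mono h3).trans ?_
    refine (finrank_span_finset_le_card T).trans ?_
    refine card_image_le.trans ?_
    simp
  have h2' : (Module.finrank ℝ (Submodule.span ℝ (Set.image (bd n) (F : Set (Finset (Fin n))))) : ℝ) ≤ n.choose d := by
    exact_mod_cast h2
  linarith

end BD

section Symmetry
open Matrix
variable {n : ℕ}

/-- action of a permutation on subsets. -/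
def pm (π : Equiv.Perm (Fin n)) : Equiv.Perm (Finset (Fin n)) := Equiv.finsetCongr π

lemma pm_apply (π : Equiv.Perm (Fin n)) (τ : Finset (Fin n)) : pm π τ = τ.map π.toEmbedding := rfl

lemma pm_card (π : Equiv.Perm (Fin n)) (τ : Finset (Fin n)) : (pm π τ).card = τ.card := by
  rw [pm_apply, card_map]

lemma pm_subset (π : Equiv.Perm (Fin n)) {τ σ : Finset (Fin n)} : pm π τ ⊆ pm π σ ↔ τ ⊆ σ := by
  rw [pm_apply, pm_apply, map_subset_map]

lemma pm_erase (π : Equiv.Perm (Fin n)) (σ : Finset (Fin n)) (v : Fin n) :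
    pm π (σ.erase v) = (pm π σ).erase (π v) := by
  rw [pm_apply, pm_apply, map_erase]; rfl

lemma pm_insert (π : Equiv.Perm (Fin n)) (σ : Finset (Fin n)) (v : Fin n) :
    pm π (insert v σ) = insert (π v) (pm π σ) := by
  rw [pm_apply, pm_apply, map_insert]; rfl

/-- The inversion sign of a permutation restricted to a set. -/
def eps (π : Equiv.Perm (Fin n)) (τ : Finset (Fin n)) : ℝ :=
  ∏ w ∈ τ, ∏ u ∈ τ, if w < u ∧ π u < π w then -1 else 1

lemma eps_sq (π : Equiv.Perm (Fin n)) (τ : Finset (Fin n)) : eps π τ * eps π τ = 1 := by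
  unfold eps
  rw [← prod_mul_distrib]
  refine prod_eq_one fun w _ => ?_
  rw [← prod_mul_distrib]
  refine prod_eq_one fun u _ => ?_
  split_ifs <;> simp

lemma bd_pm (π : Equiv.Perm (Fin n)) (σ τ : Finset (Fin n)) :
    bd n (pm π σ) (pm π τ) = eps π σ * eps π τ * bd n σ τ := by
  by_cases h : τ ⊆ σ ∧ τ.card + 1 = σ.card
  · obtain ⟨v, hv, rfl⟩ := exists_erase h
    have hv' : π v ∈ pm π σ := by rw [pm_apply]; exact mem_map_of_mem _ hv
    rw [pm_erase, bd_erase hv', bd_erase hv]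
    set τ := σ.erase v with hτ
    have hσ : σ = insert v τ := (insert_erase hv).symm
    have hvτ : v ∉ τ := notMem_erase v σ
    have e1 : eps π σ = (∏ u ∈ τ, (if v < u ∧ π u < π v then -1 else 1)) *
        (∏ w ∈ τ, (if w < v ∧ π v < π w then -1 else 1)) * eps π τ := by
      rw [hσ, eps, prod_insert hvτ, prod_insert hvτ]
      have : ∀ w ∈ τ, ∏ u ∈ insert v τ, (if w < u ∧ π u < π w then (-1 : ℝ) else 1) =
          (if w < v ∧ π v < π w then -1 else 1) * ∏ u ∈ τ, (if w < u ∧ π u < π w then (-1 : ℝ) else 1) :=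
        fun w _ => prod_insert hvτ
      rw [prod_congr rfl this, prod_mul_distrib]
      simp [eps]; ring
    have e2 : ((-1 : ℝ)) ^ (σ.filter (fun w => w < v)).card = ∏ w ∈ τ, (if w < v then -1 else 1) := by
      rw [hσ, filter_insert]
      simp only [lt_irrefl, if_false]
      rw [← prod_const, prod_filter]
    have e3 : ((-1 : ℝ)) ^ ((pm π σ).filter (fun w => w < π v)).card =
        ∏ w ∈ τ, (if π w < π v then -1 else 1) := by
      rw [hσ, pm_insert, filter_insert]
      simp only [lt_irrefl, if_false]
      rw [← prod_const, prod_filter, pm_apply, prod_map]; rfl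
    rw [e1, e2, e3]
    have : (∏ u ∈ τ, (if v < u ∧ π u < π v then (-1 : ℝ) else 1)) *
        (∏ w ∈ τ, (if w < v ∧ π v < π w then -1 else 1)) * eps π τ * eps π τ *
        ∏ w ∈ τ, (if w < v then -1 else 1) =
        (eps π τ * eps π τ) * ((∏ u ∈ τ, (if v < u ∧ π u < π v then (-1 : ℝ) else 1)) *
        (∏ w ∈ τ, (if w < v ∧ π v < π w then -1 else 1)) *
        ∏ w ∈ τ, (if w < v then -1 else 1)) := by ring
    rw [this, eps_sq, one_mul, ← prod_mul_distrib, ← prod_mul_distrib]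
    refine prod_congr rfl fun w hw => ?_
    have hne : w ≠ v := fun h => hvτ (h ▸ hw)
    have hne' : π w ≠ π v := fun h => hne (π.injective h)
    rcases lt_or_gt_of_ne hne with h1 | h1 <;> rcases lt_or_gt_of_ne hne' with h2 | h2 <;>
      simp [h1, h2, not_lt.2 h1.le, not_lt.2 h2.le]
  · rw [bd_eq_zero h, bd_eq_zero, mul_zero]
    rwa [pm_subset, pm_card, pm_card]

lemma LM_pm (π : Equiv.Perm (Fin n)) (F : Finset (Finset (Fin n))) (τ τ' : Finset (Fin n)) :
    LM (bd n) (F.map (pm π).toEmbedding) (pm π τ) (pm π τ') =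
      eps π τ * eps π τ' * LM (bd n) F τ τ' := by
  simp only [LM, Matrix.sum_apply, vecMulVec_apply, sum_map, mul_sum]
  refine sum_congr rfl fun σ _ => ?_
  have h1 := bd_pm π σ τ
  have h2 := bd_pm π σ τ'
  change bd n (pm π σ) (pm π τ) * bd n (pm π σ) (pm π τ') = _
  rw [h1, h2]
  have := eps_sq π σ
  linear_combination (eps π τ * eps π τ' * bd n σ τ * bd n σ τ') * this

lemma RM_pm (s : ℝ) (π : Equiv.Perm (Fin n)) (F : Finset (Finset (Fin n)))
    (τ τ' : Finset (Fin n)) :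
    RM s (bd n) (F.map (pm π).toEmbedding) (pm π τ) (pm π τ') =
      eps π τ * eps π τ' * RM s (bd n) F τ τ' := by
  set E : Matrix (Finset (Fin n)) (Finset (Fin n)) ℝ := diagonal (eps π) with hE
  have hEE : E * E = 1 := by
    rw [hE, diagonal_mul_diagonal]; simp [eps_sq]
  have hEinv : E⁻¹ = E := inv_eq_right_inv hEE
  have h1 : (1 + s • LM (bd n) (F.map (pm π).toEmbedding)).submatrix (pm π) (pm π) =
      E * (1 + s • LM (bd n) F) * E := by
    ext τ τ'
    rw [hE, mul_diagonal, diagonal_mul]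
    simp only [submatrix_apply, Matrix.add_apply, Matrix.smul_apply, smul_eq_mul, LM_pm]
    by_cases h : τ = τ'
    · subst h; simp; linear_combination - eps_sq π τ
    · have : pm π τ ≠ pm π τ' := fun h' => h ((pm π).injective h')
      simp [one_apply, h]; ring
  have h2 : (RM s (bd n) (F.map (pm π).toEmbedding)).submatrix (pm π) (pm π) =
      E * RM s (bd n) F * E := by
    rw [RM, ← inv_submatrix_equiv, h1, Matrix.mul_inv_rev, Matrix.mul_inv_rev, hEinv, ← mul_assoc]; rfl
  have h3 := congrFun (congrFun h2 τ) τ'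
  rw [hE, mul_diagonal, diagonal_mul] at h3
  rw [submatrix_apply] at h3
  rw [h3]; ring

lemma RM_pm_diag (s : ℝ) (π : Equiv.Perm (Fin n)) (F : Finset (Finset (Fin n)))
    (τ : Finset (Fin n)) :
    RM s (bd n) (F.map (pm π).toEmbedding) (pm π τ) (pm π τ) = RM s (bd n) F τ τ := by
  rw [RM_pm, eps_sq, one_mul]

lemma RM_pm_sq (s : ℝ) (π : Equiv.Perm (Fin n)) (F : Finset (Finset (Fin n)))
    (τ τ' : Finset (Fin n)) :
    RM s (bd n) (F.map (pm π).toEmbedding) (pm π τ) (pm π τ') ^ 2 = RM s (bd n) F τ τ' ^ 2 := by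
  rw [RM_pm]
  have h1 := eps_sq π τ
  have h2 := eps_sq π τ'
  calc _ = (eps π τ * eps π τ) * (eps π τ' * eps π τ') * RM s (bd n) F τ τ' ^ 2 := by ring
    _ = _ := by rw [h1, h2]; ring

lemma allFaces_pm (d : ℕ) (π : Equiv.Perm (Fin n)) :
    (allFaces n d).map (pm π).toEmbedding = allFaces n d := by
  ext σ
  rw [mem_map_equiv]
  have : ((pm π).symm σ).card = σ.card := by
    conv_rhs => rw [← (pm π).apply_symm_apply σ]
    rw [pm_card]
  simp [allFaces, this]

lemma bE_pm (d : ℕ) (p : ℝ) (π : Equiv.Perm (Fin n)) (X : Finset (Finset (Fin n)) → ℝ) :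
    bE (allFaces n d) p (fun F => X (F.map (pm π).toEmbedding)) = bE (allFaces n d) p X :=
  bE_map (pm π) (allFaces_pm d π) p X

lemma exists_pm {τ τ' : Finset (Fin n)} (h : τ.card = τ'.card) :
    ∃ π : Equiv.Perm (Fin n), pm π τ = τ' := by
  have e : {x // x ∈ τ} ≃ {x // x ∈ τ'} := Fintype.equivOfCardEq (by simpa using h)
  refine ⟨e.extendSubtype, ?_⟩
  rw [pm_apply]
  apply eq_of_subset_of_card_le
  · intro x hx
    obtain ⟨y, hy, rfl⟩ := Finset.mem_map.1 hx
    exact e.extendSubtype_mem y hy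
  · rw [card_map, h]

/-- a swap fixes every set which avoids or contains both points -/
lemma pm_swap_fix {v w : Fin n} {τ : Finset (Fin n)} (h : v ∈ τ ↔ w ∈ τ) :
    pm (Equiv.swap v w) τ = τ := by
  ext x
  rw [pm_apply, mem_map_equiv, Equiv.symm_swap]
  by_cases h1 : x = v
  · subst h1; rw [Equiv.swap_apply_left]; exact h.symm
  · by_cases h2 : x = w
    · subst h2; rw [Equiv.swap_apply_right]; exact h
    · rw [Equiv.swap_apply_of_ne_of_ne h1 h2]

lemma pm_swap_move {v w : Fin n} {τ : Finset (Fin n)} (hv : v ∈ τ) (hw : w ∉ τ.erase v) :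
    pm (Equiv.swap v w) τ = insert w (τ.erase v) := by
  conv_lhs => rw [← insert_erase hv]
  rw [pm_insert, Equiv.swap_apply_left, pm_swap_fix]
  simp [hw]

lemma card_allFaces (n d : ℕ) : (allFaces n d).card = n.choose (d + 1) := by
  have : allFaces n d = powersetCard (d + 1) univ := by
    ext σ; simp [allFaces, mem_powersetCard]
  rw [this, card_powersetCard]; simp

lemma mem_allFaces {d : ℕ} {σ : Finset (Fin n)} : σ ∈ allFaces n d ↔ σ.card = d + 1 := by
  simp [allFaces]

end Symmetry

section Estimates
variable {n : ℕ}

/-- Discrete derivative of the diagonal resolvent entry. -/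
def Dx (s : ℝ) (σ : Finset (Fin n)) (F : Finset (Finset (Fin n))) (τ : Finset (Fin n)) : ℝ :=
  RM s (bd n) (F.erase σ) τ τ - RM s (bd n) (insert σ F) τ τ

lemma insert_eq_erase_union {α : Type*} [DecidableEq α] (σ : α) (F : Finset α) :
    insert σ F = F.erase σ ∪ {σ} := by
  ext x; by_cases h : x = σ <;> simp [h]

lemma Dx_nonneg {s : ℝ} (hs : 0 ≤ s) (σ : Finset (Fin n)) (F) (τ) : 0 ≤ Dx s σ F τ := by
  rw [Dx, insert_eq_erase_union]
  have := (RM_diag_union hs (bd n) (F.erase σ) {σ}).1 τ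
  linarith

lemma Dx_sum_le {s : ℝ} (hs : 0 ≤ s) (σ : Finset (Fin n)) (F) (Q : Finset (Finset (Fin n))) :
    ∑ τ ∈ Q, Dx s σ F τ ≤ 1 := by
  have h1 : ∑ τ ∈ Q, Dx s σ F τ ≤ ∑ τ, Dx s σ F τ :=
    sum_le_sum_of_subset_of_nonneg (subset_univ _) fun τ _ _ => Dx_nonneg hs σ F τ
  have := (RM_diag_union hs (bd n) (F.erase σ) {σ}).2.2
  rw [← insert_eq_erase_union] at this
  simp only [card_singleton, Nat.cast_one] at this
  exact h1.trans this

lemma Dx_pm (s : ℝ) (π : Equiv.Perm (Fin n)) (σ : Finset (Fin n)) (F) (τ) :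
    Dx s (pm π σ) (F.map (pm π).toEmbedding) (pm π τ) = Dx s σ F τ := by
  have h1 : (F.map (pm π).toEmbedding).erase (pm π σ) = (F.erase σ).map (pm π).toEmbedding := by
    rw [map_erase]; rfl
  have h2 : insert (pm π σ) (F.map (pm π).toEmbedding) = (insert σ F).map (pm π).toEmbedding := by
    rw [map_insert]; rfl
  rw [Dx, h1, h2, RM_pm_diag, RM_pm_diag, Dx]

lemma sum_Dx_pm (s p : ℝ) (d : ℕ) (π : Equiv.Perm (Fin n)) (τ : Finset (Fin n)) :
    ∑ σ ∈ allFaces n d, bE (allFaces n d) p (fun F => Dx s σ F (pm π τ)) =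
    ∑ σ ∈ allFaces n d, bE (allFaces n d) p (fun F => Dx s σ F τ) := by
  conv_lhs => rw [← allFaces_pm d π, sum_map]
  refine sum_congr rfl fun σ _ => ?_
  rw [allFaces_pm d π]
  change bE (allFaces n d) p (fun F => Dx s (pm π σ) F (pm π τ)) = _
  rw [← bE_pm d p π]
  refine bE_congr fun F _ => ?_
  rw [Dx_pm]

lemma kappa_bound {s p C : ℝ} {d : ℕ} (hs : 0 ≤ s) (hp0 : 0 ≤ p) (hp1 : p ≤ 1) (hC : p * n ≤ C)
    {τ : Finset (Fin n)} (hτ : τ.card = d) :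
    p * ∑ σ ∈ allFaces n d, bE (allFaces n d) p (fun F => Dx s σ F τ) ≤ C := by
  set K := ∑ σ ∈ allFaces n d, bE (allFaces n d) p (fun F => Dx s σ F τ) with hK
  have h1 : ∀ τ' ∈ powersetCard d (univ : Finset (Fin n)),
      ∑ σ ∈ allFaces n d, bE (allFaces n d) p (fun F => Dx s σ F τ') = K := by
    intro τ' hτ'
    obtain ⟨π, rfl⟩ := exists_pm (hτ.trans (mem_powersetCard.1 hτ').2.symm)
    exact sum_Dx_pm s p d π τ
  have h2 : (n.choose d : ℝ) * K ≤ n.choose (d + 1) := by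
    have e : (n.choose d : ℝ) * K = ∑ τ' ∈ powersetCard d (univ : Finset (Fin n)),
        ∑ σ ∈ allFaces n d, bE (allFaces n d) p (fun F => Dx s σ F τ') := by
      rw [sum_congr rfl h1]; simp
    rw [e, sum_comm, ← card_allFaces, card_eq_sum_ones]
    push_cast
    refine sum_le_sum fun σ _ => ?_
    rw [← bE_sum]
    calc _ ≤ bE (allFaces n d) p (fun _ => 1) :=
          bE_mono hp0 hp1 fun F _ => Dx_sum_le hs σ F _
      _ = 1 := bE_const _ _ _
  have hdn : d ≤ n := by
    have := card_le_univ τ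
    simpa [hτ] using this
  have hpos : (0 : ℝ) < n.choose d := by exact_mod_cast Nat.choose_pos hdn
  have h3 : (n.choose (d + 1) : ℝ) ≤ n.choose d * n := by
    have h4 : n.choose (d + 1) * (d + 1) = n.choose d * (n - d) := Nat.choose_succ_right_eq n d
    have h5 : n.choose (d + 1) ≤ n.choose d * n :=
      calc n.choose (d + 1) ≤ n.choose (d + 1) * (d + 1) := Nat.le_mul_of_pos_right _ (by omega)
        _ = n.choose d * (n - d) := h4
        _ ≤ _ := Nat.mul_le_mul_left _ (by omega)
    exact_mod_cast h5
  have h6 : K ≤ n := by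
    have := h2.trans h3
    exact le_of_mul_le_mul_left this hpos
  exact (mul_le_mul_of_nonneg_left h6 hp0).trans hC

lemma var_bound {s p C : ℝ} {d : ℕ} (hs : 0 ≤ s) (hp0 : 0 ≤ p) (hp1 : p ≤ 1) (hC : p * n ≤ C)
    {Q : Finset (Finset (Fin n))} (hQ : ∀ τ ∈ Q, τ.card = d) {A : Finset (Finset (Fin n)) → ℝ}
    {L : ℝ} (hA : ∀ σ F, |A (insert σ F) - A (F.erase σ)| ≤ L * ∑ τ ∈ Q, Dx s σ F τ) :
    bE (allFaces n d) p (fun F => (A F - bE (allFaces n d) p A) ^ 2) ≤ L ^ 2 * (C * Q.card) := by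
  refine (efron_stein hp0 hp1 A).trans ?_
  have h1 : ∀ σ F, (A (insert σ F) - A (F.erase σ)) ^ 2 ≤ L ^ 2 * ∑ τ ∈ Q, Dx s σ F τ := by
    intro σ F
    have h := hA σ F
    have h0 : 0 ≤ ∑ τ ∈ Q, Dx s σ F τ := sum_nonneg fun τ _ => Dx_nonneg hs σ F τ
    have h1 := Dx_sum_le hs σ F Q
    calc (A (insert σ F) - A (F.erase σ)) ^ 2 = |A (insert σ F) - A (F.erase σ)| ^ 2 := (sq_abs _).symm
      _ ≤ (L * ∑ τ ∈ Q, Dx s σ F τ) ^ 2 := pow_le_pow_left₀ (abs_nonneg _) h 2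
      _ = L ^ 2 * (∑ τ ∈ Q, Dx s σ F τ) ^ 2 := by ring
      _ ≤ _ := mul_le_mul_of_nonneg_left (by nlinarith) (sq_nonneg _)
  calc _ ≤ p * ∑ σ ∈ allFaces n d, bE (allFaces n d) p (fun F => L ^ 2 * ∑ τ ∈ Q, Dx s σ F τ) := by
        refine mul_le_mul_of_nonneg_left (sum_le_sum fun σ _ => ?_) hp0
        exact bE_mono hp0 hp1 fun F _ => h1 σ F
    _ = L ^ 2 * ∑ τ ∈ Q, p * ∑ σ ∈ allFaces n d, bE (allFaces n d) p (fun F => Dx s σ F τ) := by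
        simp only [bE_mul, bE_sum]
        rw [← mul_sum, sum_comm, ← mul_sum]; ring
    _ ≤ L ^ 2 * ∑ τ ∈ Q, C := by
        refine mul_le_mul_of_nonneg_left (sum_le_sum fun τ hτ => ?_) (sq_nonneg _)
        exact kappa_bound hs hp0 hp1 hC (hQ τ hτ)
    _ = _ := by rw [sum_const, nsmul_eq_mul]; ring

lemma bE_x_pm (s p : ℝ) (d : ℕ) (π : Equiv.Perm (Fin n)) (τ : Finset (Fin n)) :
    bE (allFaces n d) p (fun F => RM s (bd n) F (pm π τ) (pm π τ)) =
    bE (allFaces n d) p (fun F => RM s (bd n) F τ τ) := by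
  rw [← bE_pm d p π]
  exact bE_congr fun F _ => by rw [RM_pm_diag]

lemma cov_bound {s p C : ℝ} {d : ℕ} (hs : 0 ≤ s) (hp0 : 0 ≤ p) (hp1 : p ≤ 1) (hC : p * n ≤ C)
    (hn : 2 * d < n) {τ₁ τ₂ : Finset (Fin n)} (h1 : τ₁.card = d) (h2 : τ₂.card = d) (hne : τ₁ ≠ τ₂) :
    bCov (allFaces n d) p (fun F => RM s (bd n) F τ₁ τ₁) (fun F => RM s (bd n) F τ₂ τ₂) ≤
      Real.sqrt (C / (n - 2 * d)) := by
  have hC0 : 0 ≤ C := le_trans (by positivity) hC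
  obtain ⟨v, hv2, hv1⟩ : ∃ v ∈ τ₂, v ∉ τ₁ := by
    by_contra hcon
    push Not at hcon
    exact hne (eq_of_subset_of_card_le hcon (by omega)).symm
  set W : Finset (Fin n) := univ \ (τ₁ ∪ τ₂) with hW
  set f : Fin n → Finset (Fin n) := fun w => insert w (τ₂.erase v) with hf
  have hWc : n - 2 * d ≤ W.card := by
    rw [hW, card_sdiff_of_subset (subset_univ _)]
    have := card_union_le τ₁ τ₂
    simp only [card_univ, Fintype.card_fin]; omega
  have hmem : ∀ w ∈ W, w ∉ τ₁ ∧ w ∉ τ₂ := fun w hw => by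
    simpa [hW, not_or] using hw
  have hinj : Set.InjOn f W := by
    intro w hw w' hw' h
    have h3 : w ∈ f w' := by rw [← h]; simp [hf]
    simp only [hf, mem_insert] at h3
    rcases h3 with h3 | h3
    · exact h3
    · exact absurd (mem_of_mem_erase h3) (hmem w hw).2
  have hfpm : ∀ w ∈ W, pm (Equiv.swap v w) τ₂ = f w ∧ pm (Equiv.swap v w) τ₁ = τ₁ := by
    intro w hw
    refine ⟨pm_swap_move hv2 fun h => (hmem w hw).2 (mem_of_mem_erase h), pm_swap_fix ?_⟩
    simp [hv1, (hmem w hw).1]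
  have hfc : ∀ w ∈ W, (f w).card = d := fun w hw => by
    rw [← (hfpm w hw).1, pm_card, h2]
  set cv := bCov (allFaces n d) p (fun F => RM s (bd n) F τ₁ τ₁) (fun F => RM s (bd n) F τ₂ τ₂) with hcv
  have hcov : ∀ w ∈ W, bCov (allFaces n d) p (fun F => RM s (bd n) F τ₁ τ₁)
      (fun F => RM s (bd n) F (f w) (f w)) = cv := by
    intro w hw
    obtain ⟨e2, e1⟩ := hfpm w hw
    have a1 : bE (allFaces n d) p (fun F => RM s (bd n) F (f w) (f w)) =
        bE (allFaces n d) p (fun F => RM s (bd n) F τ₂ τ₂) := by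
      rw [← e2, bE_x_pm]
    have a2 : bE (allFaces n d) p (fun F => RM s (bd n) F τ₁ τ₁ * RM s (bd n) F (f w) (f w)) =
        bE (allFaces n d) p (fun F => RM s (bd n) F τ₁ τ₁ * RM s (bd n) F τ₂ τ₂) := by
      rw [← bE_pm d p (Equiv.swap v w)]
      refine bE_congr fun F _ => ?_
      conv_lhs => rw [← e2]
      rw [RM_pm_diag]
      conv_lhs => rw [← e1]
      rw [RM_pm_diag]
    rw [bCov, a1, a2, hcv, bCov]
  have hsum : (W.card : ℝ) * cv ≤ Real.sqrt (C * W.card) := by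
    have e : (W.card : ℝ) * cv = bCov (allFaces n d) p (fun F => RM s (bd n) F τ₁ τ₁)
        (fun F => ∑ w ∈ W, RM s (bd n) F (f w) (f w)) := by
      rw [bCov_sum_right, sum_congr rfl hcov]; simp
    rw [e]
    refine (bCov_le hp0 hp1 (fun F => diag_nonneg hs _ F τ₁) (fun F => diag_le_one hs _ F τ₁)).trans ?_
    apply Real.sqrt_le_sqrt
    have hQ : ∀ τ ∈ W.image f, τ.card = d := by
      intro τ hτ
      obtain ⟨w, hw, rfl⟩ := mem_image.1 hτ
      exact hfc w hw
    have := var_bound (A := fun F => ∑ w ∈ W, RM s (bd n) F (f w) (f w)) (L := 1) hs hp0 hp1 hC hQ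
      (by
        intro σ F
        rw [sum_image hinj, ← sum_sub_distrib, one_mul]
        refine (abs_sum_le_sum_abs _ _).trans (sum_le_sum fun w _ => ?_)
        rw [abs_sub_comm, ← Dx, abs_of_nonneg (Dx_nonneg hs _ _ _)])
    rw [card_image_of_injOn hinj] at this
    simpa using this
  have hWpos : (0 : ℝ) < W.card := by
    have : 0 < W.card := by omega
    exact_mod_cast this
  have h5 : cv ≤ Real.sqrt (C / W.card) := by
    have : Real.sqrt (C * W.card) = W.card * Real.sqrt (C / W.card) := by
      have e : C * W.card = (W.card : ℝ) ^ 2 * (C / W.card) := by field_simp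
      rw [e, Real.sqrt_mul (by positivity), Real.sqrt_sq hWpos.le]
    rw [this] at hsum
    exact le_of_mul_le_mul_left hsum hWpos
  refine h5.trans (Real.sqrt_le_sqrt ?_)
  have h6 : (n : ℝ) - 2 * d ≤ W.card := by
    have : ((n - 2 * d : ℕ) : ℝ) ≤ W.card := by exact_mod_cast hWc
    rw [Nat.cast_sub hn.le] at this
    push_cast at this; exact this
  have h7 : (0 : ℝ) < n - 2 * d := by
    have : ((2 * d : ℕ) : ℝ) < n := by exact_mod_cast hn
    push_cast at this; linarith
  exact div_le_div_of_nonneg_left hC0 h7 h6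

lemma adj_bound {s p : ℝ} {d : ℕ} (hs : 0 ≤ s) (hp0 : 0 ≤ p) (hp1 : p ≤ 1)
    (hn : d < n) {τ₁ τ₂ : Finset (Fin n)} (h1 : τ₁.card = d) {v : Fin n} (hv2 : v ∈ τ₂)
    (hv1 : v ∉ τ₁) (hsub : τ₂.erase v ⊆ τ₁) :
    bE (allFaces n d) p (fun F => RM s (bd n) F τ₁ τ₂ ^ 2) ≤ 1 / (n - d) := by
  set W : Finset (Fin n) := univ \ τ₁ with hW
  set f : Fin n → Finset (Fin n) := fun w => insert w (τ₂.erase v) with hf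
  have hWc : W.card = n - d := by
    rw [hW, card_sdiff_of_subset (subset_univ _), h1]; simp
  have hmem : ∀ w ∈ W, w ∉ τ₁ := fun w hw => by
    simpa [hW] using hw
  have hinj : Set.InjOn f W := by
    intro w hw w' hw' h
    have h3 : w ∈ f w' := by rw [← h]; simp [hf]
    simp only [hf, mem_insert] at h3
    rcases h3 with h3 | h3
    · exact h3
    · exact absurd (hsub h3) (hmem w hw)
  have hfpm : ∀ w ∈ W, pm (Equiv.swap v w) τ₂ = f w ∧ pm (Equiv.swap v w) τ₁ = τ₁ := by
    intro w hw
    refine ⟨pm_swap_move hv2 fun h => (hmem w hw) (hsub h), pm_swap_fix ?_⟩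
    simp [hv1, hmem w hw]
  set K := bE (allFaces n d) p (fun F => RM s (bd n) F τ₁ τ₂ ^ 2) with hK
  have hw : ∀ w ∈ W, bE (allFaces n d) p (fun F => RM s (bd n) F τ₁ (f w) ^ 2) = K := by
    intro w hw
    obtain ⟨e2, e1⟩ := hfpm w hw
    rw [← bE_pm d p (Equiv.swap v w)]
    refine bE_congr fun F _ => ?_
    conv_lhs => rw [← e2, ← e1]
    rw [RM_pm_sq]
  have hsum : (W.card : ℝ) * K ≤ 1 := by
    have e : (W.card : ℝ) * K = bE (allFaces n d) p (fun F => ∑ w ∈ W, RM s (bd n) F τ₁ (f w) ^ 2) := by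
      rw [bE_sum, sum_congr rfl hw]; simp
    rw [e]
    calc _ ≤ bE (allFaces n d) p (fun _ => 1) := by
          refine bE_mono hp0 hp1 fun F _ => ?_
          rw [← sum_image (f := fun τ => RM s (bd n) F τ₁ τ ^ 2) hinj]
          calc _ ≤ ∑ τ, RM s (bd n) F τ₁ τ ^ 2 :=
                sum_le_sum_of_subset_of_nonneg (subset_univ _) fun _ _ _ => sq_nonneg _
            _ ≤ _ := row_sq_le hs _ F τ₁
            _ ≤ 1 := diag_le_one hs _ F τ₁
      _ = 1 := bE_const _ _ _
  have e : (W.card : ℝ) = n - d := by rw [hWc, Nat.cast_sub hn.le]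
  rw [e] at hsum
  have : (0 : ℝ) < n - d := by
    have : (d : ℝ) < n := by exact_mod_cast hn
    linarith
  rw [le_div_iff₀ this]; linarith

end Estimates

section Decorr
variable {α ι : Type*} [DecidableEq α] [DecidableEq ι]

lemma pow_sub_le {y z : ℝ} (hz : 0 ≤ z) (hzy : z ≤ y) (hy : y ≤ 1) (a : ℕ) :
    y ^ a - z ^ a ≤ a * (y - z) := by
  induction a with
  | zero => simp
  | succ a ih =>
    have h1 : z ^ a ≤ 1 := pow_le_one₀ hz (by linarith)
    have h3 : 0 ≤ y ^ a - z ^ a := sub_nonneg.2 (pow_le_pow_left₀ hz hzy a)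
    push_cast
    calc y ^ (a + 1) - z ^ (a + 1) = y * (y ^ a - z ^ a) + z ^ a * (y - z) := by ring
      _ ≤ 1 * (y ^ a - z ^ a) + 1 * (y - z) := by
          gcongr
      _ ≤ _ := by linarith

lemma prod_pow_sub_le (I : Finset ι) (a : ι → ℕ) {y z : ι → ℝ} (hz : ∀ i, 0 ≤ z i)
    (hzy : ∀ i, z i ≤ y i) (hy : ∀ i, y i ≤ 1) :
    ∏ i ∈ I, y i ^ a i - ∏ i ∈ I, z i ^ a i ≤ ∑ i ∈ I, (a i : ℝ) * (y i - z i) := by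
  induction I using Finset.induction_on with
  | empty => simp
  | insert j I hj ih =>
    rw [prod_insert hj, prod_insert hj, sum_insert hj]
    have hy0 : ∀ i, 0 ≤ y i := fun i => (hz i).trans (hzy i)
    have h1 : ∏ i ∈ I, z i ^ a i ≤ 1 :=
      prod_le_one (fun i _ => pow_nonneg (hz i) _)
        (fun i _ => pow_le_one₀ (hz i) ((hzy i).trans (hy i)))
    have h0 : 0 ≤ ∏ i ∈ I, z i ^ a i := prod_nonneg fun i _ => pow_nonneg (hz i) _
    have h2 : y j ^ a j ≤ 1 := pow_le_one₀ (hy0 j) (hy j)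
    have h3 : 0 ≤ ∏ i ∈ I, y i ^ a i - ∏ i ∈ I, z i ^ a i :=
      sub_nonneg.2 (prod_le_prod (fun i _ => pow_nonneg (hz i) _)
        (fun i _ => pow_le_pow_left₀ (hz i) (hzy i) _))
    have h4 : 0 ≤ y j ^ a j - z j ^ a j := sub_nonneg.2 (pow_le_pow_left₀ (hz j) (hzy j) _)
    have h5 := pow_sub_le (hz j) (hzy j) (hy j) (a j)
    calc _ = y j ^ a j * (∏ i ∈ I, y i ^ a i - ∏ i ∈ I, z i ^ a i) +
          (∏ i ∈ I, z i ^ a i) * (y j ^ a j - z j ^ a j) := by ring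
      _ ≤ 1 * (∏ i ∈ I, y i ^ a i - ∏ i ∈ I, z i ^ a i) + 1 * (y j ^ a j - z j ^ a j) := by
          gcongr
      _ ≤ _ := by linarith

lemma harris_cov_le {S : Finset α} {p : ℝ} (hp0 : 0 ≤ p) (hp1 : p ≤ 1) {U V A B : Finset α → ℝ}
    (hU : Antitone U) (hB : Antitone B)
    (hAU : Antitone (fun F => A F - U F)) (hBV : Antitone (fun F => B F - V F)) :
    bCov S p U V ≤ bCov S p A B := by
  have h1 := harris (S := S) hp0 hp1 hAU hB
  have h2 := harris (S := S) hp0 hp1 hU hBV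
  have e1 : bE S p (fun F => (A F - U F) * B F) =
      bE S p (fun F => A F * B F) - bE S p (fun F => U F * B F) := by
    rw [← bE_sub]; congr 1; ext F; ring
  have e2 : bE S p (fun F => U F * (B F - V F)) =
      bE S p (fun F => U F * B F) - bE S p (fun F => U F * V F) := by
    rw [← bE_sub]; congr 1; ext F; ring
  rw [e1, bE_sub] at h1
  rw [e2, bE_sub] at h2
  unfold bCov
  nlinarith

lemma decorr {S : Finset α} {p : ℝ} (hp0 : 0 ≤ p) (hp1 : p ≤ 1) (X : ι → Finset α → ℝ)
    (hX : ∀ i, Antitone (X i)) (h0 : ∀ i F, 0 ≤ X i F) (h1 : ∀ i F, X i F ≤ 1) (a : ι → ℕ)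
    {δ : ℝ} (hδ : ∀ i j, i ≠ j → bCov S p (X i) (X j) ≤ δ) (I : Finset ι) :
    |bE S p (fun F => ∏ i ∈ I, X i F ^ a i) - ∏ i ∈ I, bE S p (fun F => X i F ^ a i)| ≤
      ∑ j ∈ I, ∑ i ∈ I, (a i : ℝ) * (a j * |δ|) := by
  induction I using Finset.induction_on with
  | empty => simp [bE_const]
  | insert j I hj ih =>
    set U : Finset α → ℝ := fun F => ∏ i ∈ I, X i F ^ a i with hU
    set Vv : Finset α → ℝ := fun F => X j F ^ a j with hV
    set A : Finset α → ℝ := fun F => ∑ i ∈ I, (a i : ℝ) * X i F with hA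
    set B : Finset α → ℝ := fun F => (a j : ℝ) * X j F with hB
    have hUa : Antitone U := fun F G h =>
      prod_le_prod (fun i _ => pow_nonneg (h0 i _) _) (fun i _ => pow_le_pow_left₀ (h0 i _) (hX i h) _)
    have hVa : Antitone Vv := fun F G h => pow_le_pow_left₀ (h0 j _) (hX j h) _
    have hBa : Antitone B := fun F G h => mul_le_mul_of_nonneg_left (hX j h) (by positivity)
    have hAU : Antitone (fun F => A F - U F) := fun F G h => by
      have := prod_pow_sub_le I a (y := fun i => X i F) (z := fun i => X i G) (fun i => h0 i G)
        (fun i => hX i h) (fun i => h1 i F)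
      simp only [mul_sub, sum_sub_distrib] at this
      simp only [hA, hU]; linarith
    have hBV : Antitone (fun F => B F - Vv F) := fun F G h => by
      have := pow_sub_le (h0 j G) (hX j h) (h1 j F) (a j)
      simp only [hB, hV]; linarith
    have hc1 := harris_cov_le (S := S) hp0 hp1 hUa hBa hAU hBV
    have hc0 : 0 ≤ bCov S p U Vv := sub_nonneg.2 (harris hp0 hp1 hUa hVa)
    have hc2 : bCov S p A B ≤ ∑ i ∈ I, (a i : ℝ) * (a j * |δ|) := by
      have e : bCov S p A B = ∑ i ∈ I, (a i : ℝ) * (a j * bCov S p (X i) (X j)) := by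
        simp only [bCov, hA, hB, sum_mul, bE_sum, bE_mul]
        rw [← sum_sub_distrib]
        refine sum_congr rfl fun i _ => ?_
        have : (fun F => (a i : ℝ) * X i F * (a j * X j F)) =
          fun F => ((a i : ℝ) * a j) * (X i F * X j F) := by funext F; ring
        rw [this, bE_mul]; ring
      rw [e]
      refine sum_le_sum fun i hi => ?_
      have := (hδ i j (fun h => hj (h ▸ hi))).trans (le_abs_self δ)
      gcongr
    have e1 : bE S p (fun F => ∏ i ∈ insert j I, X i F ^ a i) = bE S p (fun F => U F * Vv F) := by
      refine bE_congr fun F _ => ?_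
      rw [prod_insert hj, mul_comm]
    rw [e1, prod_insert hj]
    have hV1 : |bE S p Vv| ≤ 1 := by
      rw [abs_of_nonneg (bE_nonneg hp0 hp1 fun F _ => pow_nonneg (h0 j F) _)]
      calc _ ≤ bE S p (fun _ => 1) := bE_mono hp0 hp1 fun F _ => pow_le_one₀ (h0 j F) (h1 j F)
        _ = 1 := bE_const _ _ _
    have hstep : bE S p (fun F => U F * Vv F) - bE S p Vv * ∏ i ∈ I, bE S p (fun F => X i F ^ a i) =
        bCov S p U Vv + bE S p Vv * (bE S p U - ∏ i ∈ I, bE S p (fun F => X i F ^ a i)) := by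
      rw [bCov]; ring
    rw [hstep]
    refine (abs_add_le _ _).trans ?_
    rw [abs_mul, abs_of_nonneg hc0]
    have hb : |bE S p Vv| * |bE S p U - ∏ i ∈ I, bE S p (fun F => X i F ^ a i)| ≤
        1 * ∑ j ∈ I, ∑ i ∈ I, (a i : ℝ) * (a j * |δ|) :=
      mul_le_mul hV1 ih (abs_nonneg _) zero_le_one
    rw [sum_insert hj, sum_insert hj]
    have hc3 : ∑ j ∈ I, ∑ i ∈ I, (a i : ℝ) * (a j * |δ|) ≤
        ∑ k ∈ I, ∑ i ∈ insert j I, (a i : ℝ) * (a k * |δ|) := by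
      refine sum_le_sum fun k _ => sum_le_sum_of_subset_of_nonneg (subset_insert _ _) ?_
      intros; positivity
    have hc4 : 0 ≤ (a j : ℝ) * (a j * |δ|) := by positivity
    linarith

end Decorr

section EG

/-- `eg θ x = exp (-θ/x)` for `x > 0` and `0` for `x ≤ 0`. -/
def eg (θ x : ℝ) : ℝ := expNegInvGlue (x / θ)

lemma eg_of_pos {θ x : ℝ} (hθ : 0 < θ) (hx : 0 < x) : eg θ x = Real.exp (-(θ / x)) := by
  rw [eg, expNegInvGlue, if_neg (not_le.2 (by positivity)), inv_div]

lemma eg_of_nonpos {θ x : ℝ} (hθ : 0 < θ) (hx : x ≤ 0) : eg θ x = 0 := by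
  rw [eg]; exact expNegInvGlue.zero_of_nonpos (div_nonpos_of_nonpos_of_nonneg hx hθ.le)

lemma eg_nonneg (θ x : ℝ) : 0 ≤ eg θ x := expNegInvGlue.nonneg _

lemma eg_le_one (θ x : ℝ) : eg θ x ≤ 1 := by
  rw [eg, expNegInvGlue]
  split_ifs with h
  · exact zero_le_one
  · push Not at h
    rw [Real.exp_le_one_iff]
    have : 0 < (x / θ)⁻¹ := by positivity
    linarith

lemma glue_lip (x y : ℝ) : |expNegInvGlue x - expNegInvGlue y| ≤ 2 * |x - y| := by
  have hd : ∀ x : ℝ, HasDerivAt expNegInvGlue (x⁻¹ ^ 2 * expNegInvGlue x) x := by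
    intro x
    have := expNegInvGlue.hasDerivAt_polynomial_eval_inv_mul 1 x
    simpa using this
  have hb : ∀ x : ℝ, ‖x⁻¹ ^ 2 * expNegInvGlue x‖ ≤ 2 := by
    intro x
    rw [Real.norm_eq_abs, abs_of_nonneg (mul_nonneg (sq_nonneg _) (expNegInvGlue.nonneg x))]
    rw [expNegInvGlue]
    split_ifs with h
    · simp
    · push Not at h
      have hu : 0 < x⁻¹ := by positivity
      have h1 := Real.quadratic_le_exp_of_nonneg hu.le
      rw [Real.exp_neg, ← div_eq_mul_inv, div_le_iff₀ (Real.exp_pos _)]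
      nlinarith
  have := Convex.norm_image_sub_le_of_norm_hasDerivWithin_le (f := expNegInvGlue) (s := Set.univ)
    (x := y) (y := x) (C := 2) (fun x _ => (hd x).hasDerivWithinAt) (fun x _ => hb x) convex_univ
    (Set.mem_univ _) (Set.mem_univ _)
  simpa [Real.norm_eq_abs] using this

lemma eg_lip {θ : ℝ} (hθ : 0 < θ) (x y : ℝ) : |eg θ x - eg θ y| ≤ 2 / θ * |x - y| := by
  refine (glue_lip _ _).trans (le_of_eq ?_)
  rw [← sub_div, abs_div, abs_of_pos hθ]; ring

lemma eg_continuous (θ : ℝ) : Continuous (eg θ) := by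
  unfold eg
  exact (expNegInvGlue.contDiff (n := 0)).continuous.comp (continuous_id.div_const θ)

lemma exp_neg_lip {a b : ℝ} (ha : 0 ≤ a) (hb : 0 ≤ b) :
    |Real.exp (-a) - Real.exp (-b)| ≤ |a - b| := by
  wlog h : a ≤ b generalizing a b
  · rw [abs_sub_comm, abs_sub_comm a b]; exact this hb ha (by linarith)
  have h1 : Real.exp (-b) ≤ Real.exp (-a) := Real.exp_le_exp.2 (by linarith)
  rw [abs_of_nonneg (by linarith), abs_of_nonpos (by linarith)]
  have h2 : Real.exp (-b) = Real.exp (-a) * Real.exp (-(b - a)) := by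
    rw [← Real.exp_add]; ring_nf
  have h3 := Real.add_one_le_exp (-(b - a))
  have h4 : Real.exp (-a) ≤ 1 := Real.exp_le_one_iff.2 (by linarith)
  have h5 := Real.exp_pos (-a)
  rw [h2]
  nlinarith

lemma one_sub_exp {t : ℝ} (h0 : 0 ≤ t) (h1 : t ≤ 1) : |(1 - t) - Real.exp (-t)| ≤ t ^ 2 := by
  have := Real.abs_exp_sub_one_sub_id_le (x := -t) (by rw [abs_neg, abs_of_nonneg h0]; exact h1)
  rw [abs_sub_comm] at this
  have e : Real.exp (-t) - 1 - -t = - ((1 - t) - Real.exp (-t)) := by ring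
  rw [abs_sub_comm, e, abs_neg, neg_sq] at this
  exact this

lemma prod_exp {ι : Type*} (T : Finset ι) {p : ℝ} (hp0 : 0 ≤ p) (hp1 : p ≤ 1) (y : ι → ℝ)
    (hy0 : ∀ i ∈ T, 0 ≤ y i) (hy1 : ∀ i ∈ T, y i ≤ 1) :
    |∏ i ∈ T, (1 - p * y i) - Real.exp (-(p * ∑ i ∈ T, y i))| ≤ T.card * p ^ 2 := by
  have hA : 0 ≤ ∏ i ∈ T, (1 - p * y i) ∧ ∏ i ∈ T, (1 - p * y i) ≤ 1 := by
    have h : ∀ i ∈ T, 0 ≤ 1 - p * y i := fun i hi => by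
      have := hy0 i hi; have := hy1 i hi; nlinarith
    refine ⟨prod_nonneg h, prod_le_one h fun i hi => ?_⟩
    have := mul_nonneg hp0 (hy0 i hi); linarith
  induction T using Finset.induction_on with
  | empty => simp
  | insert j T hj ih =>
    have hy0' : ∀ i ∈ T, 0 ≤ y i := fun i hi => hy0 i (mem_insert_of_mem hi)
    have hy1' : ∀ i ∈ T, y i ≤ 1 := fun i hi => hy1 i (mem_insert_of_mem hi)
    have hj0 := hy0 j (mem_insert_self j T)
    have hj1 := hy1 j (mem_insert_self j T)
    have hT : 0 ≤ ∏ i ∈ T, (1 - p * y i) ∧ ∏ i ∈ T, (1 - p * y i) ≤ 1 := by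
      have h : ∀ i ∈ T, 0 ≤ 1 - p * y i := fun i hi => by
        have := hy0' i hi; have := hy1' i hi; nlinarith
      refine ⟨prod_nonneg h, prod_le_one h fun i hi => ?_⟩
      have := mul_nonneg hp0 (hy0' i hi); linarith
    have ih' := ih hy0' hy1' hT
    rw [prod_insert hj, sum_insert hj, card_insert_of_notMem hj]
    have e : Real.exp (-(p * (y j + ∑ i ∈ T, y i))) =
        Real.exp (-(p * y j)) * Real.exp (-(p * ∑ i ∈ T, y i)) := by
      rw [← Real.exp_add]; ring_nf
    rw [e]
    have ht0 : 0 ≤ p * y j := mul_nonneg hp0 hj0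
    have ht1 : p * y j ≤ p := mul_le_of_le_one_right hp0 hj1
    have h1 := one_sub_exp ht0 (by linarith)
    have h2 : Real.exp (-(p * y j)) ≤ 1 := Real.exp_le_one_iff.2 (by linarith)
    have h3 := Real.exp_pos (-(p * y j))
    have h4 : (p * y j) ^ 2 ≤ p ^ 2 := pow_le_pow_left₀ ht0 ht1 2
    calc _ = |((1 - p * y j) - Real.exp (-(p * y j))) * ∏ i ∈ T, (1 - p * y i) +
          Real.exp (-(p * y j)) * (∏ i ∈ T, (1 - p * y i) - Real.exp (-(p * ∑ i ∈ T, y i)))| := by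
            congr 1; ring
      _ ≤ _ := abs_add_le _ _
      _ ≤ p ^ 2 * 1 + 1 * (T.card * p ^ 2) := by
          rw [abs_mul, abs_mul, abs_of_nonneg hT.1, abs_of_pos h3]
          gcongr
          · exact hT.1
          · exact h1.trans h4
          · exact hT.2
      _ = _ := by push_cast; ring

end EG

section Star
variable {n : ℕ}

/-- the faces containing `τ` with one more vertex. -/
def TT (τ : Finset (Fin n)) : Finset (Finset (Fin n)) := (univ \ τ).image (fun u => insert u τ)

/-- the other facets of the faces in `TT τ`. -/
def QQ (τ : Finset (Fin n)) : Finset (Finset (Fin n)) := (TT τ ×ˢ τ).image (fun z => z.1.erase z.2)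

lemma mem_TT {τ σ : Finset (Fin n)} : σ ∈ TT τ ↔ ∃ u, u ∉ τ ∧ σ = insert u τ := by
  simp only [TT, mem_image, Finset.mem_sdiff, mem_univ, true_and]
  constructor
  · rintro ⟨u, hu, rfl⟩; exact ⟨u, hu, rfl⟩
  · rintro ⟨u, hu, rfl⟩; exact ⟨u, hu, rfl⟩

lemma TT_card (τ : Finset (Fin n)) : (TT τ).card = n - τ.card := by
  rw [TT, card_image_of_injOn, card_sdiff_of_subset (subset_univ _)]
  · simp
  · intro u hu u' hu' h
    simp only [coe_sdiff, Set.mem_sdiff, mem_coe] at hu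
    have h : insert u τ = insert u' τ := h
    have : u ∈ insert u' τ := by rw [← h]; simp
    rcases mem_insert.1 this with h | h
    · exact h
    · exact absurd h hu.2

lemma TT_subset {d : ℕ} {τ : Finset (Fin n)} (hτ : τ.card = d) : TT τ ⊆ allFaces n d := by
  intro σ hσ
  obtain ⟨u, hu, rfl⟩ := mem_TT.1 hσ
  rw [mem_allFaces, card_insert_of_notMem hu, hτ]

lemma QQ_inj (τ : Finset (Fin n)) :
    Set.InjOn (fun z : Finset (Fin n) × Fin n => z.1.erase z.2) (TT τ ×ˢ τ : Finset _) := by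
  rintro ⟨σ, v⟩ h ⟨σ', v'⟩ h' heq
  simp only [mem_coe, mem_product] at h h'
  obtain ⟨u, hu, rfl⟩ := mem_TT.1 h.1
  obtain ⟨u', hu', rfl⟩ := mem_TT.1 h'.1
  simp only at heq
  have hvv : v = v' := by
    by_contra hne
    have : v ∈ (insert u' τ).erase v' := mem_erase.2 ⟨hne, mem_insert_of_mem h.2⟩
    rw [← heq] at this
    exact absurd this (notMem_erase _ _)
  subst hvv
  have h1 : insert v ((insert u τ).erase v) = insert u τ := insert_erase (mem_insert_of_mem h.2)
  have h2 : insert v ((insert u' τ).erase v) = insert u' τ := insert_erase (mem_insert_of_mem h.2)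
  rw [heq] at h1
  rw [← h1, h2]

lemma QQ_sum (τ : Finset (Fin n)) (f : Finset (Fin n) → ℝ) :
    ∑ σ ∈ TT τ, ∑ v ∈ τ, f (σ.erase v) = ∑ q ∈ QQ τ, f q := by
  rw [QQ, sum_image (QQ_inj τ), sum_product]

lemma QQ_card (τ : Finset (Fin n)) : (QQ τ).card = (n - τ.card) * τ.card := by
  rw [QQ, card_image_of_injOn (QQ_inj τ), card_product, TT_card]

lemma QQ_dim {d : ℕ} {τ : Finset (Fin n)} (hτ : τ.card = d) : ∀ q ∈ QQ τ, q.card = d := by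
  intro q hq
  obtain ⟨⟨σ, v⟩, h, rfl⟩ := mem_image.1 hq
  rw [mem_product] at h
  obtain ⟨u, hu, hσ⟩ := mem_TT.1 h.1
  simp only at hσ
  simp only [hσ]
  rw [card_erase_of_mem (mem_insert_of_mem h.2), card_insert_of_notMem hu, hτ]; rfl

lemma bd_TT_ne {d : ℕ} {τ σ : Finset (Fin n)} (hτ : τ.card = d) (hσ : σ ∈ allFaces n d)
    (h : σ ∉ TT τ) : bd n σ τ = 0 := by
  apply bd_eq_zero
  intro hc
  obtain ⟨v, hv, rfl⟩ := exists_erase hc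
  exact h (mem_TT.2 ⟨v, notMem_erase v σ, (insert_erase hv).symm⟩)

lemma bd_TT_sq {τ σ : Finset (Fin n)} (h : σ ∈ TT τ) : bd n σ τ ^ 2 = 1 := by
  obtain ⟨u, hu, rfl⟩ := mem_TT.1 h
  have := bd_erase_sq (mem_insert_self u τ)
  rwa [erase_insert hu] at this

lemma bd_expand (σ : Finset (Fin n)) :
    bd n σ = ∑ v ∈ σ, bd n σ (σ.erase v) • Pi.single (σ.erase v) 1 := by
  ext τ
  have := bd_sum σ (fun τ' => bd n σ τ' * (Pi.single τ' 1 : Finset (Fin n) → ℝ) τ)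
    (fun τ' h => by simp [h])
  rw [Finset.sum_apply]
  simp only [Pi.smul_apply, smul_eq_mul]
  rw [← this]
  simp [Pi.single_apply]

/-- the part of the boundary of `σ` away from `τ`. -/
def ww (τ σ : Finset (Fin n)) : Finset (Fin n) → ℝ := bd n σ - (bd n σ τ) • Pi.single τ 1

lemma ww_expand {τ σ : Finset (Fin n)} (h : σ ∈ TT τ) :
    ww τ σ = ∑ v ∈ τ, bd n σ (σ.erase v) • Pi.single (σ.erase v) 1 := by
  obtain ⟨u, hu, rfl⟩ := mem_TT.1 h
  rw [ww]
  conv_lhs => lhs; rw [bd_expand]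
  rw [sum_insert hu, erase_insert hu]; abel

open Matrix in
lemma ww_quad {τ σ ρ : Finset (Fin n)} (h : σ ∈ TT τ) (h' : ρ ∈ TT τ)
    (R : Matrix (Finset (Fin n)) (Finset (Fin n)) ℝ) :
    ww τ σ ⬝ᵥ (R *ᵥ ww τ ρ) = ∑ v ∈ τ, ∑ v' ∈ τ,
      bd n σ (σ.erase v) * bd n ρ (ρ.erase v') * R (σ.erase v) (ρ.erase v') := by
  rw [ww_expand h, ww_expand h', sum_dotProduct]
  refine sum_congr rfl fun v _ => ?_
  rw [smul_dotProduct, single_one_dotProduct]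
  have := map_sum (Matrix.mulVecLin R) (fun v' => bd n ρ (ρ.erase v') • (Pi.single (ρ.erase v') 1 : Finset (Fin n) → ℝ)) τ
  simp only [mulVecLin_apply, mulVec_smul] at this
  rw [this, Finset.sum_apply, smul_eq_mul, mul_sum]
  refine sum_congr rfl fun v' _ => ?_
  simp; ring

lemma bd_abs {τ σ : Finset (Fin n)} (h : σ ∈ TT τ) {v : Fin n} (hv : v ∈ τ) :
    |bd n σ (σ.erase v)| = 1 := by
  obtain ⟨u, hu, rfl⟩ := mem_TT.1 h
  have := bd_erase_sq (mem_insert_of_mem (a := v) (b := u) hv)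
  rw [← sq_abs] at this
  nlinarith [abs_nonneg (bd n (insert u τ) ((insert u τ).erase v))]

open Matrix in
lemma W_off {τ σ ρ : Finset (Fin n)} (h : σ ∈ TT τ) (h' : ρ ∈ TT τ)
    (R : Matrix (Finset (Fin n)) (Finset (Fin n)) ℝ) :
    |ww τ σ ⬝ᵥ (R *ᵥ ww τ ρ)| ≤ ∑ v ∈ τ, ∑ v' ∈ τ, |R (σ.erase v) (ρ.erase v')| := by
  rw [ww_quad h h']
  refine (abs_sum_le_sum_abs _ _).trans (sum_le_sum fun v hv => ?_)
  refine (abs_sum_le_sum_abs _ _).trans (sum_le_sum fun v' hv' => ?_)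
  rw [abs_mul, abs_mul, bd_abs h hv, bd_abs h' hv', one_mul, one_mul]

open Matrix in
lemma W_diag {τ σ : Finset (Fin n)} (h : σ ∈ TT τ)
    (R : Matrix (Finset (Fin n)) (Finset (Fin n)) ℝ) :
    |ww τ σ ⬝ᵥ (R *ᵥ ww τ σ) - ∑ v ∈ τ, R (σ.erase v) (σ.erase v)| ≤
      ∑ v ∈ τ, ∑ v' ∈ τ.erase v, |R (σ.erase v) (σ.erase v')| := by
  rw [ww_quad h h, ← sum_sub_distrib]
  refine (abs_sum_le_sum_abs _ _).trans (sum_le_sum fun v hv => ?_)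
  rw [← add_sum_erase _ _ hv]
  have e : bd n σ (σ.erase v) * bd n σ (σ.erase v) * R (σ.erase v) (σ.erase v) =
      R (σ.erase v) (σ.erase v) := by
    have := bd_abs h hv
    rw [← abs_mul_abs_self, this]; ring
  rw [e, add_sub_cancel_left]
  refine (abs_sum_le_sum_abs _ _).trans (sum_le_sum fun v' hv' => ?_)
  rw [abs_mul, abs_mul, bd_abs h hv, bd_abs h (mem_of_mem_erase hv'), one_mul, one_mul]

/-- deterministic bound for the off-diagonal terms. -/
lemma off_total {s : ℝ} (hs : 0 ≤ s) (F : Finset (Finset (Fin n))) (τ : Finset (Fin n)) :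
    ∑ q ∈ QQ τ, ∑ q' ∈ QQ τ, |RM s (bd n) F q q'| ≤ (QQ τ).card * Real.sqrt (QQ τ).card := by
  calc _ ≤ ∑ q ∈ QQ τ, Real.sqrt (QQ τ).card := by
        refine sum_le_sum fun q _ => ?_
        apply Real.le_sqrt_of_sq_le
        have h1 := sq_sum_le_card_mul_sum_sq (s := QQ τ) (f := fun q' => |RM s (bd n) F q q'|)
        refine h1.trans ?_
        have h2 : ∑ q' ∈ QQ τ, |RM s (bd n) F q q'| ^ 2 ≤ 1 := by
          simp only [sq_abs]
          calc _ ≤ ∑ τ, RM s (bd n) F q τ ^ 2 :=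
                sum_le_sum_of_subset_of_nonneg (subset_univ _) fun _ _ _ => sq_nonneg _
            _ ≤ _ := row_sq_le hs _ F q
            _ ≤ 1 := diag_le_one hs _ F q
        have h3 : (0 : ℝ) ≤ (QQ τ).card := by positivity
        nlinarith
    _ = _ := by simp

end Star

section Cav
variable {n : ℕ}

lemma bE_sdiff {α : Type*} [DecidableEq α] (S T : Finset α) (hT : T ⊆ S) (p : ℝ)
    (f : Finset α → ℝ) : bE S p (fun F => f (F \ T)) = bE (S \ T) p f := by
  have h : S = (S \ T) ∪ T := (sdiff_union_of_subset hT).symm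
  conv_lhs => rw [h]
  rw [bE_union sdiff_disjoint]
  refine bE_congr fun F hF => ?_
  rw [← bE_const T p (f F)]
  refine bE_congr fun G hG => ?_
  congr 1
  have hd : Disjoint F T := (sdiff_disjoint).mono_left hF
  rw [union_sdiff_distrib, sdiff_eq_empty_iff_subset.2 hG, union_empty, sdiff_eq_self_of_disjoint hd]

lemma bE_split {α : Type*} [DecidableEq α] (S T : Finset α) (hT : T ⊆ S) (p : ℝ)
    (X : Finset α → ℝ) :
    bE S p X = bE (S \ T) p (fun F => bE T p (fun G => X (F ∪ G))) := by
  rw [← bE_union sdiff_disjoint, sdiff_union_of_subset hT]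

/-- sum of the diagonal entries over the facets other than `τ`. -/
def DD (s : ℝ) (τ : Finset (Fin n)) (F : Finset (Finset (Fin n))) (σ : Finset (Fin n)) : ℝ :=
  ∑ v ∈ τ, RM s (bd n) F (σ.erase v) (σ.erase v)

lemma DD_nonneg {s : ℝ} (hs : 0 ≤ s) (τ : Finset (Fin n)) (F) (σ) : 0 ≤ DD s τ F σ :=
  sum_nonneg fun _ _ => diag_nonneg hs _ _ _

/-- the cavity prediction. -/
def xh (s : ℝ) (τ : Finset (Fin n)) (F G : Finset (Finset (Fin n))) : ℝ :=
  1 / (1 + ∑ σ ∈ G, 1 / (1 / s + DD s τ F σ))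

lemma disj_TT {d : ℕ} {τ : Finset (Fin n)} {F G : Finset (Finset (Fin n))}
    (hF : F ⊆ allFaces n d \ TT τ) (hG : G ⊆ TT τ) : Disjoint F G :=
  (sdiff_disjoint).mono hF hG

lemma cav1 {s p : ℝ} {d : ℕ} (hs : 1 ≤ s) (hp0 : 0 ≤ p) (hp1 : p ≤ 1) {τ : Finset (Fin n)}
    (hτ : τ.card = d) {F : Finset (Finset (Fin n))} (hF : F ⊆ allFaces n d \ TT τ) :
    bE (TT τ) p (fun G => |RM s (bd n) (F ∪ G) τ τ - xh s τ F G|) ≤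
      s * (p * (∑ σ ∈ TT τ, ∑ v ∈ τ, ∑ v' ∈ τ.erase v, |RM s (bd n) F (σ.erase v) (σ.erase v')|)
        + p ^ 2 * ((QQ τ).card * Real.sqrt (QQ τ).card)) := by
  have hs0 : 0 ≤ s := by linarith
  have h1 : ∀ G ⊆ TT τ, |RM s (bd n) (F ∪ G) τ τ - xh s τ F G| ≤
      s * ∑ σ ∈ G, ∑ ρ ∈ G, |ww τ σ ⬝ᵥ (Matrix.mulVec (RM s (bd n) F) (ww τ ρ)) -
        if σ = ρ then DD s τ F σ else 0| := fun G hG =>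
    cavity hs (bd n) F G (disj_TT hF hG) τ
      (fun σ hσ => bd_TT_ne hτ (Finset.mem_sdiff.1 (hF hσ)).1 (Finset.mem_sdiff.1 (hF hσ)).2)
      (fun σ hσ => bd_TT_sq (hG hσ)) (ww τ) (fun σ _ => rfl) (DD s τ F) (DD_nonneg hs0 τ F)
  refine (bE_mono hp0 hp1 h1).trans ?_
  rw [bE_mul, bE_sum_sum_mem]
  refine mul_le_mul_of_nonneg_left (add_le_add ?_ ?_) hs0
  · refine mul_le_mul_of_nonneg_left (sum_le_sum fun σ hσ => ?_) hp0
    rw [if_pos rfl]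
    exact W_diag hσ _
  · refine mul_le_mul_of_nonneg_left ?_ (sq_nonneg p)
    refine le_trans ?_ (off_total hs0 F τ)
    rw [← QQ_sum]
    simp_rw [← QQ_sum]
    refine sum_le_sum fun σ hσ => ?_
    calc _ ≤ ∑ ρ ∈ (TT τ).erase σ, ∑ v ∈ τ, ∑ v' ∈ τ, |RM s (bd n) F (σ.erase v) (ρ.erase v')| := by
          refine sum_le_sum fun ρ hρ => ?_
          rw [if_neg (mem_erase.1 hρ).1.symm, sub_zero]
          exact W_off hσ (mem_erase.1 hρ).2 _
      _ ≤ ∑ ρ ∈ (TT τ), ∑ v ∈ τ, ∑ v' ∈ τ, |RM s (bd n) F (σ.erase v) (ρ.erase v')| :=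
          sum_le_sum_of_subset_of_nonneg (erase_subset _ _) fun _ _ _ =>
            sum_nonneg fun _ _ => sum_nonneg fun _ _ => abs_nonneg _
      _ = _ := sum_comm

/-- increase of the diagonal when the star of `τ` is removed. -/
def dl (s : ℝ) (τ : Finset (Fin n)) (F : Finset (Finset (Fin n))) (q : Finset (Fin n)) : ℝ :=
  RM s (bd n) (F \ TT τ) q q - RM s (bd n) F q q

lemma dl_aux (s : ℝ) (τ : Finset (Fin n)) (F : Finset (Finset (Fin n))) (hs : 0 ≤ s) :
    (∀ q, 0 ≤ dl s τ F q) ∧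
    (∀ q q', |RM s (bd n) (F \ TT τ) q q'| ≤ |RM s (bd n) F q q'| + (dl s τ F q + dl s τ F q') / 2) ∧
    (∑ q ∈ QQ τ, dl s τ F q ≤ (F ∩ TT τ).card) := by
  have hF : F \ TT τ ∪ F ∩ TT τ = F := sdiff_union_inter F (TT τ)
  obtain ⟨h1, h2, h3⟩ := RM_diag_union hs (bd n) (F \ TT τ) (F ∩ TT τ)
  rw [hF] at h1 h2 h3
  have h0 : ∀ q, 0 ≤ dl s τ F q := fun q => sub_nonneg.2 (h1 q)
  refine ⟨h0, fun q q' => ?_, ?_⟩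
  · have a := h2 q q'
    have b := abs_sub_abs_le_abs_sub (RM s (bd n) (F \ TT τ) q q') (RM s (bd n) F q q')
    unfold dl; linarith
  · exact (sum_le_sum_of_subset_of_nonneg (subset_univ _) fun q _ _ => h0 q).trans h3

lemma E_inter {d : ℕ} (p : ℝ) {τ : Finset (Fin n)} (hτ : τ.card = d) (hd : d ≤ n) :
    bE (allFaces n d) p (fun F => ((F ∩ TT τ).card : ℝ)) = p * (n - d) := by
  have : ∀ F : Finset (Finset (Fin n)), ((F ∩ TT τ).card : ℝ) = ∑ σ ∈ F, if σ ∈ TT τ then 1 else 0 := by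
    intro F
    rw [sum_boole, ← filter_mem_eq_inter]
  simp_rw [this]
  rw [bE_sum_mem, sum_boole, filter_mem_eq_inter, inter_eq_right.2 (TT_subset hτ), TT_card, hτ,
    Nat.cast_sub hd]

lemma cav2 {s p : ℝ} {d : ℕ} (hs : 1 ≤ s) (hp0 : 0 ≤ p) (hp1 : p ≤ 1) {τ : Finset (Fin n)}
    (hτ : τ.card = d) (hn : d < n) :
    bE (allFaces n d) p (fun F => |RM s (bd n) F τ τ - xh s τ (F \ TT τ) (F ∩ TT τ)|) ≤
      s * (p * ((n - d) * d ^ 2 / Real.sqrt (n - d) + d * (p * (n - d)))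
        + p ^ 2 * (((n - d) * d) * Real.sqrt ((n - d) * d))) := by
  have hs0 : 0 ≤ s := by linarith
  have hN : ((n - d : ℕ) : ℝ) = n - d := Nat.cast_sub hn.le
  have hNpos : (0 : ℝ) < n - d := by rw [← hN]; exact_mod_cast Nat.sub_pos_of_lt hn
  rw [bE_split _ _ (TT_subset hτ)]
  have e1 : ∀ F ⊆ allFaces n d \ TT τ, bE (TT τ) p (fun G => |RM s (bd n) (F ∪ G) τ τ
      - xh s τ ((F ∪ G) \ TT τ) ((F ∪ G) ∩ TT τ)|) ≤
      s * (p * (∑ σ ∈ TT τ, ∑ v ∈ τ, ∑ v' ∈ τ.erase v, |RM s (bd n) F (σ.erase v) (σ.erase v')|)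
        + p ^ 2 * ((QQ τ).card * Real.sqrt (QQ τ).card)) := by
    intro F hF
    refine le_trans (le_of_eq (bE_congr fun G hG => ?_)) (cav1 hs hp0 hp1 hτ hF)
    have hd : Disjoint F (TT τ) := disj_TT hF (Subset.refl _)
    rw [union_sdiff_distrib, sdiff_eq_empty_iff_subset.2 hG, union_empty,
      sdiff_eq_self_of_disjoint hd, union_inter_distrib_right, disjoint_iff_inter_eq_empty.1 hd,
      empty_union, inter_eq_left.2 hG]
  refine (bE_mono hp0 hp1 e1).trans ?_
  rw [← bE_sdiff _ _ (TT_subset hτ), bE_mul, bE_add, bE_mul, bE_const]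
  refine mul_le_mul_of_nonneg_left (add_le_add (mul_le_mul_of_nonneg_left ?_ hp0) ?_) hs0
  swap
  · rw [QQ_card, hτ]; push_cast; rw [hN]
  have e2 : ∀ F ⊆ allFaces n d,
      ∑ σ ∈ TT τ, ∑ v ∈ τ, ∑ v' ∈ τ.erase v, |RM s (bd n) (F \ TT τ) (σ.erase v) (σ.erase v')| ≤
      (∑ σ ∈ TT τ, ∑ v ∈ τ, ∑ v' ∈ τ.erase v, |RM s (bd n) F (σ.erase v) (σ.erase v')|)
        + d * (F ∩ TT τ).card := by
    intro F _
    obtain ⟨h0, h1, h2⟩ := dl_aux s τ F hs0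
    have h3 : (d : ℝ) * ∑ q ∈ QQ τ, dl s τ F q ≤ d * (F ∩ TT τ).card :=
      mul_le_mul_of_nonneg_left h2 (Nat.cast_nonneg d)
    refine le_trans ?_ (add_le_add le_rfl h3)
    rw [← QQ_sum, mul_sum, ← sum_add_distrib]
    refine sum_le_sum fun σ _ => ?_
    calc _ ≤ ∑ v ∈ τ, ∑ v' ∈ τ.erase v, (|RM s (bd n) F (σ.erase v) (σ.erase v')| +
          (dl s τ F (σ.erase v) + dl s τ F (σ.erase v')) / 2) :=
          sum_le_sum fun v _ => sum_le_sum fun v' _ => h1 _ _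
      _ = (∑ v ∈ τ, ∑ v' ∈ τ.erase v, |RM s (bd n) F (σ.erase v) (σ.erase v')|) +
          ∑ v ∈ τ, ∑ v' ∈ τ.erase v, (dl s τ F (σ.erase v) + dl s τ F (σ.erase v')) / 2 := by
          simp_rw [sum_add_distrib]
      _ ≤ _ := by
          refine add_le_add le_rfl ?_
          calc _ ≤ ∑ v ∈ τ, ∑ v' ∈ τ, (dl s τ F (σ.erase v) + dl s τ F (σ.erase v')) / 2 :=
                sum_le_sum fun v _ => sum_le_sum_of_subset_of_nonneg (erase_subset _ _) fun v' _ _ => by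
                  have := h0 (σ.erase v); have := h0 (σ.erase v'); linarith
            _ = _ := by
              simp_rw [add_div, sum_add_distrib, sum_const, hτ, nsmul_eq_mul]
              rw [← mul_sum, ← sum_div]; ring
  refine (bE_mono hp0 hp1 e2).trans ?_
  rw [bE_add, bE_mul, E_inter p hτ hn.le]
  refine add_le_add ?_ le_rfl
  simp_rw [bE_sum]
  calc _ ≤ ∑ σ ∈ TT τ, ∑ v ∈ τ, ∑ v' ∈ τ.erase v, 1 / Real.sqrt (n - d) := by
        refine sum_le_sum fun σ hσ => sum_le_sum fun v hv => sum_le_sum fun v' hv' => ?_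
        obtain ⟨u, hu, rfl⟩ := mem_TT.1 hσ
        refine (bE_abs_le_sqrt hp0 hp1 _).trans ?_
        rw [← Real.sqrt_one, ← Real.sqrt_div zero_le_one]
        refine Real.sqrt_le_sqrt ?_
        refine (adj_bound hs0 hp0 hp1 hn (v := v) ?_ ?_ ?_ ?_).trans (le_of_eq (by simp))
        · rw [card_erase_of_mem (mem_insert_of_mem hv), card_insert_of_notMem hu, hτ]; rfl
        · exact mem_erase.2 ⟨(mem_erase.1 hv').1.symm, mem_insert_of_mem hv⟩
        · exact notMem_erase _ _
        · exact erase_subset_erase _ (erase_subset _ _)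
    _ ≤ ∑ σ ∈ TT τ, ∑ v ∈ τ, ∑ v' ∈ τ, 1 / Real.sqrt (n - d) :=
        sum_le_sum fun σ _ => sum_le_sum fun v _ =>
          sum_le_sum_of_subset_of_nonneg (erase_subset _ _) fun _ _ _ => by positivity
    _ = _ := by
        simp only [sum_const, nsmul_eq_mul, TT_card, hτ, hN]; ring

lemma cav3 {s p C : ℝ} {d : ℕ} (hs : 1 ≤ s) (hp0 : 0 ≤ p) (hp1 : p ≤ 1) {τ : Finset (Fin n)}
    (hτ : τ.card = d) (hn : d < n) (hC : p * (n - d) ≤ C) :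
    bE (allFaces n d) p (fun F => |RM s (bd n) F τ τ - xh s τ (F \ TT τ) (F ∩ TT τ)|) ≤
      s * ((C * d ^ 2 + d * C ^ 2 + C ^ 2 * d ^ 2) / Real.sqrt (n - d)) := by
  refine (cav2 hs hp0 hp1 hτ hn).trans (mul_le_mul_of_nonneg_left ?_ (by linarith))
  have hN1 : (1 : ℝ) ≤ n - d := by
    have : (d : ℝ) + 1 ≤ n := by exact_mod_cast hn
    linarith
  set N : ℝ := n - d
  set r := Real.sqrt N with hr
  have hr1 : 1 ≤ r := Real.one_le_sqrt.2 hN1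
  have hrr : N = r * r := (Real.mul_self_sqrt (by linarith)).symm
  have hC0 : 0 ≤ C := le_trans (by positivity) hC
  have hpN : 0 ≤ p * N := by positivity
  have hdd : Real.sqrt d ≤ d := by
    rcases Nat.eq_zero_or_pos d with h | h
    · simp [h]
    · rw [Real.sqrt_le_left (by positivity)]
      have : (1 : ℝ) ≤ d := by exact_mod_cast h
      nlinarith
  have h1 : p * (N * d ^ 2 / r) ≤ C * d ^ 2 / r := by
    rw [← mul_div_assoc, ← mul_assoc]; gcongr
  have h2 : p * (d * (p * N)) ≤ d * C ^ 2 / r := by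
    rw [le_div_iff₀ (by linarith)]
    have : p * r ≤ p * N := by rw [hrr]; nlinarith [mul_nonneg hp0 (by linarith : (0:ℝ) ≤ r)]
    calc p * (d * (p * N)) * r = d * ((p * r) * (p * N)) := by ring
      _ ≤ d * (C * C) := by gcongr; exact this.trans hC
      _ = _ := by ring
  have h3 : p ^ 2 * (N * d * Real.sqrt (N * d)) ≤ C ^ 2 * d ^ 2 / r := by
    rw [le_div_iff₀ (by linarith), Real.sqrt_mul (by linarith), ← hr]
    calc p ^ 2 * (N * d * (r * Real.sqrt d)) * r = (p * N) ^ 2 * (d * Real.sqrt d) := by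
          rw [hrr]; ring
      _ ≤ C ^ 2 * (d * d) := by gcongr
      _ = _ := by ring
  rw [mul_add, add_div, add_div]
  linarith

end Cav

section Cav2
variable {n : ℕ}

/-- the exponent functional. -/
def AA (θ s : ℝ) (τ : Finset (Fin n)) (F : Finset (Finset (Fin n))) : ℝ :=
  ∑ σ ∈ TT τ, (1 - eg θ (1 / s + DD s τ F σ))

lemma AA_nonneg (θ s : ℝ) (τ : Finset (Fin n)) (F) : 0 ≤ AA θ s τ F :=
  sum_nonneg fun _ _ => sub_nonneg.2 (eg_le_one _ _)

lemma eg_xh {θ s : ℝ} (hs : 1 ≤ s) (hθ : 0 < θ) (τ : Finset (Fin n)) (F G) :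
    eg θ (xh s τ F G) = Real.exp (-θ) * ∏ σ ∈ G, eg θ (1 / s + DD s τ F σ) := by
  have hs0 : 0 < 1 / s := by positivity
  have hp : ∀ σ, 0 < 1 / s + DD s τ F σ := fun σ => by
    have := DD_nonneg (by linarith : 0 ≤ s) τ F σ; linarith
  have hq : 0 < 1 + ∑ σ ∈ G, 1 / (1 / s + DD s τ F σ) := by
    have : 0 ≤ ∑ σ ∈ G, 1 / (1 / s + DD s τ F σ) := sum_nonneg fun σ _ => (one_div_pos.2 (hp σ)).le
    linarith
  rw [eg_of_pos hθ (by unfold xh; exact one_div_pos.2 hq)]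
  have : ∀ σ, eg θ (1 / s + DD s τ F σ) = Real.exp (-(θ / (1 / s + DD s τ F σ))) := fun σ =>
    eg_of_pos hθ (hp σ)
  simp_rw [this]
  rw [← Real.exp_sum, ← Real.exp_add]
  congr 1
  unfold xh
  rw [div_div_eq_mul_div, div_one, mul_add, mul_sum, sum_neg_distrib]
  simp_rw [mul_one_div]
  ring

lemma cav4 {θ s p : ℝ} (hs : 1 ≤ s) (hθ : 0 < θ) (hp0 : 0 ≤ p) (hp1 : p ≤ 1)
    (τ : Finset (Fin n)) (F) :
    |bE (TT τ) p (fun G => eg θ (xh s τ F G)) - Real.exp (-(θ + p * AA θ s τ F))| ≤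
      (TT τ).card * p ^ 2 := by
  simp_rw [eg_xh hs hθ]
  rw [bE_mul, bE_prod, neg_add, Real.exp_add, ← mul_sub, abs_mul, abs_of_pos (Real.exp_pos _)]
  have h := prod_exp (TT τ) hp0 hp1 (fun σ => 1 - eg θ (1 / s + DD s τ F σ))
    (fun _ _ => sub_nonneg.2 (eg_le_one _ _)) (fun σ _ => by
      have := eg_nonneg θ (1 / s + DD s τ F σ); linarith)
  refine le_trans ?_ h
  refine mul_le_of_le_one_left (abs_nonneg _) (Real.exp_le_one_iff.2 (by linarith))

lemma AA_diff {θ s : ℝ} (hθ : 0 < θ) (τ : Finset (Fin n)) (F F' : Finset (Finset (Fin n)))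
    (h : ∀ q, 0 ≤ RM s (bd n) F q q - RM s (bd n) F' q q) :
    |AA θ s τ F - AA θ s τ F'| ≤ 2 / θ * ∑ q ∈ QQ τ, (RM s (bd n) F q q - RM s (bd n) F' q q) := by
  unfold AA
  rw [← sum_sub_distrib, ← QQ_sum, mul_sum]
  refine (abs_sum_le_sum_abs _ _).trans (sum_le_sum fun σ _ => ?_)
  rw [abs_sub_comm]
  have e : 1 - eg θ (1 / s + DD s τ F' σ) - (1 - eg θ (1 / s + DD s τ F σ)) =
    eg θ (1 / s + DD s τ F σ) - eg θ (1 / s + DD s τ F' σ) := by ring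
  rw [e]
  refine (eg_lip hθ _ _).trans (le_of_eq ?_)
  congr 1
  rw [add_sub_add_left_eq_sub, DD, DD, ← sum_sub_distrib, abs_of_nonneg (sum_nonneg fun v _ => h _)]

lemma AA_sdiff {θ s : ℝ} (hs : 0 ≤ s) (hθ : 0 < θ) (τ : Finset (Fin n)) (F : Finset (Finset (Fin n))) :
    |AA θ s τ (F \ TT τ) - AA θ s τ F| ≤ 2 / θ * (F ∩ TT τ).card := by
  obtain ⟨h0, h1, h2⟩ := dl_aux s τ F hs
  exact (AA_diff hθ τ _ _ h0).trans (mul_le_mul_of_nonneg_left h2 (by positivity))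

lemma AA_conc {θ s p C : ℝ} {d : ℕ} (hs : 0 ≤ s) (hθ : 0 < θ) (hp0 : 0 ≤ p) (hp1 : p ≤ 1)
    (hC : p * n ≤ C) {τ : Finset (Fin n)} (hτ : τ.card = d) (hn : d ≤ n) :
    bE (allFaces n d) p (fun F => |AA θ s τ F - bE (allFaces n d) p (AA θ s τ)|) ≤
      2 / θ * Real.sqrt (C * ((n - d) * d)) := by
  refine (bE_abs_le_sqrt hp0 hp1 _).trans ?_
  have := var_bound hs hp0 hp1 hC (QQ_dim hτ) (A := AA θ s τ) (L := 2 / θ) (fun σ F => by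
    rw [abs_sub_comm]
    exact AA_diff hθ τ _ _ (fun q => Dx_nonneg hs σ F q))
  refine (Real.sqrt_le_sqrt this).trans (le_of_eq ?_)
  rw [Real.sqrt_mul (sq_nonneg _), Real.sqrt_sq (by positivity), QQ_card, hτ]
  push_cast; rw [Nat.cast_sub hn]

lemma E_AA {θ s p : ℝ} {d : ℕ} {τ : Finset (Fin n)} (hτ : τ.card = d) (hn : d ≤ n)
    {σ0 : Finset (Fin n)} (h0 : σ0 ∈ TT τ) :
    bE (allFaces n d) p (AA θ s τ) =
      (n - d) * (1 - bE (allFaces n d) p (fun F => eg θ (1 / s + DD s τ F σ0))) := by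
  have h : ∀ σ ∈ TT τ, bE (allFaces n d) p (fun F => eg θ (1 / s + DD s τ F σ)) =
      bE (allFaces n d) p (fun F => eg θ (1 / s + DD s τ F σ0)) := by
    intro σ hσ
    obtain ⟨u, hu, rfl⟩ := mem_TT.1 hσ
    obtain ⟨u0, hu0, rfl⟩ := mem_TT.1 h0
    have hfix : pm (Equiv.swap u u0) τ = τ := pm_swap_fix (by simp [hu, hu0])
    rw [← bE_pm d p (Equiv.swap u u0)]
    refine bE_congr fun F _ => ?_
    congr 2
    unfold DD
    refine sum_congr rfl fun v hv => ?_
    have e1 : (insert u τ).erase v = pm (Equiv.swap u u0) ((insert u0 τ).erase v) := by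
      rw [pm_erase, pm_insert, hfix, Equiv.swap_apply_right, Equiv.swap_apply_of_ne_of_ne]
      · rintro rfl; exact hu hv
      · rintro rfl; exact hu0 hv
    rw [e1, RM_pm_diag]
  unfold AA
  rw [bE_sum]
  simp_rw [bE_sub, bE_const]
  rw [sum_congr rfl fun σ hσ => by rw [h σ hσ], sum_const, TT_card, hτ, nsmul_eq_mul, Nat.cast_sub hn]

set_option maxHeartbeats 1000000 in
/-- The approximate distributional fixed point equation. -/
lemma main_approx {θ s p C : ℝ} {d : ℕ} (hs : 1 ≤ s) (hθ : 0 < θ) (hp0 : 0 ≤ p) (hp1 : p ≤ 1)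
    (hC : p * n ≤ C) {τ : Finset (Fin n)} (hτ : τ.card = d) (hn : d < n)
    {σ0 : Finset (Fin n)} (h0 : σ0 ∈ TT τ) :
    |bE (allFaces n d) p (fun F => eg θ (RM s (bd n) F τ τ)) -
      Real.exp (-(θ + p * (n - d) * (1 - bE (allFaces n d) p (fun F => eg θ (1 / s + DD s τ F σ0)))))|
    ≤ s * ((2 / θ * (C * d ^ 2 + d * C ^ 2 + C ^ 2 * d ^ 2) + (1 + 2 / θ) * C ^ 2 +
        2 / θ * C * Real.sqrt (C * d)) / Real.sqrt (n - d)) := by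
  have hs0 : 0 ≤ s := by linarith
  have hd0 : (0 : ℝ) ≤ d := Nat.cast_nonneg d
  have hC' : p * (n - d) ≤ C := by nlinarith
  have hN1 : (1 : ℝ) ≤ n - d := by
    have : (d : ℝ) + 1 ≤ n := by exact_mod_cast hn
    linarith
  have hNc : ((n - d : ℕ) : ℝ) = n - d := Nat.cast_sub hn.le
  set S := allFaces n d with hS
  have hTS : TT τ ⊆ S := TT_subset hτ
  set M := bE S p (AA θ s τ) with hM
  have hMeq := E_AA (θ := θ) (s := s) (p := p) hτ hn.le h0
  rw [← hS, ← hM] at hMeq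
  have hM0 : 0 ≤ M := bE_nonneg hp0 hp1 fun F _ => AA_nonneg _ _ _ _
  rw [mul_assoc, ← hMeq]
  -- step 1
  have s1 : |bE S p (fun F => eg θ (RM s (bd n) F τ τ)) -
      bE S p (fun F => eg θ (xh s τ (F \ TT τ) (F ∩ TT τ)))| ≤
      2 / θ * (s * ((C * d ^ 2 + d * C ^ 2 + C ^ 2 * d ^ 2) / Real.sqrt (n - d))) := by
    rw [← bE_sub]
    refine (bE_abs hp0 hp1 _).trans ?_
    refine (bE_mono hp0 hp1 fun F _ => eg_lip hθ _ _).trans ?_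
    rw [bE_mul]
    exact mul_le_mul_of_nonneg_left (cav3 hs hp0 hp1 hτ hn hC') (by positivity)
  -- step 2
  have s2 : |bE S p (fun F => eg θ (xh s τ (F \ TT τ) (F ∩ TT τ))) -
      bE S p (fun F => Real.exp (-(θ + p * AA θ s τ (F \ TT τ))))| ≤ (n - d) * p ^ 2 := by
    rw [bE_sdiff S (TT τ) hTS p (fun F => Real.exp (-(θ + p * AA θ s τ F))), bE_split S (TT τ) hTS,
      ← bE_sub]
    refine (bE_abs hp0 hp1 _).trans ?_
    rw [← bE_const (S \ TT τ) p (((n : ℝ) - d) * p ^ 2)]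
    refine bE_mono hp0 hp1 fun F hF => ?_
    have := cav4 hs hθ hp0 hp1 τ F
    rw [TT_card, hτ, hNc] at this
    refine le_trans (le_of_eq ?_) this
    congr 2
    refine bE_congr fun G hG => ?_
    have hd : Disjoint F (TT τ) := disj_TT hF (Subset.refl _)
    rw [union_sdiff_distrib, sdiff_eq_empty_iff_subset.2 hG, union_empty,
      sdiff_eq_self_of_disjoint hd, union_inter_distrib_right, disjoint_iff_inter_eq_empty.1 hd,
      empty_union, inter_eq_left.2 hG]
  -- step 3
  have s3 : |bE S p (fun F => Real.exp (-(θ + p * AA θ s τ (F \ TT τ)))) - Real.exp (-(θ + p * M))| ≤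
      p * (2 / θ * (p * (n - d)) + 2 / θ * Real.sqrt (C * ((n - d) * d))) := by
    rw [← bE_const S p (Real.exp (-(θ + p * M))), ← bE_sub]
    refine (bE_abs hp0 hp1 _).trans ?_
    refine (bE_mono (Y := fun F => p * (2 / θ * (F ∩ TT τ).card + |AA θ s τ F - M|))
      hp0 hp1 fun F _ => ?_).trans ?_
    · have hA := AA_nonneg θ s τ (F \ TT τ)
      refine (exp_neg_lip (by positivity) (by positivity)).trans ?_
      rw [add_sub_add_left_eq_sub, ← mul_sub, abs_mul, abs_of_nonneg hp0]
      refine mul_le_mul_of_nonneg_left ?_ hp0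
      have a := AA_sdiff hs0 hθ τ F
      have b := abs_sub_le (AA θ s τ (F \ TT τ)) (AA θ s τ F) M
      linarith
    · rw [bE_mul, bE_add, bE_mul, E_inter p hτ hn.le]
      exact mul_le_mul_of_nonneg_left (add_le_add le_rfl (AA_conc hs0 hθ hp0 hp1 hC hτ hn.le)) hp0
  -- combine
  have tri := abs_sub_le (bE S p (fun F => eg θ (RM s (bd n) F τ τ)))
    (bE S p (fun F => eg θ (xh s τ (F \ TT τ) (F ∩ TT τ)))) (Real.exp (-(θ + p * M)))
  have tri2 := abs_sub_le (bE S p (fun F => eg θ (xh s τ (F \ TT τ) (F ∩ TT τ))))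
    (bE S p (fun F => Real.exp (-(θ + p * AA θ s τ (F \ TT τ))))) (Real.exp (-(θ + p * M)))
  set N : ℝ := n - d
  set r := Real.sqrt N with hr
  have hr1 : 1 ≤ r := Real.one_le_sqrt.2 hN1
  have hrr : N = r * r := (Real.mul_self_sqrt (by linarith)).symm
  have hC0 : 0 ≤ C := le_trans (by positivity) hC'
  have h4 : N * p ^ 2 ≤ C ^ 2 / r := by
    rw [le_div_iff₀ (by linarith)]
    have : p * r ≤ p * N := by rw [hrr]; nlinarith [mul_nonneg hp0 (by linarith : (0:ℝ) ≤ r)]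
    calc N * p ^ 2 * r = (p * r) * (p * N) := by ring
      _ ≤ C * C := by gcongr; exact this.trans hC'
      _ = _ := by ring
  have h5 : p * Real.sqrt (C * (N * d)) ≤ C * Real.sqrt (C * d) / r := by
    rw [le_div_iff₀ (by linarith)]
    have : Real.sqrt (C * (N * d)) = r * Real.sqrt (C * d) := by
      rw [hr, ← Real.sqrt_mul (by linarith)]; ring_nf
    rw [this]
    calc p * (r * Real.sqrt (C * d)) * r = (p * N) * Real.sqrt (C * d) := by rw [hrr]; ring
      _ ≤ _ := by gcongr
  have h6 : p * (2 / θ * (p * N) + 2 / θ * Real.sqrt (C * (N * d))) ≤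
      2 / θ * (C ^ 2 / r) + 2 / θ * (C * Real.sqrt (C * d) / r) := by
    calc _ = 2 / θ * (N * p ^ 2) + 2 / θ * (p * Real.sqrt (C * (N * d))) := by ring
      _ ≤ _ := by gcongr
  have h7 : C ^ 2 / r + (2 / θ * (C ^ 2 / r) + 2 / θ * (C * Real.sqrt (C * d) / r)) ≤
      s * (C ^ 2 / r + (2 / θ * (C ^ 2 / r) + 2 / θ * (C * Real.sqrt (C * d) / r))) :=
    le_mul_of_one_le_left (by positivity) hs
  refine (show _ ≤ 2 / θ * (s * ((C * d ^ 2 + d * C ^ 2 + C ^ 2 * d ^ 2) / r)) +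
    s * (C ^ 2 / r + (2 / θ * (C ^ 2 / r) + 2 / θ * (C * Real.sqrt (C * d) / r))) by
      linarith only [tri, tri2, s1, s2, s3, h4, h6, h7]).trans
    (le_of_eq (by ring))

end Cav2

section Lim
open MeasureTheory Topology

lemma law_exists {α : Type*} [DecidableEq α] {S : Finset α} {p : ℝ} (hp0 : 0 ≤ p) (hp1 : p ≤ 1)
    (X : Finset α → ℝ) (h : ∀ F, X F ∈ Set.Icc (0 : ℝ) 1) :
    ∃ ν : ProbabilityMeasure unitInterval, ∀ g : ℝ → ℝ,
      ∫ x, g (x : ℝ) ∂(ν : Measure unitInterval) = bE S p (fun F => g (X F)) := by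
  set w : Finset α → ℝ := fun F => p ^ F.card * (1 - p) ^ (S.card - F.card) with hw
  have hw0 : ∀ F, 0 ≤ w F := fun F =>
    mul_nonneg (pow_nonneg hp0 _) (pow_nonneg (by linarith) _)
  set m : Measure unitInterval :=
    ∑ F ∈ S.powerset, ENNReal.ofReal (w F) • Measure.dirac (⟨X F, h F⟩ : unitInterval) with hm
  have hi : ∀ g : unitInterval → ℝ, ∀ F ∈ S.powerset,
      Integrable g (ENNReal.ofReal (w F) • Measure.dirac (⟨X F, h F⟩ : unitInterval)) := by
    intro g F _
    refine Integrable.smul_measure ?_ ENNReal.ofReal_ne_top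
    exact integrable_dirac (by simp)
  have hIntg : ∀ g : unitInterval → ℝ, ∫ x, g x ∂m = ∑ F ∈ S.powerset, w F * g ⟨X F, h F⟩ := by
    intro g
    rw [hm, integral_finsetSum_measure (hi g)]
    refine sum_congr rfl fun F _ => ?_
    rw [integral_smul_measure, integral_dirac, ENNReal.toReal_ofReal (hw0 F), smul_eq_mul]
  have hprob : IsProbabilityMeasure m := by
    constructor
    rw [hm, Measure.finsetSum_apply]
    simp only [Measure.smul_apply, measure_univ, smul_eq_mul, mul_one]
    rw [← ENNReal.ofReal_sum_of_nonneg fun F _ => hw0 F]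
    have := bE_const S p 1
    unfold bE at this
    simp only [mul_one] at this
    rw [hw]; simp only; rw [this]; simp
  refine ⟨⟨m, hprob⟩, fun g => ?_⟩
  exact hIntg (fun x => g (x : ℝ))

lemma limit_law (U : Ultrafilter ℕ) (E : ℕ → (ℝ → ℝ) → ℝ)
    (h : ∀ᶠ n in (U : Filter ℕ), ∃ ν : ProbabilityMeasure unitInterval, ∀ g : ℝ → ℝ,
      ∫ x, g (x : ℝ) ∂(ν : Measure unitInterval) = E n g) :
    ∃ μ : Measure ℝ, IsProbabilityMeasure μ ∧ (∀ᵐ x ∂μ, x ∈ Set.Icc (0 : ℝ) 1) ∧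
      ∀ g : ℝ → ℝ, Continuous g → Tendsto (fun n => E n g) U (𝓝 (∫ x, g x ∂μ)) := by
  obtain ⟨ν0, -⟩ := h.exists.choose_spec
  have h' : ∀ n, ∃ ν : ProbabilityMeasure unitInterval,
      (∃ ν : ProbabilityMeasure unitInterval, ∀ g : ℝ → ℝ,
        ∫ x, g (x : ℝ) ∂(ν : Measure unitInterval) = E n g) →
      ∀ g : ℝ → ℝ, ∫ x, g (x : ℝ) ∂(ν : Measure unitInterval) = E n g := by
    intro n
    by_cases hn : ∃ ν : ProbabilityMeasure unitInterval, ∀ g : ℝ → ℝ,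
        ∫ x, g (x : ℝ) ∂(ν : Measure unitInterval) = E n g
    · obtain ⟨ν, hν⟩ := hn
      exact ⟨ν, fun _ => hν⟩
    · exact ⟨h.exists.choose_spec.choose, fun hh => absurd hh hn⟩
  choose ν hν using h'
  have hlim := (U.map ν).le_nhds_lim
  set L := (U.map ν).lim
  have hT : Tendsto ν U (𝓝 L) := hlim
  rw [ProbabilityMeasure.tendsto_iff_forall_integral_tendsto] at hT
  refine ⟨Measure.map Subtype.val (L : Measure unitInterval),
    Measure.isProbabilityMeasure_map measurable_subtype_coe.aemeasurable, ?_, ?_⟩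
  · exact (ae_map_iff (p := fun x => x ∈ Set.Icc (0 : ℝ) 1) measurable_subtype_coe.aemeasurable
      measurableSet_Icc).2 (Eventually.of_forall fun x => x.2)
  · intro g hg
    rw [integral_map measurable_subtype_coe.aemeasurable hg.aestronglyMeasurable]
    have := hT (BoundedContinuousFunction.mkOfCompact ⟨fun x : unitInterval => g x, by fun_prop⟩)
    simp only [BoundedContinuousFunction.mkOfCompact_apply, ContinuousMap.coe_mk] at this
    refine this.congr' ?_
    filter_upwards [h] with n hn
    exact hν n hn g

lemma pi_Icc {d : ℕ} {μ : Measure ℝ} [IsProbabilityMeasure μ] (h : ∀ᵐ x ∂μ, x ∈ Set.Icc (0 : ℝ) 1) :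
    ∀ᵐ y ∂(Measure.pi fun _ : Fin d => μ), ∀ j, y j ∈ Set.Icc (0 : ℝ) 1 :=
  eventually_all.2 fun i => (Measure.tendsto_eval_ae_ae (μ := fun _ : Fin d => μ) (i := i)).eventually h

lemma sum_Icc {d : ℕ} {y : Fin d → ℝ} (h : ∀ j, y j ∈ Set.Icc (0 : ℝ) 1) :
    ∑ j, y j ∈ Set.Icc (0 : ℝ) d := by
  refine ⟨sum_nonneg fun j _ => (h j).1, (sum_le_sum fun j _ => (h j).2).trans ?_⟩
  simp

lemma int_pi {d : ℕ} {μ : Measure ℝ} [IsProbabilityMeasure μ] (h : ∀ᵐ x ∂μ, x ∈ Set.Icc (0 : ℝ) 1)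
    {f : (Fin d → ℝ) → ℝ} (hf : Continuous f) : Integrable f (Measure.pi fun _ : Fin d => μ) := by
  obtain ⟨B, hB⟩ := (isCompact_univ_pi (fun _ : Fin d => isCompact_Icc (a := (0:ℝ)) (b := 1))).exists_bound_of_continuousOn
    hf.continuousOn
  refine Integrable.of_bound hf.aestronglyMeasurable B ?_
  filter_upwards [pi_Icc h] with y hy
  exact hB y fun j _ => hy j

lemma prod_limit {d : ℕ} {U : Filter ℕ} {μ : Measure ℝ} [IsProbabilityMeasure μ]
    (hμ : ∀ᵐ x ∂μ, x ∈ Set.Icc (0 : ℝ) 1)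
    {α : ℕ → Type} (S : ∀ n, Finset (α n)) (p : ℕ → ℝ) (hp : ∀ᶠ n in U, 0 ≤ p n ∧ p n ≤ 1)
    (X : ∀ n, Fin d → Finset (α n) → ℝ) (hX : ∀ n j F, X n j F ∈ Set.Icc (0 : ℝ) 1)
    (h : ∀ a : Fin d → ℕ, Tendsto (fun n => bE (S n) (p n) (fun F => ∏ j, X n j F ^ a j)) U
      (𝓝 (∏ j, ∫ x, x ^ a j ∂μ)))
    (g : ℝ → ℝ) (hg : Continuous g) :
    Tendsto (fun n => bE (S n) (p n) (fun F => g (∑ j, X n j F))) U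
      (𝓝 (∫ y, g (∑ j, y j) ∂(Measure.pi fun _ : Fin d => μ))) := by
  set P := Measure.pi fun _ : Fin d => μ with hP
  have hpow : ∀ k : ℕ, Tendsto (fun n => bE (S n) (p n) (fun F => (∑ j, X n j F) ^ k)) U
      (𝓝 (∫ y, (∑ j, y j) ^ k ∂P)) := by
    intro k
    simp_rw [Finset.sum_pow_eq_sum_piAntidiag]
    rw [integral_finsetSum]
    · simp_rw [bE_sum, bE_mul, integral_const_mul]
      refine tendsto_finsetSum _ fun a _ => Tendsto.const_mul _ ?_
      have e := integral_fintype_prod_eq_prod (𝕜 := ℝ) (fun (j : Fin d) (x : ℝ) => x ^ a j)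
        (μ := fun _ : Fin d => μ)
      rw [hP, e]
      exact h a
    · intro a _
      exact int_pi hμ (by fun_prop)
  have hpoly : ∀ q : Polynomial ℝ, Tendsto (fun n => bE (S n) (p n) (fun F => q.eval (∑ j, X n j F))) U
      (𝓝 (∫ y, q.eval (∑ j, y j) ∂P)) := by
    intro q
    simp_rw [Polynomial.eval_eq_sum_range]
    rw [integral_finsetSum]
    · simp_rw [bE_sum, bE_mul, integral_const_mul]
      exact tendsto_finsetSum _ fun k _ => Tendsto.const_mul _ (hpow k)
    · intro k _
      exact int_pi hμ (by fun_prop)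
  rw [Metric.tendsto_nhds]
  intro ε hε
  obtain ⟨q, hq⟩ := exists_polynomial_near_of_continuousOn 0 d g hg.continuousOn (ε / 4) (by linarith)
  have h1 := (Metric.tendsto_nhds.1 (hpoly q)) (ε / 4) (by linarith)
  have h2 : |∫ y, q.eval (∑ j, y j) ∂P - ∫ y, g (∑ j, y j) ∂P| ≤ ε / 4 := by
    rw [← integral_sub (int_pi hμ (by fun_prop)) (int_pi hμ (by fun_prop))]
    have := norm_integral_le_of_norm_le_const (μ := P) (f := fun y => q.eval (∑ j, y j) - g (∑ j, y j))
      (C := ε / 4) (by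
        filter_upwards [pi_Icc hμ] with y hy
        exact (hq _ (sum_Icc hy)).le)
    simpa using this
  filter_upwards [h1, hp] with n hn hpn
  have h3 : |bE (S n) (p n) (fun F => q.eval (∑ j, X n j F)) -
      bE (S n) (p n) (fun F => g (∑ j, X n j F))| ≤ ε / 4 := by
    rw [← bE_sub]
    refine (bE_abs hpn.1 hpn.2 _).trans ?_
    rw [← bE_const (S n) (p n) (ε / 4)]
    exact bE_mono hpn.1 hpn.2 fun F _ => (hq _ (sum_Icc fun j => hX n j F)).le
  rw [Real.dist_eq] at hn ⊢
  rw [abs_lt] at hn ⊢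
  rw [abs_le] at h2 h3
  constructor <;> linarith

end Lim

section Lim2
open MeasureTheory Topology

lemma RM_other {n : ℕ} {s : ℝ} (hs : 1 ≤ s) {F : Finset (Finset (Fin n))} {τ : Finset (Fin n)}
    (h : ∀ σ ∈ F, bd n σ τ = 0) : RM s (bd n) F τ τ = 1 := by
  have := cavity hs (bd n) F ∅ (disjoint_empty_right F) τ h (by simp) (ww τ) (by simp) 0 (by simp)
  simp only [union_empty, sum_empty, mul_zero, add_zero, div_one] at this
  linarith [abs_nonpos_iff.1 this]

lemma bE_sym {n d : ℕ} (p s : ℝ) (g : ℝ → ℝ) {τ τ' : Finset (Fin n)} (h : τ.card = τ'.card) :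
    bE (allFaces n d) p (fun F => g (RM s (bd n) F τ τ)) =
      bE (allFaces n d) p (fun F => g (RM s (bd n) F τ' τ')) := by
  obtain ⟨π, rfl⟩ := exists_pm h
  rw [← bE_pm d p π (fun F => g (RM s (bd n) F (pm π τ) (pm π τ)))]
  simp_rw [RM_pm_diag]

lemma E_def {n d : ℕ} {s : ℝ} (p : ℝ) (hs : 1 ≤ s) {τ : Finset (Fin n)} (hτ : τ.card = d) :
    bE (allFaces n d) p (fun F => ∑ τ', (1 - RM s (bd n) F τ' τ')) =
      n.choose d * (1 - bE (allFaces n d) p (fun F => RM s (bd n) F τ τ)) := by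
  rw [bE_sum, ← sum_filter_add_sum_filter_not univ (fun τ' : Finset (Fin n) => τ'.card = d)]
  have h1 : ∑ τ' ∈ univ.filter (fun τ' : Finset (Fin n) => ¬ τ'.card = d),
      bE (allFaces n d) p (fun F => 1 - RM s (bd n) F τ' τ') = 0 := by
    refine sum_eq_zero fun τ' hτ' => ?_
    rw [mem_filter] at hτ'
    rw [← bE_const (allFaces n d) p 0]
    refine bE_congr fun F hF => ?_
    rw [RM_other hs, sub_self]
    intro σ hσ
    refine bd_eq_zero fun hc => hτ'.2 ?_
    have := mem_allFaces.1 (hF hσ)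
    omega
  have h2 : ∀ τ' ∈ univ.filter (fun τ' : Finset (Fin n) => τ'.card = d),
      bE (allFaces n d) p (fun F => 1 - RM s (bd n) F τ' τ') =
      1 - bE (allFaces n d) p (fun F => RM s (bd n) F τ τ) := by
    intro τ' hτ'
    rw [mem_filter] at hτ'
    rw [bE_sym p s (fun x => 1 - x) (hτ'.2.trans hτ.symm), bE_sub, bE_const]
  rw [h1, add_zero, sum_congr rfl h2, sum_const, nsmul_eq_mul]
  congr 2
  have : univ.filter (fun τ' : Finset (Fin n) => τ'.card = d) = powersetCard d univ := by
    ext; simp [mem_powersetCard]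
  rw [this, card_powersetCard, card_univ, Fintype.card_fin]

/-- normalised expected kernel dimension. -/
def eK (n d : ℕ) (p : ℝ) : ℝ := bE (allFaces n d) p (fun F => (dimKer n F : ℝ)) / n.choose d

lemma choose_ratio {n d : ℕ} (hn : d < n) :
    ((n.choose (d + 1) : ℕ) : ℝ) = n.choose d * ((n - d) / (d + 1)) := by
  have := Nat.choose_succ_right_eq n d
  have h2 : ((n.choose (d + 1) : ℕ) : ℝ) * (d + 1) = n.choose d * (n - d) := by
    rw [← Nat.cast_sub hn.le]; exact_mod_cast this
  rw [← mul_div_assoc, eq_div_iff (by positivity), h2]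

lemma eK_bounds {n d : ℕ} {s p : ℝ} (hp0 : 0 ≤ p) (hp1 : p ≤ 1) (hs : 1 < s) (hn : d < n)
    {τ : Finset (Fin n)} (hτ : τ.card = d) :
    eK n d p ≤ p * (n - d) / (d + 1) - (1 - bE (allFaces n d) p (fun F => RM s (bd n) F τ τ)) ∧
    p * (n - d) / (d + 1) - (1 - bE (allFaces n d) p (fun F => RM s (bd n) F τ τ)) -
      p * (n - d) / Real.log s ≤ eK n d p := by
  have hb : (0 : ℝ) < n.choose d := by exact_mod_cast Nat.choose_pos hn.le
  have hF : ∀ F ⊆ allFaces n d, ∀ σ ∈ F, σ.card = d + 1 := fun F hF σ hσ => mem_allFaces.1 (hF hσ)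
  have h1 := bE_mono hp0 hp1 (S := allFaces n d) fun F h => (dimKer_bounds F (hF F h) hs).1
  have h2 := bE_mono hp0 hp1 (S := allFaces n d) fun F h => (dimKer_bounds F (hF F h) hs).2
  have hl : 0 < Real.log s := Real.log_pos hs
  have e3 : bE (allFaces n d) p (fun F => ((d : ℝ) + 1) * F.card / Real.log s) =
      (d + 1) / Real.log s * (p * (n.choose d * ((n - d) / (d + 1)))) := by
    rw [← choose_ratio hn, ← card_allFaces, ← bE_card, ← bE_mul]
    refine bE_congr fun F _ => by ring
  rw [bE_sub, bE_card, E_def p hs.le hτ, card_allFaces, choose_ratio hn] at h1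
  rw [bE_sub, bE_sub, bE_card, E_def p hs.le hτ, card_allFaces, choose_ratio hn, e3] at h2
  unfold eK
  constructor
  · rw [div_le_iff₀ hb]
    refine h1.trans (le_of_eq ?_)
    ring
  · rw [le_div_iff₀ hb]
    refine le_trans (le_of_eq ?_) h2
    have : (d : ℝ) + 1 ≠ 0 := by positivity
    field_simp

lemma data_exists (d n : ℕ) : ∃ (τ σ : Finset (Fin n)) (q : Fin d → Finset (Fin n)), d < n →
    (τ.card = d ∧ σ ∈ TT τ ∧ (∀ j, (q j).card = d) ∧ Function.Injective q ∧
      ∀ s F, DD s τ F σ = ∑ j, RM s (bd n) F (q j) (q j)) := by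
  by_cases hn : d < n
  swap
  · exact ⟨∅, ∅, fun _ => ∅, fun h => absurd h hn⟩
  obtain ⟨τ, -, hτ⟩ := Finset.exists_subset_card_eq (s := (univ : Finset (Fin n))) (n := d)
    (by simpa using hn.le)
  obtain ⟨u, hu⟩ : ∃ u, u ∉ τ := by
    by_contra h
    push Not at h
    have : τ = univ := eq_univ_iff_forall.2 h
    rw [this] at hτ
    simp at hτ; omega
  set e := τ.equivFinOfCardEq hτ
  have hmem : insert u τ ∈ TT τ := mem_TT.2 ⟨u, hu, rfl⟩
  refine ⟨τ, insert u τ, fun j => (insert u τ).erase (e.symm j : Fin n), fun _ => ⟨hτ, hmem,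
    fun j => ?_, fun i j hij => ?_, fun s F => ?_⟩⟩
  · rw [card_erase_of_mem (mem_insert_of_mem (e.symm j).2), card_insert_of_notMem hu, hτ]; rfl
  · have := QQ_inj τ (x₁ := (insert u τ, (e.symm i : Fin n))) (x₂ := (insert u τ, (e.symm j : Fin n)))
      (by simp [hmem]) (by simp [hmem]) hij
    simp only [Prod.mk.injEq, true_and] at this
    exact e.symm.injective (Subtype.ext this)
  · unfold DD
    rw [← Finset.sum_coe_sort τ]
    exact (Equiv.sum_comp e.symm _).symm

lemma limit_eq {d : ℕ} (U : Ultrafilter ℕ) (hU : (U : Filter ℕ) ≤ atTop) (c : ℕ → ℝ) {C c0 : ℝ}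
    (hc : ∀ n, 0 ≤ c n ∧ c n ≤ C) (hlim : Tendsto c U (𝓝 c0)) :
    ∃ μ : Measure ℝ, IsProbabilityMeasure μ ∧ (∀ᵐ x ∂μ, x ∈ Set.Icc (0 : ℝ) 1) ∧
      (∀ θ > 0, ∫ x, eg θ x ∂μ = Real.exp (-(θ + c0 * (1 -
        ∫ y, eg θ (∑ j, y j) ∂(Measure.pi fun _ : Fin d => μ))))) ∧
      Tendsto (fun n : ℕ => eK n d (c n / n)) U (𝓝 (c0 / (d + 1) - (1 - ∫ x, x ∂μ))) := by
  have hC0 : 0 ≤ C := (hc 0).1.trans (hc 0).2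
  choose τ σ q hq using data_exists d
  set p : ℕ → ℝ := fun n => c n / n with hp
  set s : ℕ → ℝ := fun n => Real.sqrt (Real.sqrt (n - d)) with hsdef
  have hNt : Tendsto (fun n : ℕ => (n : ℝ) - d) U atTop :=
    (tendsto_atTop_add_const_right _ (-(d : ℝ)) tendsto_natCast_atTop_atTop).mono_left hU
  have hrt : Tendsto (fun n : ℕ => Real.sqrt ((n : ℝ) - d)) U atTop :=
    Real.tendsto_sqrt_atTop.comp hNt
  have hst : Tendsto s U atTop := Real.tendsto_sqrt_atTop.comp hrt
  have hn1 : ∀ᶠ n in (U : Filter ℕ), 2 * d < n := hU (eventually_gt_atTop _)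
  have hp01 : ∀ᶠ n in (U : Filter ℕ), 0 ≤ p n ∧ p n ≤ 1 ∧ p n * n ≤ C := by
    filter_upwards [hn1, (tendsto_natCast_atTop_atTop (R := ℝ)).mono_left hU |>.eventually_ge_atTop C]
      with n h1 h2
    have hn : (0 : ℝ) < n := by exact_mod_cast (by omega : 0 < n)
    refine ⟨div_nonneg (hc n).1 hn.le, ?_, ?_⟩
    · simp only [hp]; rw [div_le_one hn]; exact (hc n).2.trans h2
    · simp only [hp]; rw [div_mul_cancel₀ _ hn.ne']; exact (hc n).2
  have hpN : Tendsto (fun n => p n * ((n : ℝ) - d)) U (𝓝 c0) := by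
    have h1 : Tendsto (fun n : ℕ => (d : ℝ) / n) U (𝓝 0) :=
      (tendsto_const_div_atTop_nhds_zero_nat (d : ℝ)).mono_left hU
    have h2 : Tendsto (fun n => c n * (1 - (d : ℝ) / n)) U (𝓝 (c0 * (1 - 0))) :=
      hlim.mul (tendsto_const_nhds.sub h1)
    rw [sub_zero, mul_one] at h2
    refine h2.congr' ?_
    filter_upwards [hn1] with n h1
    have hn : (n : ℝ) ≠ 0 := by exact_mod_cast (by omega : n ≠ 0)
    simp only [hp]; field_simp
  have hI : ∀ n (q : Finset (Fin n)) F, RM (s n) (bd n) F q q ∈ Set.Icc (0 : ℝ) 1 := fun n q F =>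
    ⟨diag_nonneg (Real.sqrt_nonneg _) _ _ _, diag_le_one (Real.sqrt_nonneg _) _ _ _⟩
  obtain ⟨μ, hμ, hμI, hμt⟩ := limit_law U (fun n g => bE (allFaces n d) (p n)
    (fun F => g (RM (s n) (bd n) F (τ n) (τ n)))) (by
      filter_upwards [hp01] with n hn
      exact law_exists hn.1 hn.2.1 _ (hI n (τ n)))
  refine ⟨μ, hμ, hμI, ?_, ?_⟩
  · intro θ hθ
    have hmono : ∀ a : Fin d → ℕ, Tendsto (fun n => bE (allFaces n d) (p n)
        (fun F => ∏ j, RM (s n) (bd n) F (q n j) (q n j) ^ a j)) U (𝓝 (∏ j, ∫ x, x ^ a j ∂μ)) := by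
      intro a
      have h1 : Tendsto (fun n => ∏ j : Fin d, bE (allFaces n d) (p n)
          (fun F => RM (s n) (bd n) F (τ n) (τ n) ^ a j)) U (𝓝 (∏ j, ∫ x, x ^ a j ∂μ)) :=
        tendsto_finsetProd _ fun j _ => hμt (fun x => x ^ a j) (by fun_prop)
      have h2 : Tendsto (fun n : ℕ => ∑ j : Fin d, ∑ i : Fin d,
          (a i : ℝ) * (a j * |Real.sqrt (C / (n - 2 * d))|)) U (𝓝 0) := by
        have h3 : Tendsto (fun n : ℕ => |Real.sqrt (C / ((n : ℝ) - 2 * d))|) U (𝓝 0) := by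
          have h4 : Tendsto (fun n : ℕ => C / ((n : ℝ) - 2 * d)) U (𝓝 0) :=
            Tendsto.const_div_atTop ((tendsto_atTop_add_const_right _ (-(2 * d : ℝ))
              tendsto_natCast_atTop_atTop).mono_left hU) C
          have := (h4.sqrt).abs
          simpa using this
        have : Tendsto (fun n : ℕ => ∑ j : Fin d, ∑ i : Fin d,
          (a i : ℝ) * (a j * |Real.sqrt (C / (n - 2 * d))|)) U
            (𝓝 (∑ j : Fin d, ∑ i : Fin d, (a i : ℝ) * (a j * 0))) :=
          tendsto_finsetSum _ fun j _ => tendsto_finsetSum _ fun i _ =>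
            (h3.const_mul _).const_mul _
        simpa using this
      have h5 : Tendsto (fun n => bE (allFaces n d) (p n)
        (fun F => ∏ j, RM (s n) (bd n) F (q n j) (q n j) ^ a j) - ∏ j : Fin d, bE (allFaces n d) (p n)
          (fun F => RM (s n) (bd n) F (τ n) (τ n) ^ a j)) U (𝓝 0) := by
        refine squeeze_zero_norm' ?_ h2
        filter_upwards [hn1, hp01] with n hn hpn
        obtain ⟨hτ, -, hqc, hqi, -⟩ := hq n (by omega)
        rw [Real.norm_eq_abs]
        have := decorr hpn.1 hpn.2.1 (fun (j : Fin d) F => RM (s n) (bd n) F (q n j) (q n j))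
          (fun j => RM_diag_antitone (Real.sqrt_nonneg _) _ _) (fun j F => (hI n _ F).1)
          (fun j F => (hI n _ F).2) a (δ := Real.sqrt (C / (n - 2 * d)))
          (fun i j hij => cov_bound (Real.sqrt_nonneg _) hpn.1 hpn.2.1 hpn.2.2 hn (hqc i) (hqc j)
            (fun h => hij (hqi h))) univ
        refine le_trans (le_of_eq ?_) this
        congr 2
        refine prod_congr rfl fun j _ => ?_
        exact bE_sym (p n) (s n) (fun x => x ^ a j) (hτ.trans (hqc j).symm)
      have := h5.add h1
      simpa using this
    have hsum := prod_limit hμI (fun n => allFaces n d) p (hp01.mono fun n h => ⟨h.1, h.2.1⟩)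
      (fun n j F => RM (s n) (bd n) F (q n j) (q n j)) (fun n j F => hI n _ F) hmono (eg θ)
      (eg_continuous θ)
    have hsinv : Tendsto (fun n => 1 / s n) U (𝓝 0) := Tendsto.const_div_atTop hst 1
    have hsum' : Tendsto (fun n => bE (allFaces n d) (p n) (fun F => eg θ (1 / s n +
        DD (s n) (τ n) F (σ n)))) U (𝓝 (∫ y, eg θ (∑ j, y j) ∂(Measure.pi fun _ : Fin d => μ))) := by
      have h5 : Tendsto (fun n => bE (allFaces n d) (p n) (fun F => eg θ (1 / s n +
        DD (s n) (τ n) F (σ n))) - bE (allFaces n d) (p n) (fun F => eg θ (∑ j,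
          RM (s n) (bd n) F (q n j) (q n j)))) U (𝓝 0) := by
        refine squeeze_zero_norm' (a := fun n => 2 / θ * (1 / s n)) ?_ (by
          simpa using hsinv.const_mul (2 / θ))
        filter_upwards [hn1, hp01] with n hn hpn
        obtain ⟨hτ, -, hqc, hqi, hDD⟩ := hq n (by omega)
        rw [Real.norm_eq_abs, ← bE_sub]
        refine (bE_abs hpn.1 hpn.2.1 _).trans ?_
        rw [← bE_const (allFaces n d) (p n) (2 / θ * (1 / s n))]
        refine bE_mono hpn.1 hpn.2.1 fun F _ => ?_
        refine (eg_lip hθ _ _).trans (le_of_eq ?_)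
        rw [hDD, add_sub_cancel_right, abs_of_nonneg (by positivity)]
      simpa using h5.add hsum
    have hL := hμt (eg θ) (eg_continuous θ)
    have hR : Tendsto (fun n => Real.exp (-(θ + p n * ((n : ℝ) - d) * (1 - bE (allFaces n d) (p n)
        (fun F => eg θ (1 / s n + DD (s n) (τ n) F (σ n))))))) U (𝓝 (Real.exp (-(θ + c0 * (1 -
        ∫ y, eg θ (∑ j, y j) ∂(Measure.pi fun _ : Fin d => μ)))))) :=
      (Real.continuous_exp.tendsto _).comp
        (tendsto_const_nhds.add (hpN.mul (tendsto_const_nhds.sub hsum'))).neg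
    set K := (2 / θ * (C * d ^ 2 + d * C ^ 2 + C ^ 2 * d ^ 2) + (1 + 2 / θ) * C ^ 2 +
        2 / θ * C * Real.sqrt (C * d)) with hK
    have hD : Tendsto (fun n => bE (allFaces n d) (p n) (fun F => eg θ (RM (s n) (bd n) F (τ n) (τ n)))
        - Real.exp (-(θ + p n * ((n : ℝ) - d) * (1 - bE (allFaces n d) (p n)
        (fun F => eg θ (1 / s n + DD (s n) (τ n) F (σ n))))))) U (𝓝 0) := by
      refine squeeze_zero_norm' (a := fun n => K * (1 / s n)) ?_ (by
          simpa using hsinv.const_mul K)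
      filter_upwards [hn1, hp01, hst.eventually_ge_atTop 1] with n hn hpn hs1
      obtain ⟨hτ, hσ, hqc, hqi, hDD⟩ := hq n (by omega)
      rw [Real.norm_eq_abs]
      refine (main_approx hs1 hθ hpn.1 hpn.2.1 hpn.2.2 hτ (by omega) hσ).trans (le_of_eq ?_)
      rw [← hK]
      have e : Real.sqrt ((n : ℝ) - d) = s n * s n := (Real.mul_self_sqrt (Real.sqrt_nonneg _)).symm
      rw [e]
      have : s n ≠ 0 := by positivity
      field_simp
    have := tendsto_nhds_unique hD (hL.sub hR)
    linarith
  · have hx := hμt (fun x => x) continuous_id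
    have hup : Tendsto (fun n : ℕ => p n * (n - d) / (d + 1) -
        (1 - bE (allFaces n d) (p n) (fun F => RM (s n) (bd n) F (τ n) (τ n)))) U
        (𝓝 (c0 / (d + 1) - (1 - ∫ x, x ∂μ))) :=
      (hpN.div_const _).sub (tendsto_const_nhds.sub hx)
    have hlo : Tendsto (fun n : ℕ => p n * (n - d) / (d + 1) -
        (1 - bE (allFaces n d) (p n) (fun F => RM (s n) (bd n) F (τ n) (τ n))) -
        p n * (n - d) / Real.log (s n)) U
        (𝓝 (c0 / (d + 1) - (1 - ∫ x, x ∂μ))) := by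
      have := hup.sub (hpN.div_atTop (Real.tendsto_log_atTop.comp hst))
      simpa using this
    refine tendsto_of_tendsto_of_tendsto_of_le_of_le' hlo hup ?_ ?_
    · filter_upwards [hn1, hp01, hst.eventually_gt_atTop 1] with n hn hpn hs1
      exact (eK_bounds hpn.1 hpn.2.1 hs1 (by omega) (hq n (by omega)).1).2
    · filter_upwards [hn1, hp01, hst.eventually_gt_atTop 1] with n hn hpn hs1
      exact (eK_bounds hpn.1 hpn.2.1 hs1 (by omega) (hq n (by omega)).1).1

end Lim2

section Ana
open MeasureTheory Topology

/-- `exp (-θ/z)` cut off at `z ≤ 0`; makes sense at `θ = 0`. -/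
def gg (θ z : ℝ) : ℝ := if 0 < z then Real.exp (-(θ / z)) else 0

lemma gg_eq_eg {θ z : ℝ} (hθ : 0 < θ) : gg θ z = eg θ z := by
  unfold gg
  split_ifs with h
  · rw [eg_of_pos hθ h]
  · rw [eg_of_nonpos hθ (not_lt.1 h)]

lemma gg_nonneg (θ z : ℝ) : 0 ≤ gg θ z := by
  unfold gg; split_ifs
  · exact (Real.exp_pos _).le
  · exact le_rfl

lemma gg_le_one {θ : ℝ} (hθ : 0 ≤ θ) (z : ℝ) : gg θ z ≤ 1 := by
  unfold gg; split_ifs with h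
  · exact Real.exp_le_one_iff.2 (neg_nonpos.2 (by positivity))
  · exact zero_le_one

lemma gg_zero (z : ℝ) : gg 0 z = if 0 < z then 1 else 0 := by
  unfold gg; simp

lemma gg_meas : Measurable (fun q : ℝ × ℝ => gg q.1 q.2) := by
  unfold gg
  refine Measurable.ite (measurableSet_lt measurable_const measurable_snd) ?_ measurable_const
  exact Real.measurable_exp.comp (measurable_fst.div measurable_snd).neg

lemma gg_meas2 (θ : ℝ) : Measurable (gg θ) :=
  gg_meas.comp (measurable_const.prodMk measurable_id)

lemma gg_cont (z : ℝ) : Continuous (fun θ => gg θ z) := by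
  unfold gg; split_ifs
  · fun_prop
  · exact continuous_const

lemma rr_bound {θ : ℝ} (hθ : 0 < θ) (z : ℝ) : |1 / z * gg θ z| ≤ 1 / θ := by
  unfold gg
  split_ifs with h
  · rw [abs_of_pos (by positivity)]
    have h1 : θ / z ≤ Real.exp (θ / z) := by linarith [Real.add_one_le_exp (θ / z)]
    rw [Real.exp_neg, ← div_eq_mul_inv, div_le_iff₀ (Real.exp_pos _)]
    calc 1 / z = 1 / θ * (θ / z) := by field_simp
      _ ≤ _ := by gcongr
  · simp; positivity

lemma gg_deriv (z θ : ℝ) : HasDerivAt (fun θ => gg θ z) (-(1 / z * gg θ z)) θ := by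
  unfold gg
  split_ifs with h
  · have h1 : HasDerivAt (fun θ : ℝ => -(θ / z)) (-(1 / z)) θ := ((hasDerivAt_id θ).div_const z).neg
    convert h1.exp using 1; ring
  · simpa using hasDerivAt_const θ (0 : ℝ)

variable {Ω : Type*} [MeasurableSpace Ω] {ν : Measure Ω} [IsProbabilityMeasure ν]

lemma gg_int {Z : Ω → ℝ} (hZ : Measurable Z) {θ : ℝ} (hθ : 0 ≤ θ) :
    Integrable (fun ω => gg θ (Z ω)) ν := by
  refine Integrable.of_bound ((gg_meas2 θ).comp hZ).aestronglyMeasurable 1 ?_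
  refine Eventually.of_forall fun ω => ?_
  rw [Real.norm_eq_abs, abs_of_nonneg (gg_nonneg _ _)]; exact gg_le_one hθ _

lemma G_cont {Z : Ω → ℝ} (hZ : Measurable Z) :
    ContinuousWithinAt (fun θ => ∫ ω, gg θ (Z ω) ∂ν) (Set.Ici 0) 0 := by
  refine continuousWithinAt_of_dominated (bound := fun _ => 1) ?_ ?_ (integrable_const _) ?_
  · exact Eventually.of_forall fun θ => ((gg_meas2 θ).comp hZ).aestronglyMeasurable
  · filter_upwards [self_mem_nhdsWithin] with θ hθ
    refine Eventually.of_forall fun ω => ?_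
    rw [Real.norm_eq_abs, abs_of_nonneg (gg_nonneg _ _)]; exact gg_le_one hθ _
  · exact Eventually.of_forall fun ω => (gg_cont _).continuousWithinAt

lemma G_deriv {Z : Ω → ℝ} (hZ : Measurable Z) {θ : ℝ} (hθ : 0 < θ) :
    HasDerivAt (fun θ => ∫ ω, gg θ (Z ω) ∂ν) (-∫ ω, 1 / Z ω * gg θ (Z ω) ∂ν) θ := by
  have hmeas : ∀ θ, Measurable (fun ω => 1 / Z ω * gg θ (Z ω)) := fun θ =>
    (measurable_const.div hZ).mul ((gg_meas2 θ).comp hZ)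
  rw [← integral_neg]
  refine (hasDerivAt_integral_of_dominated_loc_of_deriv_le (bound := fun _ => 2 / θ)
    (F := fun θ ω => gg θ (Z ω)) (F' := fun θ ω => -(1 / Z ω * gg θ (Z ω)))
    (s := Set.Ioi (θ / 2)) (Ioi_mem_nhds (by linarith)) ?_ (gg_int hZ hθ.le) ?_ ?_
    (integrable_const _) ?_).2
  · exact Eventually.of_forall fun θ => ((gg_meas2 θ).comp hZ).aestronglyMeasurable
  · exact (hmeas θ).neg.aestronglyMeasurable
  · refine Eventually.of_forall fun ω t ht => ?_
    have ht : θ / 2 < t := ht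
    rw [norm_neg, Real.norm_eq_abs]
    refine (rr_bound (by linarith) _).trans ?_
    rw [div_le_div_iff₀ (by linarith) hθ]; linarith
  · exact Eventually.of_forall fun ω t _ => gg_deriv _ _

lemma fub {k : ℝ → Ω → ℝ} (hk : Measurable (fun q : ℝ × Ω => k q.1 q.2)) (hk0 : ∀ θ ω, 0 ≤ k θ ω)
    {K : Ω → ℝ} {B : ℝ} (hK : ∀ᵐ ω ∂ν, IntegrableOn (fun θ => k θ ω) (Set.Ioi 0) ∧
      ∫ θ in Set.Ioi 0, k θ ω = K ω ∧ |K ω| ≤ B) :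
    IntegrableOn (fun θ => ∫ ω, k θ ω ∂ν) (Set.Ioi 0) ∧
      ∫ θ in Set.Ioi 0, ∫ ω, k θ ω ∂ν = ∫ ω, K ω ∂ν := by
  have hIntg : Integrable (Function.uncurry k) ((volume.restrict (Set.Ioi (0 : ℝ))).prod ν) := by
    refine (integrable_prod_iff' (f := Function.uncurry k) hk.aestronglyMeasurable).2 ?_
    refine ⟨hK.mono fun ω h => h.1, ?_⟩
    refine Integrable.of_bound (C := B) ?_ ?_
    · exact (hk.norm.stronglyMeasurable.integral_prod_left').aestronglyMeasurable
    · filter_upwards [hK] with ω h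
      have : ∫ θ in Set.Ioi 0, ‖Function.uncurry k (θ, ω)‖ = K ω := by
        rw [← h.2.1]
        refine integral_congr_ae (Eventually.of_forall fun θ => ?_)
        simp [Function.uncurry, abs_of_nonneg (hk0 θ ω)]
      rw [this]; exact h.2.2
  refine ⟨hIntg.integral_prod_left, ?_⟩
  rw [integral_integral_swap hIntg]
  exact integral_congr_ae (hK.mono fun ω h => h.2.1)

lemma exp_int {a : ℝ} (ha : 0 < a) : IntegrableOn (fun θ : ℝ => Real.exp (-(a * θ))) (Set.Ioi 0) ∧
    ∫ θ in Set.Ioi (0 : ℝ), Real.exp (-(a * θ)) = 1 / a := by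
  have h1 := integrableOn_exp_mul_Ioi (neg_lt_zero.2 ha) 0
  have h2 := integral_exp_mul_Ioi (neg_lt_zero.2 ha) 0
  simp only [neg_mul] at h1 h2
  refine ⟨h1, h2.trans ?_⟩
  simp

lemma fub1 {μ : Measure ℝ} [IsProbabilityMeasure μ] (hμ : ∀ᵐ x ∂μ, x ∈ Set.Icc (0 : ℝ) 1) :
    IntegrableOn (fun θ => ∫ x, gg θ x ∂μ) (Set.Ioi 0) ∧
      ∫ θ in Set.Ioi 0, ∫ x, gg θ x ∂μ = ∫ x, x ∂μ := by
  refine fub gg_meas gg_nonneg (B := 1) ?_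
  filter_upwards [hμ] with x hx
  refine ⟨?_, ?_, by rw [abs_of_nonneg hx.1]; exact hx.2⟩ <;> unfold gg <;> split_ifs with h
  · have := (exp_int (a := 1 / x) (by positivity)).1
    refine this.congr_fun (fun θ _ => ?_) measurableSet_Ioi
    simp only; congr 2; ring
  · exact integrableOn_zero
  · have := (exp_int (a := 1 / x) (by positivity)).2
    rw [one_div_one_div] at this
    conv_rhs => rw [← this]
    congr 1; ext θ; congr 2; ring
  · simp; linarith [hx.1]

/-- the ratio kernel. -/
def kap (x z : ℝ) : ℝ := if 0 < x ∧ 0 < z then x / (x + z) else 0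

lemma fub2 {μ : Measure ℝ} [IsProbabilityMeasure μ] {Z : Ω → ℝ} (hZ : Measurable Z)
    (hZ0 : ∀ᵐ ω ∂ν, 0 ≤ Z ω) :
    IntegrableOn (fun θ => (∫ x, gg θ x ∂μ) * ∫ ω, 1 / Z ω * gg θ (Z ω) ∂ν) (Set.Ioi 0) ∧
      ∫ θ in Set.Ioi 0, (∫ x, gg θ x ∂μ) * ∫ ω, 1 / Z ω * gg θ (Z ω) ∂ν =
        ∫ q, kap q.1 (Z q.2) ∂(μ.prod ν) := by
  have e : ∀ θ, (∫ x, gg θ x ∂μ) * ∫ ω, 1 / Z ω * gg θ (Z ω) ∂ν =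
      ∫ q : ℝ × Ω, gg θ q.1 * (1 / Z q.2 * gg θ (Z q.2)) ∂(μ.prod ν) := fun θ =>
    (integral_prod_mul (gg θ) (fun ω => 1 / Z ω * gg θ (Z ω))).symm
  have hr0 : ∀ θ z : ℝ, 0 ≤ 1 / z * gg θ z := by
    intro θ z
    by_cases h : 0 < z
    · exact mul_nonneg (by positivity) (gg_nonneg _ _)
    · rw [gg, if_neg h, mul_zero]
  simp_rw [e]
  refine fub (k := fun θ (q : ℝ × Ω) => gg θ q.1 * (1 / Z q.2 * gg θ (Z q.2))) (B := 1) ?_ ?_ ?_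
  · have h1 : Measurable (fun q : ℝ × ℝ × Ω => gg q.1 q.2.1) :=
      gg_meas.comp (measurable_fst.prodMk (measurable_fst.comp measurable_snd))
    have hz : Measurable (fun q : ℝ × ℝ × Ω => Z q.2.2) :=
      hZ.comp (measurable_snd.comp measurable_snd)
    have h2 : Measurable (fun q : ℝ × ℝ × Ω => gg q.1 (Z q.2.2)) :=
      gg_meas.comp (measurable_fst.prodMk hz)
    exact h1.mul ((measurable_const.div hz).mul h2)
  · intro θ q
    exact mul_nonneg (gg_nonneg _ _) (hr0 _ _)
  · refine Eventually.of_forall fun q => ?_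
    by_cases h : 0 < q.1 ∧ 0 < Z q.2
    · obtain ⟨h1, h2⟩ := h
      have ha : 0 < 1 / q.1 + 1 / Z q.2 := by positivity
      have hfun : ∀ θ : ℝ, gg θ q.1 * (1 / Z q.2 * gg θ (Z q.2)) =
          1 / Z q.2 * Real.exp (-((1 / q.1 + 1 / Z q.2) * θ)) := by
        intro θ
        rw [gg, gg, if_pos h1, if_pos h2]
        have : -((1 / q.1 + 1 / Z q.2) * θ) = -(θ / q.1) + -(θ / Z q.2) := by ring
        rw [this, Real.exp_add]; ring
      simp_rw [hfun]
      have hk : kap q.1 (Z q.2) = q.1 / (q.1 + Z q.2) := if_pos ⟨h1, h2⟩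
      refine ⟨(exp_int ha).1.const_mul _, ?_, ?_⟩
      · rw [integral_const_mul, (exp_int ha).2, hk]; field_simp; ring
      · rw [hk, abs_of_nonneg (by positivity), div_le_one (by positivity)]; linarith
    · have hfun : ∀ θ : ℝ, gg θ q.1 * (1 / Z q.2 * gg θ (Z q.2)) = 0 := by
        intro θ
        by_cases h1 : 0 < q.1
        · have h2 : ¬ 0 < Z q.2 := fun h2 => h ⟨h1, h2⟩
          rw [gg, gg, if_neg h2]; ring
        · rw [gg, if_neg h1]; ring
      simp_rw [hfun]
      have hk : kap q.1 (Z q.2) = 0 := if_neg h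
      rw [hk]
      exact ⟨integrableOn_zero, by simp, by simp⟩

end Ana

section Fix
open MeasureTheory Topology

variable {d : ℕ} {μ : Measure ℝ} [IsProbabilityMeasure μ]

lemma sum_meas (m : ℕ) : Measurable (fun y : Fin m → ℝ => ∑ j, y j) := by fun_prop

lemma posind (m : ℕ) (hμ : ∀ᵐ x ∂μ, x ∈ Set.Icc (0 : ℝ) 1) :
    ∫ y, gg 0 (∑ j, y j) ∂(Measure.pi fun _ : Fin m => μ) = 1 - (1 - ∫ x, gg 0 x ∂μ) ^ m := by
  have h1 : ∫ y, ∏ j, (1 - gg 0 (y j)) ∂(Measure.pi fun _ : Fin m => μ) =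
      (1 - ∫ x, gg 0 x ∂μ) ^ m := by
    rw [integral_fintype_prod_eq_prod (fun (_ : Fin m) x => 1 - gg 0 x)]
    have hi : Integrable (fun x => gg 0 x) μ := gg_int measurable_id le_rfl
    rw [integral_sub (integrable_const _) hi]
    simp
  have h2 : ∫ y, gg 0 (∑ j, y j) ∂(Measure.pi fun _ : Fin m => μ) =
      ∫ y, (1 - ∏ j, (1 - gg 0 (y j))) ∂(Measure.pi fun _ : Fin m => μ) := by
    refine integral_congr_ae ?_
    filter_upwards [pi_Icc (d := m) hμ] with y hy
    rw [gg_zero]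
    split_ifs with h
    · obtain ⟨j, _, hj⟩ := Finset.exists_lt_of_sum_lt (s := Finset.univ) (f := fun _ : Fin m => (0:ℝ))
        (g := y) (by simpa using h)
      rw [Finset.prod_eq_zero (Finset.mem_univ j)]
      · ring
      · rw [gg_zero, if_pos hj]; ring
    · have h0 : ∀ j, y j ≤ 0 := fun j => by
        have := Finset.single_le_sum (f := y) (fun i _ => (hy i).1) (Finset.mem_univ j)
        linarith
      rw [Finset.prod_eq_one]
      · ring
      · intro j _
        rw [gg_zero, if_neg (not_lt.2 (h0 j))]; ring
  rw [h2, integral_sub (integrable_const _), h1]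
  · simp
  · refine Integrable.of_bound (C := 1) ?_ ?_
    · refine (Finset.measurable_prod _ fun j _ => ?_).aestronglyMeasurable
      exact measurable_const.sub ((gg_meas2 0).comp (measurable_pi_apply j))
    · refine Eventually.of_forall fun y => ?_
      have h : ∀ j, 0 ≤ 1 - gg 0 (y j) ∧ 1 - gg 0 (y j) ≤ 1 := fun j =>
        ⟨by linarith [gg_le_one le_rfl (y j)], by linarith [gg_nonneg 0 (y j)]⟩
      rw [Real.norm_eq_abs, abs_of_nonneg (Finset.prod_nonneg fun j _ => (h j).1)]
      exact Finset.prod_le_one (fun j _ => (h j).1) fun j _ => (h j).2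

lemma ratio_int (hμ : ∀ᵐ x ∂μ, x ∈ Set.Icc (0 : ℝ) 1) (m : ℕ) (i : Fin m) :
    Integrable (fun y : Fin m → ℝ => y i / ∑ j, y j) (Measure.pi fun _ : Fin m => μ) := by
  refine Integrable.of_bound (C := 1) ?_ ?_
  · exact ((measurable_pi_apply i).div (sum_meas m)).aestronglyMeasurable
  · filter_upwards [pi_Icc (d := m) hμ] with y hy
    have h0 := Finset.single_le_sum (f := y) (fun i _ => (hy i).1) (Finset.mem_univ i)
    have h1 := (hy i).1
    rw [Real.norm_eq_abs, abs_of_nonneg (div_nonneg h1 (h1.trans h0))]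
    exact div_le_one_of_le₀ h0 (h1.trans h0)

lemma exch (hμ : ∀ᵐ x ∂μ, x ∈ Set.Icc (0 : ℝ) 1) :
    ((d : ℝ) + 1) * ∫ q, q.1 / (q.1 + ∑ j, q.2 j) ∂(μ.prod (Measure.pi fun _ : Fin d => μ)) =
      1 - (1 - ∫ x, gg 0 x ∂μ) ^ (d + 1) := by
  have key : ∀ i : Fin (d + 1), ∫ y, y i / ∑ j, y j ∂(Measure.pi fun _ : Fin (d + 1) => μ) =
      ∫ q, q.1 / (q.1 + ∑ j, q.2 j) ∂(μ.prod (Measure.pi fun _ : Fin d => μ)) := by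
    intro i
    have := (measurePreserving_piFinSuccAbove (fun _ : Fin (d + 1) => μ) i).integral_comp'
      (fun q : ℝ × (Fin d → ℝ) => q.1 / (q.1 + ∑ j, q.2 j))
    rw [← this]
    refine integral_congr_ae (Eventually.of_forall fun y => ?_)
    simp only [MeasurableEquiv.piFinSuccAbove_apply, Fin.insertNthEquiv_symm_apply]
    rw [Fin.sum_univ_succAbove _ i]
    rfl
  rw [← posind (d + 1) hμ]
  have : ∫ y, gg 0 (∑ j, y j) ∂(Measure.pi fun _ : Fin (d + 1) => μ) =
      ∫ y, ∑ i, y i / ∑ j, y j ∂(Measure.pi fun _ : Fin (d + 1) => μ) := by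
    refine integral_congr_ae ?_
    filter_upwards [pi_Icc (d := d + 1) hμ] with y hy
    have h0 := (sum_Icc hy).1
    rw [← Finset.sum_div, gg_zero]
    split_ifs with h
    · rw [div_self h.ne']
    · rw [le_antisymm (not_lt.1 h) h0]; simp
  rw [this, integral_finsetSum _ fun i _ => ratio_int hμ _ i]
  simp_rw [key]
  simp

lemma kap_int (hμ : ∀ᵐ x ∂μ, x ∈ Set.Icc (0 : ℝ) 1) :
    ∫ q, kap q.1 (∑ j, q.2 j) ∂(μ.prod (Measure.pi fun _ : Fin d => μ)) =
      (1 - (1 - ∫ x, gg 0 x ∂μ) ^ (d + 1)) / (d + 1) -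
        (∫ x, gg 0 x ∂μ) * (1 - ∫ x, gg 0 x ∂μ) ^ d := by
  set p := ∫ x, gg 0 x ∂μ with hp
  have hpos : ∀ᵐ q ∂(μ.prod (Measure.pi fun _ : Fin d => μ)), 0 ≤ q.1 ∧ 0 ≤ ∑ j, q.2 j := by
    have h1 : ∀ᵐ q ∂(μ.prod (Measure.pi fun _ : Fin d => μ)), q.1 ∈ Set.Icc (0:ℝ) 1 :=
      Measure.quasiMeasurePreserving_fst.ae hμ
    have h2 : ∀ᵐ q ∂(μ.prod (Measure.pi fun _ : Fin d => μ)), ∀ j, q.2 j ∈ Set.Icc (0:ℝ) 1 :=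
      Measure.quasiMeasurePreserving_snd.ae (pi_Icc (d := d) hμ)
    filter_upwards [h1, h2] with q a b
    exact ⟨a.1, (sum_Icc b).1⟩
  have hm2 : Measurable (fun q : ℝ × (Fin d → ℝ) => ∑ j, q.2 j) :=
    (sum_meas d).comp measurable_snd
  have e1 : ∫ q, kap q.1 (∑ j, q.2 j) ∂(μ.prod (Measure.pi fun _ : Fin d => μ)) =
      ∫ q, (q.1 / (q.1 + ∑ j, q.2 j) - gg 0 q.1 * (1 - gg 0 (∑ j, q.2 j)))
        ∂(μ.prod (Measure.pi fun _ : Fin d => μ)) := by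
    refine integral_congr_ae ?_
    filter_upwards [hpos] with q hq
    obtain ⟨a, b⟩ := hq
    simp only [kap, gg_zero]
    by_cases h1 : 0 < q.1
    · by_cases h2 : 0 < ∑ j, q.2 j
      · simp [h1, h2]
      · have h3 : ∑ j, q.2 j = 0 := le_antisymm (not_lt.1 h2) b
        simp [h1, h3, h1.ne']
    · have h3 : q.1 = 0 := le_antisymm (not_lt.1 h1) a
      simp [h3]
  have e2 : ∫ q, gg 0 q.1 * (1 - gg 0 (∑ j, q.2 j)) ∂(μ.prod (Measure.pi fun _ : Fin d => μ)) =
      p * (1 - p) ^ d := by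
    rw [integral_prod_mul (gg 0) (fun y : Fin d → ℝ => 1 - gg 0 (∑ j, y j))]
    rw [integral_sub (integrable_const _) (gg_int (sum_meas d) le_rfl), posind d hμ, ← hp]
    simp
  rw [e1, integral_sub, e2]
  · congr 1
    have h := exch (d := d) hμ
    have : (d : ℝ) + 1 ≠ 0 := by positivity
    rw [eq_div_iff this, ← h]; ring
  · refine Integrable.of_bound (C := 1) (measurable_fst.div (measurable_fst.add hm2)).aestronglyMeasurable ?_
    filter_upwards [hpos] with q hq
    obtain ⟨a, b⟩ := hq
    rw [Real.norm_eq_abs, abs_of_nonneg (div_nonneg a (add_nonneg a b))]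
    exact div_le_one_of_le₀ (by linarith) (by linarith)
  · refine Integrable.of_bound (C := 1) ?_ ?_
    · exact (((gg_meas2 0).comp measurable_fst).mul (measurable_const.sub
        ((gg_meas2 0).comp hm2))).aestronglyMeasurable
    · refine Eventually.of_forall fun q => ?_
      have a1 := gg_nonneg 0 q.1
      have a2 := gg_le_one le_rfl q.1
      have b1 := gg_nonneg 0 (∑ j, q.2 j)
      have b2 := gg_le_one le_rfl (∑ j, q.2 j)
      rw [Real.norm_eq_abs, abs_le]
      constructor <;> nlinarith

lemma fixpt (hμ : ∀ᵐ x ∂μ, x ∈ Set.Icc (0 : ℝ) 1) {c : ℝ} (hc : 0 ≤ c)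
    (h : ∀ θ > 0, ∫ x, eg θ x ∂μ = Real.exp (-(θ + c * (1 - ∫ y, eg θ (∑ j, y j)
      ∂(Measure.pi fun _ : Fin d => μ))))) :
    ∃ p : ℝ, 0 < p ∧ p ≤ 1 ∧ p = Real.exp (-(c * (1 - p) ^ d)) ∧
      ∫ x, x ∂μ = p + c * p * (1 - p) ^ d - c / (d + 1) * (1 - (1 - p) ^ (d + 1)) := by
  set π := (Measure.pi fun _ : Fin d => μ) with hπ
  set G : ℝ → ℝ := fun θ => ∫ x, gg θ x ∂μ with hG
  set Φ : ℝ → ℝ := fun θ => ∫ y, gg θ (∑ j, y j) ∂π with hΦ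
  set H : ℝ → ℝ := fun θ => Real.exp (-(θ + c * (1 - Φ θ))) with hH
  have hGH : ∀ θ > 0, G θ = H θ := by
    intro θ hθ
    have := h θ hθ
    simp only [hG, hH, hΦ, gg_eq_eg hθ]
    exact this
  have hGc : ContinuousWithinAt G (Set.Ici 0) 0 := G_cont measurable_id
  have hΦc : ContinuousWithinAt Φ (Set.Ici 0) 0 := G_cont (sum_meas d)
  have hHc : ContinuousWithinAt H (Set.Ici 0) 0 := by
    refine Real.continuous_exp.continuousAt.comp_continuousWithinAt ?_
    exact (continuousWithinAt_id.add (continuousWithinAt_const.mul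
      (continuousWithinAt_const.sub hΦc))).neg
  have h00 : G 0 = H 0 := by
    have t1 : Tendsto G (𝓝[>] 0) (𝓝 (G 0)) := hGc.mono_left (nhdsWithin_mono _ Set.Ioi_subset_Ici_self)
    have t2 : Tendsto H (𝓝[>] 0) (𝓝 (H 0)) := hHc.mono_left (nhdsWithin_mono _ Set.Ioi_subset_Ici_self)
    refine tendsto_nhds_unique t1 (t2.congr' ?_)
    filter_upwards [self_mem_nhdsWithin] with θ hθ using (hGH θ hθ).symm
  have hΦ0 : Φ 0 = 1 - (1 - G 0) ^ d := posind d hμ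
  have hfp : G 0 = Real.exp (-(c * (1 - G 0) ^ d)) := by
    have h01 : G 0 = Real.exp (-(0 + c * (1 - Φ 0))) := h00
    rw [hΦ0] at h01
    refine h01.trans ?_
    congr 1; ring
  have hΦ1 : ∀ θ ≥ 0, Φ θ ≤ 1 := by
    intro θ hθ
    calc Φ θ ≤ ∫ _, (1:ℝ) ∂π := integral_mono (gg_int (sum_meas d) hθ) (integrable_const _)
          fun y => gg_le_one hθ _
      _ = 1 := by simp
  have hHle : ∀ θ ≥ 0, H θ ≤ Real.exp (-θ) := by
    intro θ hθ
    refine Real.exp_le_exp.2 ?_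
    have := mul_nonneg hc (sub_nonneg.2 (hΦ1 θ hθ))
    linarith
  set ρ : ℝ → ℝ := fun θ => ∫ y, 1 / (∑ j, y j) * gg θ (∑ j, y j) ∂π with hρ
  have hρ0 : ∀ θ, 0 ≤ ρ θ := by
    intro θ
    refine integral_nonneg fun y => ?_
    by_cases hz : 0 < ∑ j, y j
    · exact mul_nonneg (by positivity) (gg_nonneg _ _)
    · simp only [gg, if_neg hz, mul_zero]; exact le_rfl
  have hder : ∀ θ ∈ Set.Ioi (0:ℝ), HasDerivAt H (-(G θ + c * (G θ * ρ θ))) θ := by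
    intro θ hθ
    have h1 : HasDerivAt Φ (-ρ θ) θ := G_deriv (sum_meas d) hθ
    have h2 : HasDerivAt (fun θ => -(θ + c * (1 - Φ θ))) (-(1 + c * (-(-ρ θ)))) θ :=
      ((hasDerivAt_id θ).add ((h1.const_sub 1).const_mul c)).neg
    have h3 := h2.exp
    rw [hGH θ hθ]
    convert h3 using 1
    simp only [hH]; ring
  have hlim : Tendsto H atTop (𝓝 0) := by
    refine tendsto_of_tendsto_of_tendsto_of_le_of_le' tendsto_const_nhds
      (Real.tendsto_exp_neg_atTop_nhds_zero) ?_ ?_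
    · exact Eventually.of_forall fun θ => (Real.exp_pos _).le
    · filter_upwards [eventually_ge_atTop 0] with θ hθ using hHle θ hθ
  have f1 := fub1 hμ
  have f2 := fub2 (μ := μ) (ν := π) (sum_meas d) (by
    filter_upwards [pi_Icc (d := d) hμ] with y hy using (sum_Icc hy).1)
  have hI := integral_Ioi_of_hasDerivAt_of_nonpos hHc hder (fun θ hθ => by
    have hg : 0 ≤ G θ := by rw [hGH θ hθ]; exact (Real.exp_pos _).le
    have := mul_nonneg hc (mul_nonneg hg (hρ0 θ))
    linarith) hlim
  rw [integral_neg, integral_add f1.1 (f2.1.const_mul c), integral_const_mul, f1.2, f2.2,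
    kap_int hμ, ← h00] at hI
  refine ⟨G 0, ?_, ?_, hfp, ?_⟩
  · rw [hfp]; exact Real.exp_pos _
  · rw [h00]; exact (hHle 0 le_rfl).trans (by simp)
  · change _ = _ at hI
    have e : (∫ x, gg 0 x ∂μ) = G 0 := rfl
    rw [e] at hI
    have : c / ((d:ℝ) + 1) * (1 - (1 - G 0) ^ (d + 1)) = c * ((1 - (1 - G 0) ^ (d + 1)) / (d + 1)) := by
      ring
    rw [this]
    linarith

/-- the limiting Betti number density -/
def ff (d : ℕ) (c p : ℝ) : ℝ := c * p * (1 - p) ^ d + c / ((d : ℝ) + 1) * (1 - p) ^ (d + 1) - (1 - p)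

lemma limit_ff {d : ℕ} (U : Ultrafilter ℕ) (hU : (U : Filter ℕ) ≤ atTop) (c : ℕ → ℝ) {C c0 : ℝ}
    (hc : ∀ n, 0 ≤ c n ∧ c n ≤ C) (hlim : Tendsto c U (𝓝 c0)) :
    ∃ p : ℝ, 0 < p ∧ p ≤ 1 ∧ p = Real.exp (-(c0 * (1 - p) ^ d)) ∧
      Tendsto (fun n => eK n d (c n / n)) U (𝓝 (ff d c0 p)) := by
  obtain ⟨μ, hprob, hμ, h, ht⟩ := limit_eq (d := d) U hU c hc hlim
  have hc0 : 0 ≤ c0 := ge_of_tendsto' hlim fun n => (hc n).1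
  obtain ⟨p, h1, h2, h3, h4⟩ := fixpt hμ hc0 h
  refine ⟨p, h1, h2, h3, ?_⟩
  convert ht using 2
  rw [h4, ff]
  ring

end Fix

section Root
open Topology

/-- normalised form of `(d+1)(1-t) + (1+dt) log t`. -/
def gk (d : ℕ) (t : ℝ) : ℝ := ((d : ℝ) + 1) * (1 - t) / (1 + d * t) + Real.log t

/-- the inverse of the fixed point as a function of the parameter. -/
def ph (d : ℕ) (t : ℝ) : ℝ := -Real.log t / (1 - t) ^ d

lemma gk_deriv (d : ℕ) {t : ℝ} (ht : 0 < t) :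
    HasDerivAt (gk d) ((((d : ℝ) ^ 2 * t - 1) * (t - 1)) / (t * (1 + d * t) ^ 2)) t := by
  have hpos : 0 < 1 + (d : ℝ) * t := by positivity
  have h1 : HasDerivAt (fun t : ℝ => ((d : ℝ) + 1) * (1 - t)) (((d : ℝ) + 1) * (-1)) t :=
    ((hasDerivAt_id t).const_sub 1).const_mul _
  have h2 : HasDerivAt (fun t : ℝ => 1 + (d : ℝ) * t) ((d : ℝ) * 1) t :=
    ((hasDerivAt_id t).const_mul _).const_add 1
  have h3 := (h1.div h2 hpos.ne').add (Real.hasDerivAt_log ht.ne')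
  refine h3.congr_deriv ?_
  field_simp
  ring

lemma gk_mono {d : ℕ} (hd : 2 ≤ d) : StrictMonoOn (gk d) (Set.Ioc 0 (1 / (d : ℝ) ^ 2)) := by
  have hd' : (2 : ℝ) ≤ d := by exact_mod_cast hd
  have h1 : 1 / (d : ℝ) ^ 2 ≤ 1 := by
    rw [div_le_one (by positivity)]; nlinarith
  refine strictMonoOn_of_deriv_pos (convex_Ioc _ _)
    (fun t ht => (gk_deriv d ht.1).continuousAt.continuousWithinAt) ?_
  intro t ht
  rw [interior_Ioc] at ht
  rw [(gk_deriv d ht.1).deriv]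
  have h2 : (d : ℝ) ^ 2 * t < 1 := by
    have := ht.2
    rw [lt_div_iff₀ (by positivity)] at this; linarith
  have h0 := ht.1
  refine div_pos (mul_pos_of_neg_of_neg (by linarith) (by linarith [ht.2])) (by positivity)

lemma gk_pos {d : ℕ} (hd : 2 ≤ d) {t : ℝ} (h1 : 1 / (d : ℝ) ^ 2 ≤ t) (h2 : t < 1) : 0 < gk d t := by
  have hd' : (2 : ℝ) ≤ d := by exact_mod_cast hd
  have h3 : 1 / (d : ℝ) ^ 2 ≤ 1 := by
    rw [div_le_one (by positivity)]; nlinarith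
  have h0 : 0 < 1 / (d : ℝ) ^ 2 := by positivity
  have : StrictAntiOn (gk d) (Set.Icc (1 / (d : ℝ) ^ 2) 1) := by
    refine strictAntiOn_of_deriv_neg (convex_Icc _ _)
      (fun t ht => (gk_deriv d (h0.trans_le ht.1)).continuousAt.continuousWithinAt) ?_
    intro t ht
    rw [interior_Icc] at ht
    have htp : 0 < t := h0.trans ht.1
    rw [(gk_deriv d htp).deriv]
    have h2 : 1 < (d : ℝ) ^ 2 * t := by
      have := ht.1
      rw [div_lt_iff₀ (by positivity)] at this; linarith
    exact div_neg_of_neg_of_pos (mul_neg_of_pos_of_neg (by linarith) (by linarith [ht.2]))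
      (by positivity)
  have h := this ⟨h1, h2.le⟩ ⟨h3, le_rfl⟩ h2
  have e : gk d 1 = 0 := by simp [gk]
  linarith

variable {d : ℕ}

lemma td_lt (hd : 2 ≤ d) {td : ℝ} (htd : td ∈ Set.Ioo (0 : ℝ) 1) (hroot : gk d td = 0)
    : td < 1 / (d : ℝ) ^ 2 := by
  by_contra h
  have := gk_pos hd (not_lt.1 h) htd.2
  linarith

lemma gk_nonneg (hd : 2 ≤ d) {td : ℝ} (htd : td ∈ Set.Ioo (0 : ℝ) 1) (hroot : gk d td = 0)
    {t : ℝ} (h1 : td ≤ t) (h2 : t ≤ 1) : 0 ≤ gk d t := by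
  rcases h2.eq_or_lt with rfl | h2
  · simp [gk]
  rcases le_or_gt (1 / (d : ℝ) ^ 2) t with h | h
  · exact (gk_pos hd h h2).le
  · rw [← hroot]
    exact (gk_mono hd).monotoneOn ⟨htd.1, (td_lt hd htd hroot).le⟩ ⟨htd.1.trans_le h1, h.le⟩ h1

lemma gk_lt (hd : 2 ≤ d) {td : ℝ} (htd : td ∈ Set.Ioo (0 : ℝ) 1) (hroot : gk d td = 0)
    {s t : ℝ} (h0 : 0 < s) (h1 : s ≤ t) (h2 : t < td) : gk d s ≤ gk d t ∧ gk d t < 0 := by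
  have h3 := td_lt hd htd hroot
  refine ⟨(gk_mono hd).monotoneOn ⟨h0, by linarith⟩ ⟨h0.trans_le h1, by linarith⟩ h1, ?_⟩
  rw [← hroot]
  exact gk_mono hd ⟨h0.trans_le h1, by linarith⟩ ⟨htd.1, h3.le⟩ h2

lemma ph_anti (hd : 2 ≤ d) {td : ℝ} (htd : td ∈ Set.Ioo (0 : ℝ) 1) (hroot : gk d td = 0)
    : StrictAntiOn (ph d) (Set.Ioc 0 td) := by
  have hd' : (2 : ℝ) ≤ d := by exact_mod_cast hd
  have hlt := td_lt hd htd hroot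
  have hd1 : 1 / (d : ℝ) ^ 2 ≤ 1 / d := by
    rw [div_le_div_iff₀ (by positivity) (by positivity)]; nlinarith
  have kd : ∀ t : ℝ, 0 < t → HasDerivAt (fun t : ℝ => 1 / t + d * Real.log t)
      ((d * t - 1) / t ^ 2) t := by
    intro t ht
    have h1 : HasDerivAt (fun t : ℝ => 1 / t) (-1 / t ^ 2) t := by
      simpa using (hasDerivAt_id t).fun_inv ht.ne'
    refine (h1.add ((Real.hasDerivAt_log ht.ne').const_mul (d : ℝ))).congr_deriv ?_
    field_simp; ring
  have kanti : StrictAntiOn (fun t : ℝ => 1 / t + d * Real.log t) (Set.Ioc 0 (1 / d)) := by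
    refine strictAntiOn_of_deriv_neg (convex_Ioc _ _)
      (fun t ht => (kd t ht.1).continuousAt.continuousWithinAt) ?_
    intro t ht
    rw [interior_Ioc] at ht
    rw [(kd t ht.1).deriv]
    have := ht.2
    rw [lt_div_iff₀ (by positivity)] at this
    have h0 := ht.1
    exact div_neg_of_neg_of_pos (by linarith) (by positivity)
  have ktd : 1 < 1 / td + d * Real.log td := by
    have h0 := htd.1
    have hl : Real.log td = -(((d : ℝ) + 1) * (1 - td) / (1 + d * td)) := by
      unfold gk at hroot; linarith
    have h2 : (d : ℝ) ^ 2 * td < 1 := by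
      rw [lt_div_iff₀ (by positivity)] at hlt; linarith
    have e : 1 / td + d * Real.log td - 1 = (1 - td) * (1 - (d : ℝ) ^ 2 * td) / (td * (1 + d * td)) := by
      rw [hl]; field_simp; ring
    have : 0 < (1 - td) * (1 - (d : ℝ) ^ 2 * td) / (td * (1 + d * td)) :=
      div_pos (mul_pos (by linarith [htd.2]) (by linarith)) (by positivity)
    linarith
  have pd : ∀ t : ℝ, 0 < t → t < 1 → HasDerivAt (ph d)
      ((1 - (1 / t + d * Real.log t)) / (1 - t) ^ (d + 1)) t := by
    intro t h0 h1
    have hne : (1 - t) ≠ 0 := by linarith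
    have a1 : HasDerivAt (fun t : ℝ => -Real.log t) (-t⁻¹) t := (Real.hasDerivAt_log h0.ne').neg
    have a2 : HasDerivAt (fun t : ℝ => (1 - t) ^ d) ((d : ℝ) * (1 - t) ^ (d - 1) * (-1)) t :=
      ((hasDerivAt_id t).const_sub 1).pow d
    refine (a1.div a2 (pow_ne_zero _ hne)).congr_deriv ?_
    obtain ⟨k, rfl⟩ : ∃ k, d = k + 1 := ⟨d - 1, by omega⟩
    simp only [Nat.add_sub_cancel]
    field_simp
    push_cast
    ring
  refine strictAntiOn_of_deriv_neg (convex_Ioc _ _)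
    (fun t ht => (pd t ht.1 (ht.2.trans_lt htd.2)).continuousAt.continuousWithinAt) ?_
  intro t ht
  rw [interior_Ioc] at ht
  rw [(pd t ht.1 (ht.2.trans htd.2)).deriv]
  have h1 := kanti ⟨ht.1, by linarith [ht.2]⟩ ⟨htd.1, by linarith⟩ ht.2
  simp only at h1
  exact div_neg_of_neg_of_pos (by linarith) (pow_pos (by linarith [ht.2, htd.2]) _)

lemma ph_of_fix {c p : ℝ} (h1 : p < 1) (h : p = Real.exp (-(c * (1 - p) ^ d))) :
    ph d p = c := by
  have : Real.log p = -(c * (1 - p) ^ d) := by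
    conv_lhs => rw [h]
    exact Real.log_exp _
  rw [ph, this]
  have : (1 - p) ^ d ≠ 0 := pow_ne_zero _ (by linarith)
  field_simp

lemma ff_of_fix {c p : ℝ} (h0 : 0 < p) (h : p = Real.exp (-(c * (1 - p) ^ d))) :
    ff d c p = -((1 + d * p) * gk d p) / (d + 1) := by
  have h1 : c * (1 - p) ^ d = -Real.log p := by
    have : Real.log p = -(c * (1 - p) ^ d) := by
      conv_lhs => rw [h]
      exact Real.log_exp _
    linarith
  have e : ff d c p = p * (c * (1 - p) ^ d) + (1 - p) / ((d : ℝ) + 1) * (c * (1 - p) ^ d) - (1 - p) := by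
    rw [ff]; ring
  rw [e, h1, gk]
  have : 0 < 1 + (d : ℝ) * p := by positivity
  field_simp
  ring

lemma tc_lt {c td tc : ℝ} (htd : td ∈ Set.Ioo (0 : ℝ) 1) (hc : ph d td < c)
    (htcmin : ∀ t ∈ Set.Ioo (0 : ℝ) 1, t = Real.exp (-c * (1 - t) ^ d) → tc ≤ t) : tc < td := by
  have hpow : 0 < (1 - td) ^ d := pow_pos (by linarith [htd.2]) _
  have hlog : Real.log td < 0 := Real.log_neg htd.1 htd.2
  have hc0 : 0 < c := lt_trans (div_pos (by linarith) hpow) hc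
  have hl : 0 < Real.log td + c * (1 - td) ^ d := by
    rw [ph, div_lt_iff₀ hpow] at hc; linarith
  have hle : Real.exp (-c) ≤ td := by
    rw [← Real.log_le_log_iff (Real.exp_pos _) htd.1, Real.log_exp]
    have : (1 - td) ^ d ≤ 1 := pow_le_one₀ (by linarith [htd.2]) (by linarith [htd.1])
    nlinarith
  have hcont : ContinuousOn (fun t => Real.log t + c * (1 - t) ^ d) (Set.Icc (Real.exp (-c)) td) := by
    refine ContinuousOn.add (Real.continuousOn_log.mono ?_) (by fun_prop)
    intro t ht
    exact ((Real.exp_pos _).trans_le ht.1).ne'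
  have h1 : Real.log (Real.exp (-c)) + c * (1 - Real.exp (-c)) ^ d ≤ 0 := by
    rw [Real.log_exp]
    have : (1 - Real.exp (-c)) ^ d ≤ 1 := pow_le_one₀ (by linarith [htd.2]) (by linarith [Real.exp_pos (-c)])
    nlinarith
  obtain ⟨t, ht, h0⟩ := intermediate_value_Icc hle hcont ⟨h1, hl.le⟩
  simp only at h0
  have htpos : 0 < t := (Real.exp_pos _).trans_le ht.1
  have hne : t ≠ td := by
    rintro rfl; linarith
  have hlt : t < td := lt_of_le_of_ne ht.2 hne
  refine (htcmin t ⟨htpos, hlt.trans htd.2⟩ ?_).trans_lt hlt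
  rw [show -c * (1 - t) ^ d = Real.log t by linarith, Real.exp_log htpos]

end Root

section Final
open Topology

lemma eK_ge {n d : ℕ} {p : ℝ} (hp0 : 0 ≤ p) (hp1 : p ≤ 1) (hn : d < n) :
    p * ((n - d) / (d + 1)) - 1 ≤ eK n d p := by
  have hb : (0 : ℝ) < n.choose d := by exact_mod_cast Nat.choose_pos hn.le
  have h1 := bE_mono hp0 hp1 (S := allFaces n d) (X := fun F => (F.card : ℝ) - n.choose d)
    (Y := fun F => (dimKer n F : ℝ)) fun F hF =>
      dimKer_ge F (d := d) (fun σ hσ => mem_allFaces.1 (hF hσ))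
  rw [bE_sub, bE_card, bE_const, card_allFaces, choose_ratio hn] at h1
  rw [eK, le_div_iff₀ hb]
  calc _ = p * (n.choose d * ((n - d) / (d + 1))) - n.choose d := by ring
    _ ≤ _ := h1

lemma eK_big {d : ℕ} {C : ℝ} (hC : 2 * (d : ℝ) + 2 ≤ C) :
    ∀ᶠ n : ℕ in atTop, (1 / 2 : ℝ) ≤ eK n d (C / n) := by
  have hC0 : 0 < C := by
    have : (0 : ℝ) ≤ d := Nat.cast_nonneg d
    linarith
  have h1 : Tendsto (fun n : ℕ => C / (n : ℝ) * ((n - d) / (d + 1)) - 1) atTop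
      (𝓝 (C * ((1 - d * 0) / (d + 1)) - 1)) := by
    have hi : Tendsto (fun n : ℕ => ((n : ℝ))⁻¹) atTop (𝓝 0) := tendsto_inv_atTop_nhds_zero_nat
    have := ((((hi.const_mul (d : ℝ)).const_sub 1).div_const ((d : ℝ) + 1)).const_mul C).sub_const 1
    refine this.congr' ?_
    filter_upwards [eventually_gt_atTop 0] with n hn
    have : (n : ℝ) ≠ 0 := by exact_mod_cast hn.ne'
    field_simp
  have h2 : (1 / 2 : ℝ) < C * ((1 - d * 0) / (d + 1)) - 1 := by
    have hp : (0 : ℝ) < (d : ℝ) + 1 := by positivity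
    have : C * ((1 - d * 0) / ((d : ℝ) + 1)) = C / (d + 1) := by simp [div_eq_mul_inv]
    rw [this]
    have : 2 ≤ C / ((d : ℝ) + 1) := by rw [le_div_iff₀ hp]; linarith
    linarith
  filter_upwards [h1.eventually_const_lt h2, eventually_gt_atTop d,
    tendsto_natCast_atTop_atTop.eventually_ge_atTop C] with n hn1 hn2 hn3
  have hn0 : (0 : ℝ) < n := hC0.trans_le hn3
  refine hn1.le.trans (eK_ge (by positivity) ?_ hn2)
  rwa [div_le_one hn0]

lemma mean_limit {d : ℕ} (hd : 2 ≤ d) {c td tc : ℝ} (htd : td ∈ Set.Ioo (0 : ℝ) 1)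
    (hroot : gk d td = 0) (hc : ph d td < c) (htc : tc ∈ Set.Ioo (0 : ℝ) 1)
    (htcroot : tc = Real.exp (-c * (1 - tc) ^ d))
    (htcmin : ∀ t ∈ Set.Ioo (0 : ℝ) 1, t = Real.exp (-c * (1 - t) ^ d) → tc ≤ t) :
    Tendsto (fun n : ℕ => eK n d (c / n)) atTop (𝓝 (ff d c tc)) := by
  have htl := tc_lt htd hc htcmin
  have hc0 : 0 < c := lt_trans (div_pos (neg_pos.2 (Real.log_neg htd.1 htd.2))
    (pow_pos (by linarith [htd.2]) _)) hc
  have hphc : ph d tc = c := ph_of_fix htc.2 (by rw [← neg_mul]; exact htcroot)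
  have hanti := ph_anti hd htd hroot
  have hdp : (0 : ℝ) < (d : ℝ) + 1 := by positivity
  have hgneg := (gk_lt hd htd hroot htc.1 le_rfl htl).2
  set η : ℝ := min (-gk d tc / (2 * (d + 1))) (1 / 4) with hη
  have hη0 : 0 < η := lt_min (div_pos (by linarith) (by positivity)) (by norm_num)
  have hη1 : η ≤ 1 / 4 := min_le_right _ _
  have hη2 : η < -gk d tc / (d + 1) := by
    refine (min_le_left _ _).trans_lt ?_
    rw [div_lt_div_iff₀ (by positivity) hdp]
    nlinarith
  -- dichotomy
  have dich : ∀ c' p : ℝ, c ≤ c' → 0 < p → p ≤ 1 → p = Real.exp (-(c' * (1 - p) ^ d)) →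
      (ff d c' p ≤ 0 ∨ (p ≤ tc ∧ η < ff d c' p)) := by
    intro c' p hc' h0 h1 hfix
    rcases le_or_gt td p with h | h
    · left
      rw [ff_of_fix h0 hfix]
      have := gk_nonneg hd htd hroot h h1
      exact div_nonpos_of_nonpos_of_nonneg (neg_nonpos.2 (mul_nonneg (by positivity) this)) hdp.le
    · right
      have hp1 : p < 1 := h.trans htd.2
      have hph := ph_of_fix hp1 hfix
      have hle : p ≤ tc := by
        by_contra hlt
        have := hanti ⟨htc.1, htl.le⟩ ⟨h0, h.le⟩ (not_le.1 hlt)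
        linarith
      refine ⟨hle, ?_⟩
      rw [ff_of_fix h0 hfix]
      refine hη2.trans_le ?_
      have hg := gk_lt hd htd hroot h0 hle htl
      rw [div_le_div_iff_of_pos_right hdp]
      have : 0 ≤ (d : ℝ) * p * (-gk d p) := mul_nonneg (by positivity) (by linarith)
      nlinarith
  rw [tendsto_iff_ultrafilter]
  intro U hU
  obtain ⟨p, h0, h1, hfix, hlim⟩ := limit_ff (d := d) U hU (fun _ => c) (C := c)
    (fun _ => ⟨hc0.le, le_rfl⟩) tendsto_const_nhds
  rcases dich c p le_rfl h0 h1 hfix with hneg | ⟨hple, -⟩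
  swap
  · -- p = tc
    have : p = tc := by
      by_contra hne
      have hlt := lt_of_le_of_ne hple hne
      have := hanti ⟨h0, (hlt.trans htl).le⟩ ⟨htc.1, htl.le⟩ hlt
      rw [ph_of_fix (hlt.trans htc.2) hfix] at this
      linarith
    rw [← this]; exact hlim
  exfalso
  set C : ℝ := max c (2 * d + 2) with hC
  have hcC : c ≤ C := le_max_left _ _
  have hlow : ∀ᶠ n in (U : Filter ℕ), eK n d (c / n) < η := hlim.eventually_lt_const (by linarith)
  have hhigh : ∀ᶠ n in (U : Filter ℕ), (1 / 2 : ℝ) ≤ eK n d (C / n) := hU (eK_big (le_max_right _ _))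
  have hex : ∀ n : ℕ, ∃ x ∈ Set.Icc c C, (eK n d (c / n) < η ∧ (1 / 2 : ℝ) ≤ eK n d (C / n)) →
      eK n d (x / n) = η := by
    intro n
    by_cases hh : eK n d (c / n) < η ∧ (1 / 2 : ℝ) ≤ eK n d (C / n)
    · have hcont : Continuous (fun x : ℝ => eK n d (x / n)) := by
        unfold eK
        exact ((bE_continuous _ _).comp (continuous_id.div_const _)).div_const _
      obtain ⟨x, hx, he⟩ := intermediate_value_Icc hcC hcont.continuousOn
        (show η ∈ Set.Icc _ _ from ⟨hh.1.le, by linarith [hh.2]⟩)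
      exact ⟨x, hx, fun _ => he⟩
    · exact ⟨c, ⟨le_rfl, hcC⟩, fun h => absurd h hh⟩
  choose x hx hxe using hex
  obtain ⟨c0, hc0m, hc0l⟩ := (isCompact_Icc (a := c) (b := C)).ultrafilter_le_nhds (U.map x)
    (by
      rw [le_principal_iff]
      exact Eventually.of_forall (f := (U : Filter ℕ)) hx)
  have hxl : Tendsto x U (𝓝 c0) := hc0l
  obtain ⟨q, hq0, hq1, hqfix, hqlim⟩ := limit_ff (d := d) U hU x (C := C)
    (fun n => ⟨hc0.le.trans (hx n).1, (hx n).2⟩) hxl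
  have hconst : Tendsto (fun n => eK n d (x n / n)) U (𝓝 η) := by
    refine tendsto_const_nhds.congr' ?_
    filter_upwards [hlow, hhigh] with n a b using (hxe n ⟨a, b⟩).symm
  have hfe := tendsto_nhds_unique hqlim hconst
  rcases dich c0 q hc0m.1 hq0 hq1 hqfix with h | h
  · linarith
  · linarith [h.2]

lemma variance_le {n d : ℕ} {p : ℝ} (hp0 : 0 ≤ p) (hp1 : p ≤ 1) :
    bE (allFaces n d) p (fun F => ((dimKer n F : ℝ) - bE (allFaces n d) p
      (fun F => (dimKer n F : ℝ))) ^ 2) ≤ p * n.choose (d + 1) := by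
  refine (efron_stein hp0 hp1 (fun F => (dimKer n F : ℝ))).trans ?_
  refine mul_le_mul_of_nonneg_left ?_ hp0
  rw [← card_allFaces, ← nsmul_one (allFaces n d).card]
  refine Finset.sum_le_card_nsmul _ _ _ fun σ _ => ?_
  rw [← bE_const (allFaces n d) p 1]
  refine bE_mono hp0 hp1 fun F _ => ?_
  have h := dimKer_insert (F.erase σ) σ
  have e : insert σ (F.erase σ) = insert σ F := by
    ext x; simp only [Finset.mem_insert, Finset.mem_erase]; tauto
  rwa [e] at h

lemma probY_eq (n d : ℕ) (p : ℝ) (E : Finset (Finset (Fin n)) → Prop) :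
    probY n d p E = bE (allFaces n d) p (fun F => if E F then 1 else 0) := by
  unfold probY bE
  refine Finset.sum_congr rfl fun F _ => ?_
  by_cases h : E F <;> simp [h]

lemma cheb {n d : ℕ} {c L ε : ℝ} (hc : 0 < c) (hn : d < n) (hcn : c ≤ n) (hε : 0 < ε)
    (hclose : |eK n d (c / n) - L| ≤ ε / 2) :
    1 - 4 * c / ε ^ 2 / n.choose d ≤
      probY n d (c / n) (fun F => |(dimKer n F : ℝ) / (n.choose d) - L| ≤ ε) ∧
    probY n d (c / n) (fun F => |(dimKer n F : ℝ) / (n.choose d) - L| ≤ ε) ≤ 1 := by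
  have hb : (0 : ℝ) < n.choose d := by exact_mod_cast Nat.choose_pos hn.le
  have hn0 : (0 : ℝ) < n := hc.trans_le hcn
  have hp0 : 0 ≤ c / n := by positivity
  have hp1 : c / n ≤ 1 := by rwa [div_le_one hn0]
  rw [probY_eq]
  constructor
  · set M := bE (allFaces n d) (c / n) (fun F => (dimKer n F : ℝ)) with hM
    have hv := variance_le (n := n) (d := d) hp0 hp1
    rw [← hM] at hv
    have h1 := bE_mono hp0 hp1 (S := allFaces n d)
      (X := fun F => 1 - 4 / (ε * n.choose d) ^ 2 * ((dimKer n F : ℝ) - M) ^ 2)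
      (Y := fun F => if |(dimKer n F : ℝ) / (n.choose d) - L| ≤ ε then 1 else 0) (by
        intro F _
        split_ifs with h
        · have : 0 ≤ 4 / (ε * n.choose d) ^ 2 * ((dimKer n F : ℝ) - M) ^ 2 := by positivity
          linarith
        · have h2 : ε / 2 ≤ |((dimKer n F : ℝ) - M) / n.choose d| := by
            have e : (dimKer n F : ℝ) / n.choose d - L =
                ((dimKer n F : ℝ) - M) / n.choose d + (eK n d (c / n) - L) := by
              rw [eK, ← hM]; ring
            rw [e] at h
            have := abs_add_le (((dimKer n F : ℝ) - M) / n.choose d) (eK n d (c / n) - L)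
            push Not at h
            linarith
          have h3 : (ε / 2) ^ 2 ≤ (((dimKer n F : ℝ) - M) / n.choose d) ^ 2 := by
            rw [← sq_abs (((dimKer n F : ℝ) - M) / n.choose d)]
            exact pow_le_pow_left₀ (by positivity) h2 2
          have e2 : 4 / (ε * n.choose d) ^ 2 * ((dimKer n F : ℝ) - M) ^ 2 =
              (((dimKer n F : ℝ) - M) / n.choose d) ^ 2 / (ε / 2) ^ 2 := by
            field_simp; ring
          have : 1 ≤ (((dimKer n F : ℝ) - M) / n.choose d) ^ 2 / (ε / 2) ^ 2 := by
            rwa [one_le_div (by positivity)]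
          linarith)
    rw [bE_sub, bE_const, bE_mul] at h1
    refine le_trans ?_ h1
    have h4 : c / n * n.choose (d + 1) ≤ c * n.choose d := by
      rw [choose_ratio hn]
      have : ((n : ℝ) - d) / (d + 1) ≤ n := by
        rw [div_le_iff₀ (by positivity)]
        nlinarith [mul_nonneg hn0.le (Nat.cast_nonneg (α := ℝ) d), Nat.cast_nonneg (α := ℝ) d]
      calc c / n * (n.choose d * (((n : ℝ) - d) / (d + 1)))
          ≤ c / n * (n.choose d * n) := by gcongr
        _ = c * n.choose d := by field_simp
    have h5 : 4 / (ε * n.choose d) ^ 2 * bE (allFaces n d) (c / n)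
        (fun F => ((dimKer n F : ℝ) - M) ^ 2) ≤ 4 / (ε * n.choose d) ^ 2 * (c * n.choose d) :=
      mul_le_mul_of_nonneg_left (hv.trans h4) (by positivity)
    have h6 : 4 / (ε * n.choose d) ^ 2 * (c * n.choose d) = 4 * c / ε ^ 2 / n.choose d := by
      field_simp
    linarith
  · have := bE_mono hp0 hp1 (S := allFaces n d)
      (X := fun F => if |(dimKer n F : ℝ) / (n.choose d) - L| ≤ ε then (1 : ℝ) else 0)
      (Y := fun _ => 1) (fun F _ => by split_ifs <;> norm_num)
    rwa [bE_const] at this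

lemma choose_tendsto {d : ℕ} (hd : 1 ≤ d) :
    Tendsto (fun n : ℕ => ((n.choose d : ℕ) : ℝ)) atTop atTop := by
  refine tendsto_natCast_atTop_atTop.comp ?_
  refine tendsto_atTop_mono' atTop ?_ (tendsto_sub_atTop_nat d)
  filter_upwards [eventually_gt_atTop d] with n hn
  induction n, hn using Nat.le_induction with
  | base => simp
  | succ n hn ih =>
    obtain ⟨k, rfl⟩ : ∃ k, d = k + 1 := ⟨d - 1, by omega⟩
    rw [Nat.choose_succ_succ']
    have : 0 < n.choose k := Nat.choose_pos (by omega)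
    omega

end Final

end LP

/-- For `d ≥ 2` and `c > c_d^*`, with `t_c` the smallest root in `(0,1)`
of `t = e^{-c(1-t)^d}`, asymptotically almost surely
`dim ker ∂_d(Y_d(n,c/n)) = C(n,d)·(1+o(1))·(c t_c (1-t_c)^d + c/(d+1)·(1-t_c)^{d+1} - (1-t_c))`. -/
theorem statement1 (d : ℕ) (hd : 2 ≤ d) (c td tc : ℝ)
    (htd : td ∈ Set.Ioo (0 : ℝ) 1)
    (hroot : ((d : ℝ) + 1) * (1 - td) + (1 + (d : ℝ) * td) * Real.log td = 0)
    (hc : c > -Real.log td / (1 - td) ^ d)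
    (htc : tc ∈ Set.Ioo (0 : ℝ) 1)
    (htcroot : tc = Real.exp (-c * (1 - tc) ^ d))
    (htcmin : ∀ t ∈ Set.Ioo (0 : ℝ) 1, t = Real.exp (-c * (1 - t) ^ d) → tc ≤ t) :
    ∀ ε > 0, Filter.Tendsto (fun n : ℕ =>
      probY n d (c / n) (fun F =>
        |(dimKer n F : ℝ) / (n.choose d) -
          (c * tc * (1 - tc) ^ d + c / ((d : ℝ) + 1) * (1 - tc) ^ (d + 1) - (1 - tc))| ≤ ε))
      atTop (nhds 1) := by
  intro ε hε
  have hd1 : (0 : ℝ) < 1 + (d : ℝ) * td := by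
    have := htd.1
    positivity
  have hroot' : LP.gk d td = 0 := by
    have h : LP.gk d td = (((d : ℝ) + 1) * (1 - td) + (1 + (d : ℝ) * td) * Real.log td) /
        (1 + d * td) := by
      rw [LP.gk]; field_simp
    rw [h, hroot, zero_div]
  have hc0 : 0 < c := lt_trans (div_pos (neg_pos.2 (Real.log_neg htd.1 htd.2))
    (pow_pos (by linarith [htd.2]) _)) hc
  have hm := LP.mean_limit hd htd hroot' hc htc htcroot htcmin
  have hL : LP.ff d c tc =
      c * tc * (1 - tc) ^ d + c / ((d : ℝ) + 1) * (1 - tc) ^ (d + 1) - (1 - tc) := rfl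
  rw [← hL]
  have hclose : ∀ᶠ n : ℕ in atTop, |LP.eK n d (c / n) - LP.ff d c tc| ≤ ε / 2 := by
    filter_upwards [(Metric.tendsto_nhds.1 hm) (ε / 2) (by linarith)] with n hn
    rw [Real.dist_eq] at hn
    exact hn.le
  have hlow : Tendsto (fun n : ℕ => 1 - 4 * c / ε ^ 2 / ((n.choose d : ℕ) : ℝ)) atTop
      (nhds 1) := by
    simpa using ((LP.choose_tendsto (d := d) (by omega)).const_div_atTop
      (4 * c / ε ^ 2)).const_sub 1
  have hev : ∀ᶠ n : ℕ in atTop, d < n ∧ c ≤ (n : ℝ) ∧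
      |LP.eK n d (c / n) - LP.ff d c tc| ≤ ε / 2 := by
    filter_upwards [hclose, eventually_gt_atTop d,
      tendsto_natCast_atTop_atTop.eventually_ge_atTop c] with n h1 h2 h3
    exact ⟨h2, h3, h1⟩
  refine tendsto_of_tendsto_of_tendsto_of_le_of_le' hlow tendsto_const_nhds ?_ ?_
  · filter_upwards [hev] with n h using (LP.cheb hc0 h.1 h.2.1 hε h.2.2).1
  · filter_upwards [hev] with n h using (LP.cheb hc0 h.1 h.2.1 hε h.2.2).2

end
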